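/- Assume f satisfies assumption (A). There exist ε₀, M > 0 such that for every integer k ≥ 1 and every ε ∈ (0, ε₀], setting ω = (k(k+ε²))^{−1/2}, there exist solutions u_wk^s (defined for x ≥ 0) and u_wk^u (defined for x ≤ 0) of (KG), 2π/ω-periodic and odd in t, whose Fourier expansions contain only modes n ∈ kℤ with n/k odd, satisfying Π_k[∂_x u_wk^⋆(0,·)] = 0 (⋆ = u,s), and such that, for x ≥ 0 when ⋆ = s and x ≤ 0 when ⋆ = u, ‖(1 − (kω)^{−2}∂_t²)( u_wk^⋆(x,·) − √k·εω·v^h(εω√k·x)·sin(kω·) )‖_{ℓ₁} + ‖(1 − (kω)^{−2}∂_t²)( (√k·εω)^{−1}·∂_x u_wk^⋆(x,·) − √k·εω·(v^h)'(εω√k·x)·sin(kω·) )‖_{ℓ₁} ≤ M·k^{−3/2}·ε³·v^h(εω√k·x). -/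

import Mathlib

open Complex Filter MeasureTheory Topology Asymptotics
open scoped ENNReal

noncomputable section

/-- Assumption (A): `f` is (the complex-analytic extension of) a real-analytic odd function
near `0` with `f(u) = O(u⁵)` as `u → 0`. -/
def AssumptionA (f : ℂ → ℂ) : Prop :=
  AnalyticAt ℂ f 0 ∧ (∀ z, f (-z) = - f z) ∧ (∀ x : ℝ, (f (x : ℂ)).im = 0) ∧
    f =O[nhds (0 : ℂ)] fun z => z ^ 5

/-- `u` solves the nonlinear Klein-Gordon equation (KG) for `x ∈ S`. -/
def IsKGSolutionOn (f : ℂ → ℂ) (S : Set ℝ) (u : ℝ → ℝ → ℝ) : Prop :=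
  ∀ x ∈ S, ∀ t : ℝ,
    deriv (fun s => deriv (fun s' => u x s') s) t
      - deriv (fun s => deriv (fun s' => u s' t) s) x
      + u x t - (1 / 3) * u x t ^ 3 - (f (u x t)).re = 0

/-- The `n`-th Fourier coefficient `Π_n[w]` of a `2π/ω`-periodic function
(`w(t) = Σ (−i/2)·w_n·e^{inωt}`). -/
def fCoeff (ω : ℝ) (w : ℝ → ℝ) (n : ℤ) : ℂ :=
  Complex.I * (ω : ℂ) / (Real.pi : ℂ) *
    ∫ t in (-(Real.pi / ω))..(Real.pi / ω),
      (w t : ℂ) * Complex.exp (-(Complex.I * (n : ℂ) * (ω : ℂ) * (t : ℂ)))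

/-- `ℓ₁` norm of `(1 − (kω)^{−2}∂_t²)w`: the operator acts on the mode `e^{inωt}` by
multiplication with `1 + n²/k²`. -/
def l1op (k : ℕ) (ω : ℝ) (w : ℝ → ℝ) : ℝ≥0∞ :=
  ∑' n : ℤ, ENNReal.ofReal (1 + (n : ℝ) ^ 2 / (k : ℝ) ^ 2) * (‖fCoeff ω w n‖₊ : ℝ≥0∞)

/-- The homoclinic solution `v^h(y) = 2√2/cosh y` of the Duffing equation `v'' = v − v³/4`. -/
def vh (y : ℝ) : ℝ := 2 * Real.sqrt 2 / Real.cosh y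


namespace KGP

/-- Submultiplicative weight. -/
def W (m : ℕ) : ℝ := (1 + (m : ℝ)) ^ 2

lemma W_pos (m : ℕ) : 0 < W m := by unfold W; positivity
lemma W_ge (m : ℕ) : 1 ≤ W m := by
  unfold W
  have : (0 : ℝ) ≤ m := by positivity
  nlinarith
lemma W_add (m n : ℕ) : W (m + n) ≤ W m * W n := by
  unfold W
  rw [← mul_pow]
  have h1 : (0 : ℝ) ≤ m := by positivity
  have h2 : (0 : ℝ) ≤ n := by positivity
  have : 0 ≤ (m : ℝ) * n := by positivity
  push_cast
  apply pow_le_pow_left₀ (by positivity)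
  nlinarith
lemma W_mono {m n : ℕ} (h : m ≤ n) : W m ≤ W n := by
  unfold W
  have : (m : ℝ) ≤ n := by exact_mod_cast h
  gcongr

/-- The weighted Wiener algebra of cosine series. -/
def WA : Type := lp (fun _ : ℕ => ℝ) 1

instance : NormedAddCommGroup WA := inferInstanceAs (NormedAddCommGroup (lp (fun _ : ℕ => ℝ) 1))
instance : NormedSpace ℝ WA := inferInstanceAs (NormedSpace ℝ (lp (fun _ : ℕ => ℝ) 1))
instance : CompleteSpace WA := inferInstanceAs (CompleteSpace (lp (fun _ : ℕ => ℝ) 1))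

/-- weighted coordinates -/
def rawL (m : ℕ) : WA →L[ℝ] ℝ := lp.evalCLM ℝ (fun _ : ℕ => ℝ) 1 m

lemma WA_ext {x y : WA} (h : ∀ m, rawL m x = rawL m y) : x = y :=
  lp.ext (funext h)

lemma hasSum_raw (x : WA) : HasSum (fun m => |rawL m x|) ‖x‖ := by
  have := lp.hasSum_norm (E := fun _ : ℕ => ℝ) (p := 1) (by simp) x
  simp only [ENNReal.toReal_one, Real.rpow_one, Real.norm_eq_abs] at this
  exact this

lemma summable_raw (x : WA) : Summable (fun m => |rawL m x|) := (hasSum_raw x).summable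

def mkWA (x : ℕ → ℝ) (h : Summable fun m => |x m|) : WA :=
  (⟨x, by
    apply memℓp_gen
    simpa using h⟩ : lp (fun _ : ℕ => ℝ) 1)

lemma raw_mk (x : ℕ → ℝ) (h : Summable fun m => |x m|) (m : ℕ) : rawL m (mkWA x h) = x m := rfl

lemma norm_mk (x : ℕ → ℝ) (h : Summable fun m => |x m|) : ‖mkWA x h‖ = ∑' m, |x m| :=
  (hasSum_raw (mkWA x h)).tsum_eq.symm

def BB (m : ℕ) : WA := (lp.single 1 m (1 : ℝ) : lp (fun _ : ℕ => ℝ) 1)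

lemma norm_BB (m : ℕ) : ‖BB m‖ = 1 := by
  have := lp.norm_single (E := fun _ : ℕ => ℝ) (p := 1) (by simp) m (1 : ℝ)
  rw [norm_one] at this
  exact this

lemma raw_BB (m n : ℕ) : rawL m (BB n) = if m = n then 1 else 0 := by
  have := lp.single_apply (E := fun _ : ℕ => ℝ) 1 n (1 : ℝ) m
  rw [show rawL m (BB n) = (lp.single 1 n (1 : ℝ) : lp (fun _ : ℕ => ℝ) 1) m from rfl, this]
  simp [Pi.single_apply]

lemma hasSum_BB (x : WA) : HasSum (fun m => rawL m x • BB m) x := by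
  have := lp.hasSum_single (E := fun _ : ℕ => ℝ) (p := 1) (by simp) x
  have e : ∀ m, rawL m x • BB m = (lp.single 1 m (rawL m x) : lp (fun _ : ℕ => ℝ) 1) := by
    intro m
    have := lp.single_smul (E := fun _ : ℕ => ℝ) (𝕜 := ℝ) 1 m (rawL m x) (1 : ℝ)
    rw [smul_eq_mul, mul_one] at this
    exact this.symm
  simp_rw [e]
  exact this

lemma summable_mul_bdd (x : WA) {b : ℕ → ℝ} {C : ℝ} (h : ∀ m, |b m| ≤ C) :
    Summable (fun m => |rawL m x * b m|) := by
  refine Summable.of_nonneg_of_le (fun _ => abs_nonneg _) (fun m => ?_)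
    ((summable_raw x).mul_right C)
  rw [abs_mul]
  exact mul_le_mul_of_nonneg_left (h m) (abs_nonneg _)

lemma tsum_mul_bdd (x : WA) {b : ℕ → ℝ} {C : ℝ} (h : ∀ m, |b m| ≤ C) :
    ∑' m, |rawL m x * b m| ≤ C * ‖x‖ := by
  rw [mul_comm, ← (hasSum_raw x).tsum_eq, ← tsum_mul_right]
  refine (summable_mul_bdd x h).tsum_le_tsum (fun m => ?_) ((summable_raw x).mul_right C)
  rw [abs_mul]
  exact mul_le_mul_of_nonneg_left (h m) (abs_nonneg _)

/-- functional given by bounded weights -/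
def func (b : ℕ → ℝ) (C : ℝ) (h : ∀ m, |b m| ≤ C) : WA →L[ℝ] ℝ :=
  LinearMap.mkContinuous
    { toFun := fun x => ∑' m, rawL m x * b m
      map_add' := fun x y => by
        rw [← Summable.tsum_add (summable_mul_bdd x h).of_abs (summable_mul_bdd y h).of_abs]
        simp [add_mul]
      map_smul' := fun c x => by
        simp [mul_assoc, tsum_mul_left] } C (fun x => by
      refine le_trans ?_ (tsum_mul_bdd x h)
      have := norm_tsum_le_tsum_norm (f := fun m => rawL m x * b m) (summable_mul_bdd x h)
      simpa using this)

lemma func_apply (b : ℕ → ℝ) (C : ℝ) (h : ∀ m, |b m| ≤ C) (x : WA) :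
    func b C h x = ∑' m, rawL m x * b m := rfl

lemma func_hasSum (b : ℕ → ℝ) (C : ℝ) (h : ∀ m, |b m| ≤ C) (x : WA) :
    HasSum (fun m => rawL m x * b m) (func b C h x) := (summable_mul_bdd x h).of_abs.hasSum

lemma func_BB (b : ℕ → ℝ) (C : ℝ) (h : ∀ m, |b m| ≤ C) (n : ℕ) : func b C h (BB n) = b n := by
  rw [func_apply, tsum_eq_single n]
  · simp [raw_BB]
  · intro m hm; simp [raw_BB, hm]

/-- diagonal operator -/
def diag (b : ℕ → ℝ) (C : ℝ) (h : ∀ m, |b m| ≤ C) : WA →L[ℝ] WA :=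
  LinearMap.mkContinuous
    { toFun := fun x => mkWA (fun m => rawL m x * b m) (summable_mul_bdd x h)
      map_add' := fun x y => WA_ext fun m => by simp [raw_mk, add_mul]
      map_smul' := fun c x => WA_ext fun m => by simp [raw_mk, mul_assoc] } C (fun x => by
      refine le_trans (le_of_eq ?_) (tsum_mul_bdd x h)
      exact norm_mk _ (summable_mul_bdd x h))

lemma raw_diag (b : ℕ → ℝ) (C : ℝ) (h : ∀ m, |b m| ≤ C) (x : WA) (m : ℕ) :
    rawL m (diag b C h x) = rawL m x * b m := rfl

lemma norm_diag_le (b : ℕ → ℝ) (C : ℝ) (h : ∀ m, |b m| ≤ C) (x : WA) :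
    ‖diag b C h x‖ ≤ C * ‖x‖ := by
  refine le_trans (le_of_eq ?_) (tsum_mul_bdd x h)
  exact norm_mk _ (summable_mul_bdd x h)

lemma diag_BB (b : ℕ → ℝ) (C : ℝ) (h : ∀ m, |b m| ≤ C) (n : ℕ) :
    diag b C h (BB n) = b n • BB n := by
  refine WA_ext fun m => ?_
  rw [raw_diag, map_smul, raw_BB]
  by_cases h : m = n <;> simp [h]

/-- true cosine coefficient -/
def coefL (m : ℕ) : WA →L[ℝ] ℝ := (W m)⁻¹ • rawL m

lemma raw_eq_coef (m : ℕ) (x : WA) : rawL m x = W m * coefL m x := by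
  simp [coefL, (W_pos m).ne']

lemma coef_ext {x y : WA} (h : ∀ m, coefL m x = coefL m y) : x = y :=
  WA_ext fun m => by rw [raw_eq_coef, raw_eq_coef, h]

lemma coef_diag (b : ℕ → ℝ) (C : ℝ) (h : ∀ m, |b m| ≤ C) (x : WA) (m : ℕ) :
    coefL m (diag b C h x) = coefL m x * b m := by
  simp [coefL, raw_diag, mul_assoc]

/-- basis element `cos (m τ)` -/
def cosE (m : ℕ) : WA := W m • BB m

lemma coef_cosE (m n : ℕ) : coefL m (cosE n) = if m = n then 1 else 0 := by
  simp only [coefL, cosE, _root_.smul_apply, map_smul, raw_BB, smul_eq_mul]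
  by_cases h : m = n
  · subst h; simp [(W_pos m).ne']
  · simp [h]

lemma norm_cosE (m : ℕ) : ‖cosE m‖ = W m := by
  rw [cosE, norm_smul, norm_BB, mul_one, Real.norm_of_nonneg (W_pos m).le]

lemma diag_cosE (b : ℕ → ℝ) (C : ℝ) (h : ∀ m, |b m| ≤ C) (n : ℕ) :
    diag b C h (cosE n) = b n • cosE n := by
  rw [cosE, map_smul, diag_BB, smul_comm]

lemma abs_coef_le (m : ℕ) (x : WA) : |coefL m x| ≤ ‖x‖ := by
  have h1 : |rawL m x| ≤ ‖x‖ := (hasSum_raw x).summable.le_tsum m (fun _ _ => abs_nonneg _)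
    |>.trans (le_of_eq (hasSum_raw x).tsum_eq)
  rw [raw_eq_coef, abs_mul, abs_of_pos (W_pos m)] at h1
  nlinarith [W_ge m, abs_nonneg (coefL m x)]

lemma ev_bound (τ : ℝ) (m : ℕ) : |Real.cos (m * τ) / W m| ≤ 1 := by
  rw [abs_div, abs_of_pos (W_pos m), div_le_one (W_pos m)]
  exact (Real.abs_cos_le_one _).trans (W_ge m)

/-- evaluation of the cosine series -/
def ev (τ : ℝ) : WA →L[ℝ] ℝ := func (fun m => Real.cos (m * τ) / W m) 1 (ev_bound τ)

lemma ev_hasSum (τ : ℝ) (x : WA) : HasSum (fun m : ℕ => coefL m x * Real.cos (m * τ)) (ev τ x) := by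
  have := func_hasSum _ _ (ev_bound τ) x
  refine this.congr_fun ?_
  intro m
  rw [raw_eq_coef]
  field_simp [(W_pos m).ne']

lemma ev_BB (τ : ℝ) (m : ℕ) : ev τ (BB m) = Real.cos (m * τ) / W m := func_BB _ _ _ _

lemma ev_cosE (τ : ℝ) (m : ℕ) : ev τ (cosE m) = Real.cos (m * τ) := by
  rw [cosE, map_smul, ev_BB, smul_eq_mul]
  field_simp [(W_pos m).ne']

lemma summable_coef (x : WA) : Summable (fun m => |coefL m x|) := by
  refine Summable.of_nonneg_of_le (fun _ => abs_nonneg _) (fun m => ?_) (summable_raw x)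
  rw [raw_eq_coef, abs_mul, abs_of_pos (W_pos m)]
  nlinarith [W_ge m, abs_nonneg (coefL m x)]

lemma integral_exp_per (ω : ℝ) (hω : 0 < ω) (j : ℤ) :
    ∫ t in (-(Real.pi / ω))..(Real.pi / ω), Complex.exp (Complex.I * j * ω * t)
      = if j = 0 then 2 * (Real.pi : ℂ) / ω else 0 := by
  have hω' : (ω : ℂ) ≠ 0 := by exact_mod_cast hω.ne'
  split_ifs with h
  · subst h
    simp
    ring
  · have hj : (j : ℂ) ≠ 0 := by exact_mod_cast h
    have hc : Complex.I * j * ω ≠ 0 := by simp [hj, hω.ne']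
    rw [integral_exp_mul_complex hc, div_eq_zero_iff]
    left
    rw [sub_eq_zero, Complex.exp_eq_exp_iff_exists_int]
    refine ⟨j, ?_⟩
    push_cast
    field_simp
    ring

lemma integral_cos_exp (k : ℕ) (ω : ℝ) (hω : 0 < ω) (d : ℝ) (m : ℕ) (n : ℤ) :
    ∫ t in (-(Real.pi / ω))..(Real.pi / ω),
      ((Real.cos (m * (k * ω * t + d)) : ℝ) : ℂ) *
        Complex.exp (-(Complex.I * (n : ℂ) * (ω : ℂ) * (t : ℂ)))
    = (Real.pi : ℂ) / ω * (Complex.exp (Complex.I * m * d) * (if (m * k : ℤ) = n then 1 else 0)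
        + Complex.exp (-(Complex.I * m * d)) * (if (m * k : ℤ) = -n then 1 else 0)) := by
  have h : ∀ t : ℝ, ((Real.cos (m * (k * ω * t + d)) : ℝ) : ℂ) *
        Complex.exp (-(Complex.I * (n : ℂ) * (ω : ℂ) * (t : ℂ)))
      = (Complex.exp (Complex.I * m * d) / 2) *
          Complex.exp (Complex.I * ((m * k - n : ℤ) : ℂ) * ω * t)
        + (Complex.exp (-(Complex.I * m * d)) / 2) *
          Complex.exp (Complex.I * ((-(m * k) - n : ℤ) : ℂ) * ω * t) := by
    intro t
    rw [Complex.ofReal_cos, Complex.cos, div_mul_eq_mul_div, add_mul, ← Complex.exp_add,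
      ← Complex.exp_add, div_mul_eq_mul_div, div_mul_eq_mul_div, ← Complex.exp_add,
      ← Complex.exp_add, add_div]
    push_cast
    ring_nf
  simp_rw [h]
  rw [intervalIntegral.integral_add, intervalIntegral.integral_const_mul,
    intervalIntegral.integral_const_mul, integral_exp_per ω hω, integral_exp_per ω hω]
  · have e1 : ((m * k - n : ℤ) = 0) ↔ ((m * k : ℤ) = n) := by omega
    have e2 : ((-(m * k) - n : ℤ) = 0) ↔ ((m * k : ℤ) = -n) := by omega
    simp only [e1, e2]
    split_ifs <;> ring
  · exact Continuous.intervalIntegrable (by fun_prop) _ _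
  · exact Continuous.intervalIntegrable (by fun_prop) _ _

lemma hasSum_integral_ev (x : WA) (φ : ℝ → ℝ) (hφ : Continuous φ) (K : ℝ → ℂ) (hK : Continuous K)
    (hK1 : ∀ t, ‖K t‖ ≤ 1) (a b : ℝ) :
    HasSum (fun m : ℕ => (coefL m x : ℂ) * ∫ t in a..b, ((Real.cos (m * φ t) : ℝ) : ℂ) * K t)
      (∫ t in a..b, ((ev (φ t) x : ℝ) : ℂ) * K t) := by
  simp_rw [← intervalIntegral.integral_const_mul]
  refine intervalIntegral.hasSum_integral_of_dominated_convergence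
    (fun m _ => |coefL m x|) ?_ ?_ ?_ ?_ ?_
  · intro m
    exact Continuous.aestronglyMeasurable (by fun_prop)
  · intro m
    refine ae_of_all _ fun t _ => ?_
    rw [norm_mul, norm_mul, Complex.norm_real, Complex.norm_real, Real.norm_eq_abs,
      Real.norm_eq_abs]
    have h1 := Real.abs_cos_le_one (m * φ t)
    have h2 : |Real.cos (m * φ t)| * ‖K t‖ ≤ 1 := mul_le_one₀ h1 (norm_nonneg _) (hK1 t)
    calc _ ≤ |coefL m x| * 1 := by gcongr
      _ = _ := mul_one _
  · exact ae_of_all _ fun t _ => summable_coef x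
  · exact intervalIntegrable_const
  · refine ae_of_all _ fun t _ => ?_
    have h := (ev_hasSum (φ t) x)
    have h2 := (Complex.hasSum_ofReal.mpr h).mul_right (K t)
    refine h2.congr_fun ?_
    intro m
    push_cast
    ring

lemma ev_inj {x : WA} (h : ∀ τ, ev τ x = 0) : x = 0 := by
  refine coef_ext fun n => ?_
  have h1 := hasSum_integral_ev x (fun t => (1 : ℕ) * 1 * t + 0) (by fun_prop)
    (fun t => Complex.exp (-(Complex.I * ((n : ℤ) : ℂ) * ((1 : ℝ) : ℂ) * (t : ℂ)))) (by fun_prop)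
    (by
      intro t
      rw [show (-(Complex.I * ((n : ℤ) : ℂ) * ((1 : ℝ) : ℂ) * (t : ℂ)))
        = ((-(n * t) : ℝ) : ℂ) * Complex.I by push_cast; ring]
      rw [Complex.norm_exp_ofReal_mul_I]) (-(Real.pi / 1)) (Real.pi / 1)
  simp_rw [h, integral_cos_exp 1 1 one_pos] at h1
  simp only [Complex.ofReal_zero, zero_mul, intervalIntegral.integral_zero] at h1
  have h2 := h1.unique (hasSum_single n (fun m hm => ?_))
  · simp only [map_zero]
    have hp : (Real.pi : ℂ) ≠ 0 := by exact_mod_cast Real.pi_ne_zero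
    by_cases hn : n = 0
    · subst hn; simp [hp] at h2
      exact h2
    · have hn2 : ¬ ((n : ℤ) = -n) := by omega
      simp [hp, hn2] at h2
      exact h2
  · have e1 : ¬ ((m : ℤ) * (1 : ℕ) = n) := by push_cast; omega
    have e2 : ¬ ((m : ℤ) * (1 : ℕ) = -n) := by push_cast; omega
    simp only [e1, e2]
    simp

end KGP

namespace KGP

def CC (m n : ℕ) : WA :=
  (2 * W m * W n)⁻¹ • (W (m + n) • BB (m + n) + W ((m - n) + (n - m)) • BB ((m - n) + (n - m)))

lemma norm_CC (m n : ℕ) : ‖CC m n‖ ≤ 1 := by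
  have h1 := W_pos m
  have h2 := W_pos n
  have h3 := W_add m n
  have h4 : W ((m - n) + (n - m)) ≤ W m * W n := (W_mono (by omega)).trans h3
  rw [CC, norm_smul, Real.norm_of_nonneg (by positivity), inv_mul_le_one₀ (by positivity)]
  refine (norm_add_le _ _).trans ?_
  rw [norm_smul, norm_smul, norm_BB, norm_BB, Real.norm_of_nonneg (W_pos _).le,
    Real.norm_of_nonneg (W_pos _).le]
  linarith

lemma ev_CC (τ : ℝ) (m n : ℕ) : ev τ (CC m n) = ev τ (BB m) * ev τ (BB n) := by
  simp only [CC, map_smul, map_add, ev_BB, smul_eq_mul]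
  have h1 := (W_pos m).ne'
  have h2 := (W_pos n).ne'
  have h3 := (W_pos (m + n)).ne'
  have h4 := (W_pos ((m - n) + (n - m))).ne'
  have e : Real.cos (((m - n + (n - m) : ℕ) : ℝ) * τ) = Real.cos (m * τ - n * τ) := by
    rcases le_total m n with h | h
    · rw [Nat.sub_eq_zero_of_le h, zero_add, Nat.cast_sub h, ← Real.cos_neg]
      ring_nf
    · rw [Nat.sub_eq_zero_of_le h, add_zero, Nat.cast_sub h]
      ring_nf
  rw [e]
  push_cast
  rw [add_mul, Real.cos_add, Real.cos_sub]
  field_simp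
  ring

lemma summable_prod (x y : WA) :
    Summable (fun p : ℕ × ℕ => |rawL p.1 x| * |rawL p.2 y|) :=
  (summable_raw x).mul_of_nonneg (summable_raw y) (fun _ => abs_nonneg _) (fun _ => abs_nonneg _)

lemma mul_term_le (x y : WA) (p : ℕ × ℕ) :
    ‖(rawL p.1 x * rawL p.2 y) • CC p.1 p.2‖ ≤ |rawL p.1 x| * |rawL p.2 y| := by
  rw [norm_smul, Real.norm_eq_abs, abs_mul]
  exact mul_le_of_le_one_right (by positivity) (norm_CC _ _)

lemma summable_mul_term (x y : WA) :
    Summable (fun p : ℕ × ℕ => ‖(rawL p.1 x * rawL p.2 y) • CC p.1 p.2‖) :=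
  Summable.of_nonneg_of_le (fun _ => norm_nonneg _) (mul_term_le x y) (summable_prod x y)

def mulWA (x y : WA) : WA := ∑' p : ℕ × ℕ, (rawL p.1 x * rawL p.2 y) • CC p.1 p.2

lemma norm_mulWA (x y : WA) : ‖mulWA x y‖ ≤ ‖x‖ * ‖y‖ := by
  refine (norm_tsum_le_tsum_norm (summable_mul_term x y)).trans ?_
  refine ((summable_mul_term x y).tsum_le_tsum (mul_term_le x y) (summable_prod x y)).trans ?_
  rw [← (hasSum_raw x).tsum_eq, ← (hasSum_raw y).tsum_eq]
  exact le_of_eq ((summable_raw x).tsum_mul_tsum (summable_raw y) (summable_prod x y)).symm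

lemma ev_mulWA (τ : ℝ) (x y : WA) : ev τ (mulWA x y) = ev τ x * ev τ y := by
  have h : ∀ z : WA, ev τ z = ∑' m, rawL m z * ev τ (BB m) := by
    intro z
    conv_lhs => rw [← (hasSum_BB z).tsum_eq]
    rw [(ev τ).map_tsum (hasSum_BB z).summable]
    simp
  have hs : ∀ z : WA, Summable (fun m => ‖rawL m z * ev τ (BB m)‖) := by
    intro z
    refine Summable.of_nonneg_of_le (fun _ => norm_nonneg _) (fun m => ?_) (summable_raw z)
    rw [norm_mul, Real.norm_eq_abs, Real.norm_eq_abs, ev_BB]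
    exact mul_le_of_le_one_right (abs_nonneg _) (ev_bound τ m)
  rw [mulWA, (ev τ).map_tsum (summable_mul_term x y).of_norm, h x, h y,
    tsum_mul_tsum_of_summable_norm (hs x) (hs y)]
  refine tsum_congr fun p => ?_
  rw [map_smul, ev_CC, smul_eq_mul]
  ring

def evF (x : WA) : ℝ → ℝ := fun τ => ev τ x

lemma evF_inj : Function.Injective evF := by
  intro x y h
  have : x - y = 0 := ev_inj fun τ => by
    rw [map_sub, sub_eq_zero]; exact congrFun h τ
  exact sub_eq_zero.mp this

instance : Mul WA := ⟨mulWA⟩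
instance : One WA := ⟨cosE 0⟩
def powWA (x : WA) : ℕ → WA
  | 0 => 1
  | n + 1 => powWA x n * x
instance : Pow WA ℕ := ⟨powWA⟩
instance : NatCast WA := ⟨fun n => (n : ℝ) • (1 : WA)⟩
instance : IntCast WA := ⟨fun n => (n : ℝ) • (1 : WA)⟩

lemma ev_mul (τ : ℝ) (x y : WA) : ev τ (x * y) = ev τ x * ev τ y := ev_mulWA τ x y
lemma ev_one (τ : ℝ) : ev τ (1 : WA) = 1 := by
  change ev τ (cosE 0) = 1
  rw [ev_cosE]; simp
lemma ev_pow (τ : ℝ) (x : WA) (n : ℕ) : ev τ (x ^ n) = (ev τ x) ^ n := by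
  induction n with
  | zero => exact (ev_one τ).trans (pow_zero _).symm
  | succ n ih =>
    change ev τ (x ^ n * x) = _
    rw [ev_mul, ih, pow_succ]

instance instCR : CommRing WA :=
  { Function.Injective.commRing evF evF_inj (funext fun τ => map_zero (ev τ)) (funext fun τ => ev_one τ)
      (fun x y => funext fun τ => map_add (ev τ) x y) (fun x y => funext fun τ => ev_mul τ x y)
      (fun x => funext fun τ => map_neg (ev τ) x) (fun x y => funext fun τ => map_sub (ev τ) x y)
      (fun n x => funext fun τ => map_nsmul (ev τ) n x)
      (fun n x => funext fun τ => map_zsmul (ev τ) n x)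
      (fun x n => funext fun τ => ev_pow τ x n)
      (fun n => funext fun τ => by
        change ev τ ((n : ℝ) • (1 : WA)) = _
        rw [map_smul, ev_one]; simp)
      (fun n => funext fun τ => by
        change ev τ ((n : ℝ) • (1 : WA)) = _
        rw [map_smul, ev_one]; simp) with }

instance : NormedCommRing WA :=
  { (inferInstance : NormedAddCommGroup WA), instCR with
    norm_mul_le := norm_mulWA }

instance : NormedAlgebra ℝ WA :=
  { Algebra.ofModule
      (fun r x y => evF_inj (funext fun τ => by simp [evF, ev_mul, mul_assoc]))
      (fun r x y => evF_inj (funext fun τ => by simp [evF, ev_mul]; ring)) with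
    norm_smul_le := norm_smul_le }

/-- ring homomorphism version of the evaluation -/
def evHom (τ : ℝ) : WA →ₐ[ℝ] ℝ :=
  AlgHom.ofLinearMap (ev τ).toLinearMap (ev_one τ) (ev_mul τ)

lemma e1_cube : (cosE 1) ^ 3 = (3 / 4 : ℝ) • cosE 1 + (1 / 4 : ℝ) • cosE 3 := by
  refine evF_inj (funext fun τ => ?_)
  simp only [evF, ev_pow, map_add, map_smul, ev_cosE, smul_eq_mul]
  push_cast
  rw [Real.cos_three_mul]
  ring_nf

end KGP

namespace KGP

instance : NormOneClass WA := ⟨by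
  change ‖cosE 0‖ = 1
  rw [norm_cosE]; simp [W]⟩

lemma abs_ev_le (τ : ℝ) (x : WA) : |ev τ x| ≤ ‖x‖ := by
  have h := (norm_tsum_le_tsum_norm (f := fun m => rawL m x * (Real.cos (m * τ) / W m))
      (summable_mul_bdd x (ev_bound τ))).trans (tsum_mul_bdd x (ev_bound τ))
  rw [one_mul] at h
  exact h

lemma factor5 {f : ℂ → ℂ} (hf : AnalyticAt ℂ f 0) (hO : f =O[nhds (0 : ℂ)] fun z => z ^ 5) :
    ∃ g : ℂ → ℂ, AnalyticAt ℂ g 0 ∧ ∀ᶠ z in 𝓝 (0 : ℂ), f z = z ^ 5 * g z := by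
  by_cases h5 : (5 : ℕ) ≤ analyticOrderAt f 0
  · obtain ⟨g, hg, h⟩ := (natCast_le_analyticOrderAt hf).1 h5
    exact ⟨g, hg, by simpa using h⟩
  · exfalso
    have hlt : analyticOrderAt f 0 < (5 : ℕ) := not_le.1 h5
    obtain ⟨n, hn⟩ := ENat.ne_top_iff_exists.1 (hlt.trans_le le_top).ne
    rw [← hn] at hlt
    have hn5 : n < 5 := by exact_mod_cast hlt
    obtain ⟨g, hg, hg0, h⟩ := (hf.analyticOrderAt_eq_natCast).1 hn.symm
    simp only [sub_zero, smul_eq_mul] at h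
    obtain ⟨C, hC⟩ := hO.bound
    have h1 : ∀ᶠ z in 𝓝[≠] (0 : ℂ), ‖g z‖ ≤ C * ‖z‖ ^ (5 - n) := by
      filter_upwards [self_mem_nhdsWithin, nhdsWithin_le_nhds h, nhdsWithin_le_nhds hC]
        with z hz h2 h3
      rw [h2, norm_mul, norm_pow, norm_pow] at h3
      have hz' : 0 < ‖z‖ := norm_pos_iff.2 hz
      have e : ‖z‖ ^ 5 = ‖z‖ ^ n * ‖z‖ ^ (5 - n) := by rw [← pow_add]; congr 1; omega
      rw [e, mul_left_comm] at h3
      exact le_of_mul_le_mul_left h3 (by positivity)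
    have h2 : Tendsto (fun z : ℂ => ‖g z‖) (𝓝[≠] 0) (𝓝 ‖g 0‖) :=
      (hg.continuousAt.norm.tendsto).mono_left nhdsWithin_le_nhds
    have h3 : Tendsto (fun z : ℂ => C * ‖z‖ ^ (5 - n)) (𝓝[≠] 0) (𝓝 0) := by
      have : Continuous (fun z : ℂ => C * ‖z‖ ^ (5 - n)) := by fun_prop
      have h4 := (this.tendsto 0).mono_left (nhdsWithin_le_nhds (s := {0}ᶜ))
      simpa [zero_pow (show 5 - n ≠ 0 by omega)] using h4
    have := le_of_tendsto_of_tendsto h2 h3 h1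
    exact hg0 (norm_le_zero_iff.1 this)

lemma nonlin {f : ℂ → ℂ} (hf : AssumptionA f) :
    ∃ g : WA → WA, ∃ g' : WA → (WA →L[ℝ] WA), ∃ ρ > 0, ∃ C ≥ 0,
      (∀ a, ‖a‖ < ρ → ∀ τ, (f ((ev τ a : ℝ) : ℂ)).re = (ev τ a) ^ 5 * ev τ (g a)) ∧
      (∀ a, ‖a‖ < ρ → HasFDerivAt g (g' a) a ∧ ‖g a‖ ≤ C ∧ ‖g' a‖ ≤ C) ∧
      (∀ a b, ‖a‖ < ρ → ‖b‖ < ρ → ‖g a - g b‖ ≤ C * ‖a - b‖ ∧ ‖g' a - g' b‖ ≤ C * ‖a - b‖) := by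
  obtain ⟨hA, -, -, hO⟩ := hf
  obtain ⟨G, hG, hfG⟩ := factor5 hA hO
  obtain ⟨p, r, hp⟩ := hG
  obtain ⟨ρ0, hρ0, hρr⟩ := ENNReal.lt_iff_exists_nnreal_btwn.1 hp.r_pos
  have hρ0' : 0 < ρ0 := by exact_mod_cast hρ0
  obtain ⟨C0, hC0, hC0b⟩ := p.norm_mul_pow_le_of_lt_radius (hρr.trans_le hp.r_le)
  set c : ℕ → ℝ := fun n => (p.coeff n).re with hc
  set P := FormalMultilinearSeries.ofScalars WA c with hP
  have hrad : (ρ0 : ℝ≥0∞) ≤ P.radius := by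
    refine P.le_radius_of_bound C0 fun n => ?_
    rw [hP, FormalMultilinearSeries.ofScalars_norm]
    refine le_trans ?_ (hC0b n)
    gcongr
    rw [p.norm_apply_eq_norm_coef]
    exact Complex.abs_re_le_norm _
  have hPs : HasFPowerSeriesOnBall P.sum P 0 P.radius := P.hasFPowerSeriesOnBall (hρ0.trans_le hrad)
  have hAn : AnalyticAt ℝ P.sum 0 := hPs.analyticAt
  have hAn' : AnalyticAt ℝ (fderiv ℝ P.sum) 0 := hAn.fderiv
  obtain ⟨K1, s1, hs1, hL1⟩ := hAn.hasStrictFDerivAt.exists_lipschitzOnWith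
  obtain ⟨K2, s2, hs2, hL2⟩ := hAn'.hasStrictFDerivAt.exists_lipschitzOnWith
  obtain ⟨ε1, hε1, hfG1⟩ := Metric.eventually_nhds_iff.1 hfG
  have hd : ∀ᶠ a in 𝓝 (0 : WA), a ∈ s1 ∧ a ∈ s2 ∧ DifferentiableAt ℝ P.sum a := by
    filter_upwards [hs1, hs2, hAn.eventually_analyticAt] with a h1 h2 h3
    exact ⟨h1, h2, h3.differentiableAt⟩
  obtain ⟨ε2, hε2, hd2⟩ := Metric.eventually_nhds_iff.1 hd
  have hd3 : ∀ a : WA, ‖a‖ < ε2 → a ∈ s1 ∧ a ∈ s2 ∧ DifferentiableAt ℝ P.sum a := fun a ha =>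
    hd2 (by simpa using ha)
  set ρ : ℝ := min (min ε1 ε2) (min ρ0 1) with hρ
  have hρpos : 0 < ρ := by
    have : (0 : ℝ) < ρ0 := by exact_mod_cast hρ0'
    positivity
  set C : ℝ := ‖P.sum 0‖ + ‖fderiv ℝ P.sum 0‖ + K1 + K2 with hC
  have hz := hd3 0 (by simpa using hε2)
  have lip : ∀ a b : WA, ‖a‖ < ρ → ‖b‖ < ρ →
      ‖P.sum a - P.sum b‖ ≤ K1 * ‖a - b‖ ∧ ‖fderiv ℝ P.sum a - fderiv ℝ P.sum b‖ ≤ K2 * ‖a - b‖ := by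
    intro a b ha hb
    have ha' := hd3 a (ha.trans_le ((min_le_left _ _).trans (min_le_right _ _)))
    have hb' := hd3 b (hb.trans_le ((min_le_left _ _).trans (min_le_right _ _)))
    have h1 := hL1.dist_le_mul a ha'.1 b hb'.1
    have h2 := hL2.dist_le_mul a ha'.2.1 b hb'.2.1
    rw [dist_eq_norm, dist_eq_norm] at h1 h2
    exact ⟨h1, h2⟩
  have n1 := norm_nonneg (P.sum 0)
  have n2 := norm_nonneg (fderiv ℝ P.sum 0)
  have n3 : (0 : ℝ) ≤ K1 := K1.2
  have n4 : (0 : ℝ) ≤ K2 := K2.2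
  refine ⟨P.sum, fderiv ℝ P.sum, ρ, hρpos, C, by positivity, ?_, ?_, ?_⟩
  · intro a ha τ
    have hx : |ev τ a| < ρ := (abs_ev_le τ a).trans_lt ha
    set x := ev τ a with hxdef
    have h1 : f (x : ℂ) = (x : ℂ) ^ 5 * G x := hfG1 (by
      simpa using hx.trans_le ((min_le_left _ _).trans (min_le_left _ _)))
    have hρρ : ρ ≤ ρ0 := (min_le_right _ _).trans (min_le_left _ _)
    have h2 : HasSum (fun n => p n fun _ => (x : ℂ)) (G x) := by
      have := hp.hasSum (y := (x : ℂ)) (by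
        rw [Metric.mem_eball, edist_zero_right]
        refine lt_trans ?_ hρr
        rw [← ofReal_norm, ENNReal.ofReal_lt_coe_iff]
        · rw [Complex.norm_real]; exact hx.trans_le hρρ
        · exact norm_nonneg _)
      simpa using this
    have h3 : HasSum (fun n => P n fun _ => a) (P.sum a) := by
      have := hPs.hasSum (y := a) (by
        rw [Metric.mem_eball, edist_zero_right]
        refine lt_of_lt_of_le ?_ hrad
        rw [← ofReal_norm, ENNReal.ofReal_lt_coe_iff]
        · exact ha.trans_le hρρ
        · exact norm_nonneg _)
      simpa using this
    have h4 := (ev τ).hasSum h3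
    have h5 := Complex.hasSum_re h2
    have h6 : ev τ (P.sum a) = (G x).re := by
      refine h4.unique (h5.congr_fun fun n => ?_)
      simp only [hP, FormalMultilinearSeries.ofScalars_apply_eq, map_smul, ev_pow, smul_eq_mul,
        FormalMultilinearSeries.apply_eq_pow_smul_coeff, hc]
      rw [← Complex.ofReal_pow, Complex.re_ofReal_mul, mul_comm]
    rw [h6, h1, ← Complex.ofReal_pow, Complex.re_ofReal_mul]
  · intro a ha
    have ha' := hd3 a (ha.trans_le ((min_le_left _ _).trans (min_le_right _ _)))
    have ha1 : ‖a‖ ≤ 1 := ha.le.trans ((min_le_right _ _).trans (min_le_right _ _))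
    have := lip a 0 ha (by simpa using hρpos)
    rw [sub_zero] at this
    refine ⟨ha'.2.2.hasFDerivAt, ?_, ?_⟩
    · have h1 := norm_sub_norm_le (P.sum a) (P.sum 0)
      nlinarith
    · have h1 := norm_sub_norm_le (fderiv ℝ P.sum a) (fderiv ℝ P.sum 0)
      nlinarith
  · intro a b ha hb
    have := lip a b ha hb
    have hn := norm_nonneg (a - b)
    constructor <;> nlinarith [mul_nonneg n1 hn, mul_nonneg n2 hn, mul_nonneg n3 hn, mul_nonneg n4 hn]

end KGP

namespace KGP

/-- the quintic remainder of the nonlinearity, packaged -/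
structure NL where
  g : WA → WA
  g' : WA → (WA →L[ℝ] WA)
  ρ : ℝ
  C : ℝ
  hρ : 0 < ρ
  hC : 0 ≤ C
  hd : ∀ a, ‖a‖ < ρ → HasFDerivAt g (g' a) a
  hb : ∀ a, ‖a‖ < ρ → ‖g a‖ ≤ C
  hb' : ∀ a, ‖a‖ < ρ → ‖g' a‖ ≤ C
  hl : ∀ a b, ‖a‖ < ρ → ‖b‖ < ρ → ‖g a - g b‖ ≤ C * ‖a - b‖
  hl' : ∀ a b, ‖a‖ < ρ → ‖b‖ < ρ → ‖g' a - g' b‖ ≤ C * ‖a - b‖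

/-- uniformly bounded and Lipschitz families -/
def UL {ι X E : Type*} [SeminormedAddCommGroup X] [SeminormedAddCommGroup E] (A : ι → Set X) (F : ι → X → E) : Prop :=
  ∃ C : ℝ, 0 ≤ C ∧ ∀ i, ∀ p ∈ A i, ‖F i p‖ ≤ C ∧ ∀ p' ∈ A i, ‖F i p - F i p'‖ ≤ C * ‖p - p'‖

section UL
variable {ι X E E' E'' : Type*} [SeminormedAddCommGroup X] [NormedAddCommGroup E] [NormedSpace ℝ E]
  [NormedAddCommGroup E'] [NormedSpace ℝ E'] [NormedAddCommGroup E''] [NormedSpace ℝ E''] {A : ι → Set X}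

lemma UL.add {F G : ι → X → E} (hF : UL A F) (hG : UL A G) : UL A (fun i p => F i p + G i p) := by
  obtain ⟨C, hC, h⟩ := hF
  obtain ⟨D, hD, k⟩ := hG
  refine ⟨C + D, by positivity, fun i p hp => ⟨?_, fun p' hp' => ?_⟩⟩
  · exact (norm_add_le _ _).trans (add_le_add (h i p hp).1 (k i p hp).1)
  · rw [add_sub_add_comm, add_mul]
    exact (norm_add_le _ _).trans (add_le_add ((h i p hp).2 p' hp') ((k i p hp).2 p' hp'))

lemma UL.bilin (B : E →L[ℝ] E' →L[ℝ] E'') {F : ι → X → E} {G : ι → X → E'} (hF : UL A F) (hG : UL A G) :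
    UL A (fun i p => B (F i p) (G i p)) := by
  obtain ⟨C, hC, h⟩ := hF
  obtain ⟨D, hD, k⟩ := hG
  refine ⟨‖B‖ * C * D + (‖B‖ * C * D + ‖B‖ * C * D), by positivity, fun i p hp => ⟨?_, fun p' hp' => ?_⟩⟩
  · have h1 := B.le_opNorm₂ (F i p) (G i p)
    have h2 : ‖B‖ * ‖F i p‖ * ‖G i p‖ ≤ ‖B‖ * C * D := by
      gcongr
      exacts [(h i p hp).1, (k i p hp).1]
    have : 0 ≤ ‖B‖ * C * D := by positivity
    linarith
  · have e : B (F i p) (G i p) - B (F i p') (G i p')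
        = B (F i p - F i p') (G i p) + B (F i p') (G i p - G i p') := by
      simp
    rw [e]
    have h1 : ‖B (F i p - F i p') (G i p)‖ ≤ ‖B‖ * (C * ‖p - p'‖) * D :=
      (B.le_opNorm₂ _ _).trans (by
        gcongr
        exacts [(h i p hp).2 p' hp', (k i p hp).1])
    have h2 : ‖B (F i p') (G i p - G i p')‖ ≤ ‖B‖ * C * (D * ‖p - p'‖) :=
      (B.le_opNorm₂ _ _).trans (by
        gcongr
        exacts [(h i p' hp').1, (k i p hp).2 p' hp'])
    have : 0 ≤ ‖B‖ * C * D * ‖p - p'‖ := by positivity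
    refine (norm_add_le _ _).trans ?_
    linarith

lemma UL.mul {F G : ι → X → WA} (hF : UL A F) (hG : UL A G) : UL A (fun i p => F i p * G i p) :=
  UL.bilin (ContinuousLinearMap.mul ℝ WA) hF hG

lemma UL.clm {F : ι → X → (WA →L[ℝ] WA)} {G : ι → X → WA} (hF : UL A F) (hG : UL A G) :
    UL A (fun i p => F i p (G i p)) :=
  UL.bilin (ContinuousLinearMap.id ℝ (WA →L[ℝ] WA)) hF hG

lemma UL.smul {F : ι → X → E} (hF : UL A F) {c : ι → ℝ} {K : ℝ} (hc : ∀ i, (A i).Nonempty → |c i| ≤ K) :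
    UL A (fun i p => c i • F i p) := by
  obtain ⟨C, hC, h⟩ := hF
  refine ⟨|K| * C, by positivity, fun i p hp => ⟨?_, fun p' hp' => ?_⟩⟩
  · rw [norm_smul, Real.norm_eq_abs]
    exact mul_le_mul ((hc i ⟨p, hp⟩).trans (le_abs_self _)) (h i p hp).1 (norm_nonneg _) (abs_nonneg _)
  · rw [← smul_sub, norm_smul, Real.norm_eq_abs, mul_assoc]
    exact mul_le_mul ((hc i ⟨p, hp⟩).trans (le_abs_self _)) ((h i p hp).2 p' hp') (norm_nonneg _) (abs_nonneg _)

lemma UL.pow {F : ι → X → WA} (hF : UL A F) (n : ℕ) : UL A (fun i p => F i p ^ n) := by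
  induction n with
  | zero =>
    refine ⟨1, zero_le_one, fun i p hp => ⟨by simp, fun p' hp' => by simp⟩⟩
  | succ n ih => simpa only [pow_succ] using ih.mul hF

lemma UL.comp {F : ι → X → WA} (hF : UL A F) {f : WA → E} {C r : ℝ}
    (hb : ∀ a, ‖a‖ < r → ‖f a‖ ≤ C) (hl : ∀ a b, ‖a‖ < r → ‖b‖ < r → ‖f a - f b‖ ≤ C * ‖a - b‖)
    (hr : ∀ i, ∀ p ∈ A i, ‖F i p‖ < r) : UL A (fun i p => f (F i p)) := by
  obtain ⟨D, hD, h⟩ := hF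
  refine ⟨|C| + |C| * D, by positivity, fun i p hp => ⟨?_, fun p' hp' => ?_⟩⟩
  · refine (hb _ (hr i p hp)).trans ?_
    have := le_abs_self C
    have : 0 ≤ |C| * D := by positivity
    linarith
  · refine (hl _ _ (hr i p hp) (hr i p' hp')).trans ?_
    have h1 : C * ‖F i p - F i p'‖ ≤ |C| * (D * ‖p - p'‖) :=
      mul_le_mul (le_abs_self _) ((h i p hp).2 p' hp') (norm_nonneg _) (abs_nonneg _)
    have : 0 ≤ |C| * ‖p - p'‖ := by positivity
    linarith
end UL

def NL.Q0 (N : NL) (s : ℝ) (V : WA) : WA := V ^ 5 * N.g (s • V)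
def NL.P0 (N : NL) (s : ℝ) (V V' : WA) : WA :=
  (5 : ℝ) • (V ^ 4 * N.g (s • V) * V') + s • (V ^ 5 * N.g' (s • V) V')

def AR (N : NL) (R : ℝ) (s : ℝ) : Set (WA × WA) :=
  {p | 0 ≤ s ∧ s ≤ 1 ∧ s * R < N.ρ ∧ ‖p.1‖ ≤ R ∧ ‖p.2‖ ≤ R}

lemma UL_fst (N : NL) (R : ℝ) : UL (AR N R) (fun _ p => p.1) := by
  refine ⟨|R| + 1, by positivity, fun i p hp => ⟨?_, fun p' hp' => ?_⟩⟩
  · have := hp.2.2.2.1; have := le_abs_self R; linarith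
  · have h := norm_fst_le (p - p')
    rw [Prod.fst_sub] at h
    have : 0 ≤ |R| * ‖p - p'‖ := by positivity
    linarith

lemma UL_snd (N : NL) (R : ℝ) : UL (AR N R) (fun _ p => p.2) := by
  refine ⟨|R| + 1, by positivity, fun i p hp => ⟨?_, fun p' hp' => ?_⟩⟩
  · have := hp.2.2.2.2; have := le_abs_self R; linarith
  · have h := norm_snd_le (p - p')
    rw [Prod.snd_sub] at h
    have : 0 ≤ |R| * ‖p - p'‖ := by positivity
    linarith

lemma UL_s (N : NL) (R : ℝ) : ∀ s, (AR N R s).Nonempty → |s| ≤ 1 := by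
  rintro s ⟨p, hp⟩
  rw [abs_of_nonneg hp.1]; exact hp.2.1

lemma UL_ball (N : NL) (R : ℝ) : ∀ s, ∀ p ∈ AR N R s, ‖s • p.1‖ < N.ρ := by
  intro s p hp
  rw [norm_smul, Real.norm_of_nonneg hp.1]
  exact (mul_le_mul_of_nonneg_left hp.2.2.2.1 hp.1).trans_lt hp.2.2.1

lemma UL_Q0 (N : NL) (R : ℝ) : UL (AR N R) (fun s p => N.Q0 s p.1) :=
  ((UL_fst N R).pow 5).mul (((UL_fst N R).smul (UL_s N R)).comp N.hb N.hl (UL_ball N R))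

lemma UL_P0 (N : NL) (R : ℝ) : UL (AR N R) (fun s p => N.P0 s p.1 p.2) := by
  have hg := ((UL_fst N R).smul (UL_s N R)).comp N.hb N.hl (UL_ball N R)
  have hg' := ((UL_fst N R).smul (UL_s N R)).comp N.hb' N.hl' (UL_ball N R)
  refine UL.add ?_ ?_
  · exact UL.smul (c := fun _ => 5) (K := 5) ((((UL_fst N R).pow 4).mul hg).mul (UL_snd N R)) (by simp)
  · exact UL.smul (((UL_fst N R).pow 5).mul (hg'.clm (UL_snd N R))) (UL_s N R)

lemma UL_P1 (N : NL) (R : ℝ) : UL (AR N R) (fun _ p => p.1 ^ 2 * p.2) :=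
  ((UL_fst N R).pow 2).mul (UL_snd N R)

lemma NL.cont_g (N : NL) {X : Type*} [TopologicalSpace X] {f : X → WA} (hf : Continuous f) (h : ∀ x, ‖f x‖ < N.ρ) :
    Continuous (fun x => N.g (f x)) := by
  rw [continuous_iff_continuousAt]
  intro x
  exact ContinuousAt.comp (f := f) (g := N.g) (N.hd _ (h x)).continuousAt hf.continuousAt

lemma NL.cont_g' (N : NL) {X : Type*} [TopologicalSpace X] {f : X → WA} (hf : Continuous f) (h : ∀ x, ‖f x‖ < N.ρ) :
    Continuous (fun x => N.g' (f x)) := by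
  rw [continuous_iff_continuousAt]
  intro x
  have : ContinuousAt N.g' (f x) := by
    have ho : ∀ᶠ a in 𝓝 (f x), ‖a‖ < N.ρ := (isOpen_lt continuous_norm continuous_const).mem_nhds (h x)
    rw [ContinuousAt, tendsto_iff_norm_sub_tendsto_zero]
    refine squeeze_zero' (g := fun a => N.C * ‖a - f x‖) (Eventually.of_forall fun _ => norm_nonneg _) ?_ ?_
    · filter_upwards [ho] with a ha
      exact N.hl' _ _ ha (h x)
    · have : Continuous fun a : WA => N.C * ‖a - f x‖ := by fun_prop
      simpa using this.tendsto (f x)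
  exact ContinuousAt.comp (f := f) (g := N.g') this hf.continuousAt

end KGP

namespace KGP

section TI
variable {E F : Type*} [NormedAddCommGroup E] [NormedSpace ℝ E] [NormedAddCommGroup F] [NormedSpace ℝ F]

/-- exponentially weighted forward integral -/
def TI (K : ℝ → E →L[ℝ] F) (h : ℝ → E) (y : ℝ) : F :=
  ∫ r in Set.Ioi (0 : ℝ), Real.exp (-r) • K r (h (y + r))

variable {K : ℝ → E →L[ℝ] F} {h h' : ℝ → E} {c B : ℝ}

lemma TI_aux_cont (hK : Continuous K) (hh : Continuous h) (y : ℝ) :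
    Continuous (fun r => Real.exp (-r) • K r (h (y + r))) := by
  have : Continuous fun r => K r (h (y + r)) := hK.clm_apply (by fun_prop)
  fun_prop

lemma TI_aux_bd (hKc : ∀ r, 0 < r → ‖K r‖ ≤ c) (hb : ∀ s, ‖h s‖ ≤ B) (y r : ℝ) (hr : 0 < r) :
    ‖Real.exp (-r) • K r (h (y + r))‖ ≤ Real.exp (-r) * (c * B) := by
  rw [norm_smul, Real.norm_of_nonneg (Real.exp_pos _).le]
  gcongr
  exact (K r).le_of_opNorm_le_of_le (hKc r hr) (hb _)

lemma TI_int (hK : Continuous K) (hKc : ∀ r, 0 < r → ‖K r‖ ≤ c) (hh : Continuous h)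
    (hb : ∀ s, ‖h s‖ ≤ B) (y : ℝ) :
    IntegrableOn (fun r => Real.exp (-r) • K r (h (y + r))) (Set.Ioi 0) := by
  refine Integrable.mono' ((integrableOn_exp_neg_Ioi 0).mul_const (c * B))
    (TI_aux_cont hK hh y).aestronglyMeasurable ?_
  filter_upwards [ae_restrict_mem measurableSet_Ioi] with r hr
  exact TI_aux_bd hKc hb y r hr

lemma TI_norm (hKc : ∀ r, 0 < r → ‖K r‖ ≤ c)
    (hb : ∀ s, ‖h s‖ ≤ B) (y : ℝ) : ‖TI K h y‖ ≤ c * B := by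
  have := norm_integral_le_of_norm_le (μ := volume.restrict (Set.Ioi (0 : ℝ)))
    (f := fun r => Real.exp (-r) • K r (h (y + r)))
    ((integrableOn_exp_neg_Ioi 0).mul_const (c * B))
    (by
      filter_upwards [ae_restrict_mem measurableSet_Ioi] with r hr
      exact TI_aux_bd hKc hb y r hr)
  rw [integral_mul_const, integral_exp_neg_Ioi_zero, one_mul] at this
  exact this

lemma TI_cont (hK : Continuous K) (hKc : ∀ r, 0 < r → ‖K r‖ ≤ c) (hh : Continuous h)
    (hb : ∀ s, ‖h s‖ ≤ B) : Continuous (TI K h) := by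
  refine continuous_of_dominated (bound := fun r => Real.exp (-r) * (c * B))
    (fun y => (TI_aux_cont hK hh y).aestronglyMeasurable) (fun y => ?_)
    ((integrableOn_exp_neg_Ioi 0).mul_const (c * B)) ?_
  · filter_upwards [ae_restrict_mem measurableSet_Ioi] with r hr
    exact TI_aux_bd hKc hb y r hr
  · refine Eventually.of_forall fun r => ?_
    have : Continuous fun y => K r (h (y + r)) := (K r).continuous.comp (by fun_prop)
    fun_prop

lemma TI_sub (hK : Continuous K) (hKc : ∀ r, 0 < r → ‖K r‖ ≤ c) (hh : Continuous h)
    (hb : ∀ s, ‖h s‖ ≤ B) (hh' : Continuous h') (hb' : ∀ s, ‖h' s‖ ≤ B) (y : ℝ) :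
    TI K h y - TI K h' y = TI K (fun s => h s - h' s) y := by
  unfold TI
  rw [← integral_sub (TI_int hK hKc hh hb y) (TI_int hK hKc hh' hb' y)]
  refine integral_congr_ae (Eventually.of_forall fun r => ?_)
  simp [smul_sub]

lemma shift_Ioi (f : ℝ → F) (y : ℝ) : ∫ r in Set.Ioi (0 : ℝ), f (y + r) = ∫ s in Set.Ioi y, f s := by
  have := (measurePreserving_add_left volume y).setIntegral_preimage_emb
    (measurableEmbedding_addLeft y) f (Set.Ioi y)
  rw [← this]
  congr 2
  ext r; simp

lemma hasDerivAt_Ioi [CompleteSpace F] {f : ℝ → F} (hf : Continuous f) (hi : IntegrableOn f (Set.Ioi 0)) (y : ℝ) :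
    HasDerivAt (fun y => ∫ s in Set.Ioi y, f s) (- f y) y := by
  have hI : ∀ y, IntegrableOn f (Set.Ioi y) := by
    intro y
    have h1 : IntegrableOn f (Set.Icc (min y 0) 0) := hf.continuousOn.integrableOn_Icc
    refine (h1.union hi).mono_set ?_
    intro s hs
    rcases le_or_gt s 0 with h | h
    · exact Or.inl ⟨(min_le_left _ _).trans (le_of_lt hs), h⟩
    · exact Or.inr h
  have e : (fun y => ∫ s in Set.Ioi y, f s) = fun y => (∫ s in Set.Ioi 0, f s) - ∫ s in (0 : ℝ)..y, f s := by
    funext y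
    rw [← intervalIntegral.integral_Ioi_sub_Ioi' hi (hI y)]
    abel
  rw [e]
  have := (intervalIntegral.integral_hasDerivAt_right (hf.intervalIntegrable 0 y)
    (hf.stronglyMeasurableAtFilter _ _) hf.continuousAt)
  simpa using this.const_sub (∫ s in Set.Ioi 0, f s)

lemma tendsto_Ioi {f : ℝ → F} {B : ℝ} (hf : ∀ s, 0 ≤ s → ‖f s‖ ≤ B * Real.exp (-s)) :
    Tendsto (fun y => ∫ s in Set.Ioi y, f s) atTop (𝓝 0) := by
  have h2 : Tendsto (fun y : ℝ => B * Real.exp (-y)) atTop (𝓝 0) := by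
    simpa using (Real.tendsto_exp_neg_atTop_nhds_zero).const_mul B
  refine squeeze_zero_norm' ?_ h2
  filter_upwards [eventually_ge_atTop 0] with y hy
  have := norm_integral_le_of_norm_le (μ := volume.restrict (Set.Ioi y)) (f := f)
    ((integrableOn_exp_neg_Ioi y).const_mul B)
    (by
      filter_upwards [ae_restrict_mem measurableSet_Ioi] with r hr
      exact hf r (hy.trans (le_of_lt hr)))
  rwa [integral_const_mul, integral_exp_neg_Ioi] at this

lemma integrable_of_exp {f : ℝ → F} {B : ℝ} (hc : Continuous f) (hf : ∀ s, 0 ≤ s → ‖f s‖ ≤ B * Real.exp (-s)) :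
    IntegrableOn f (Set.Ioi 0) := by
  refine Integrable.mono' ((integrableOn_exp_neg_Ioi 0).const_mul B) hc.aestronglyMeasurable ?_
  filter_upwards [ae_restrict_mem measurableSet_Ioi] with r hr
  exact hf r (le_of_lt hr)

end TI

/-- contraction principle for bounded continuous functions -/
lemma fixpt (Φ : (ℝ → WA) → ℝ → WA) {r b : ℝ} (hr : 0 < r) (hb0 : 0 ≤ b)
    (hcont : ∀ q, Continuous q → (∀ y, ‖q y‖ ≤ r) → Continuous (Φ q))
    (hl : ∀ q q', Continuous q → (∀ y, ‖q y‖ ≤ r) → Continuous q' → (∀ y, ‖q' y‖ ≤ r) →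
      ∀ d, (∀ y, ‖q y - q' y‖ ≤ d) → ∀ y, ‖Φ q y - Φ q' y‖ ≤ d / 2)
    (h0 : ∀ y, ‖Φ (fun _ => 0) y‖ ≤ b) (hb : b ≤ r / 2) :
    ∃ q, Continuous q ∧ (∀ y, ‖q y‖ ≤ r) ∧ (∀ y, Φ q y = q y) ∧ ∀ y, ‖q y‖ ≤ 2 * b := by
  classical
  have key : ∀ q, Continuous q → (∀ y, ‖q y‖ ≤ r) → ∀ d, (∀ y, ‖q y‖ ≤ d) → ∀ y, ‖Φ q y‖ ≤ d / 2 + b := by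
    intro q hq hqr d hd y
    have := hl q (fun _ => 0) hq hqr continuous_const (by simp [hr.le]) d (by simpa using hd) y
    calc ‖Φ q y‖ = ‖(Φ q y - Φ (fun _ => 0) y) + Φ (fun _ => 0) y‖ := by simp
      _ ≤ _ := (norm_add_le _ _).trans (add_le_add this (h0 y))
  let S : Set (BoundedContinuousFunction ℝ WA) := {q | ∀ y, ‖q y‖ ≤ r}
  have hSc : IsClosed S := by
    have : S = ⋂ y, {q : BoundedContinuousFunction ℝ WA | ‖q y‖ ≤ r} := by ext; simp [S]
    rw [this]
    exact isClosed_iInter fun y => isClosed_le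
      ((continuous_eval_const y).norm) continuous_const
  have hmaps : ∀ q : S, ∀ y, ‖Φ q.1 y‖ ≤ r := fun q y => by
    have := key q.1 q.1.continuous q.2 r q.2 y
    linarith
  let T : S → S := fun q => ⟨BoundedContinuousFunction.ofNormedAddCommGroup (Φ q.1)
    (hcont q.1 q.1.continuous q.2) r (hmaps q), hmaps q⟩
  have hT : ContractingWith (1 / 2) T := by
    refine ⟨by norm_num, LipschitzWith.of_dist_le_mul fun q q' => ?_⟩
    change dist (T q).1 (T q').1 ≤ _
    rw [BoundedContinuousFunction.dist_le (by positivity)]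
    intro y
    have := hl q.1 q'.1 q.1.continuous q.2 q'.1.continuous q'.2 (dist q q') (fun y => by
      rw [← dist_eq_norm]; exact BoundedContinuousFunction.dist_coe_le_dist y) y
    rw [dist_eq_norm]
    refine this.trans (le_of_eq ?_)
    push_cast; ring
  have hSne : Nonempty S := ⟨⟨0, by intro y; simpa using hr.le⟩⟩
  have : CompleteSpace S := hSc.completeSpace_coe
  have hfix := hT.fixedPoint_isFixedPt
  set q := ContractingWith.fixedPoint T hT with hq
  have hqf : ∀ y, Φ q.1 y = q.1 y := fun y => by
    have := congrArg (fun z : S => z.1 y) hfix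
    exact this
  refine ⟨q.1, q.1.continuous, q.2, hqf, ?_⟩
  have h1 : ∀ y, ‖q.1 y‖ ≤ ‖q.1‖ / 2 + b := fun y => by
    rw [← hqf y]
    exact key q.1 q.1.continuous q.2 ‖q.1‖ (fun y => q.1.norm_coe_le_norm y) y
  have h2 : ‖q.1‖ ≤ ‖q.1‖ / 2 + b := (BoundedContinuousFunction.norm_le (by positivity)).2 h1
  intro y
  have := q.1.norm_coe_le_norm y
  linarith

end KGP

namespace KGP

def vhd (y : ℝ) : ℝ := - (2 * Real.sqrt 2 * Real.sinh y) / Real.cosh y ^ 2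
def phione (y : ℝ) : ℝ := Real.sinh y / Real.cosh y ^ 2
def dphi1 (y : ℝ) : ℝ := (2 / Real.cosh y ^ 2 - 1) / Real.cosh y
def phitwo (y : ℝ) : ℝ := Real.cosh y - 3 / Real.cosh y + 3 * y * (Real.sinh y / Real.cosh y ^ 2)
def dphi2 (y : ℝ) : ℝ :=
  Real.sinh y + 6 * (Real.sinh y / Real.cosh y ^ 2) + 3 * y * ((2 / Real.cosh y ^ 2 - 1) / Real.cosh y)

lemma ch_ne (y : ℝ) : Real.cosh y ≠ 0 := (Real.cosh_pos y).ne'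

lemma hd_inv (y : ℝ) : HasDerivAt (fun y => 1 / Real.cosh y) (- (Real.sinh y / Real.cosh y ^ 2)) y := by
  have := (hasDerivAt_const y (1 : ℝ)).div (Real.hasDerivAt_cosh y) (ch_ne y)
  refine this.congr_deriv ?_
  ring

lemma hd_vh (y : ℝ) : HasDerivAt vh (vhd y) y := by
  have h := (hd_inv y).const_mul (2 * Real.sqrt 2)
  have e : vh = fun y => 2 * Real.sqrt 2 * (1 / Real.cosh y) := by funext y; simp [vh, div_eq_mul_inv]
  rw [e]
  refine h.congr_deriv ?_
  unfold vhd; ring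

lemma sh_sq (y : ℝ) : Real.sinh y ^ 2 = Real.cosh y ^ 2 - 1 := by
  have := Real.cosh_sq y; linarith

lemma hd_phione (y : ℝ) : HasDerivAt phione (dphi1 y) y := by
  have h := (Real.hasDerivAt_sinh y).div ((Real.hasDerivAt_cosh y).pow 2) (pow_ne_zero 2 (ch_ne y))
  refine h.congr_deriv ?_
  unfold dphi1
  have := ch_ne y
  simp only [Pi.pow_apply]
  field_simp
  have := sh_sq y
  push_cast
  ring_nf
  rw [this]
  ring

lemma hd_dphi1 (y : ℝ) : HasDerivAt dphi1 ((1 - 6 / Real.cosh y ^ 2) * phione y) y := by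
  have h := (hd_inv y)
  have h2 := ((h.pow 3).const_mul 2).sub h
  have e : dphi1 = fun y => 2 * (1 / Real.cosh y) ^ 3 - 1 / Real.cosh y := by
    funext y; unfold dphi1; have := ch_ne y; field_simp
  rw [e]
  refine h2.congr_deriv ?_
  unfold phione
  have := ch_ne y
  push_cast
  field_simp
  ring

lemma hd_vhd (y : ℝ) : HasDerivAt vhd (vh y - vh y ^ 3 / 4) y := by
  have h := (hd_phione y).const_mul (-(2 * Real.sqrt 2))
  have e : vhd = fun y => -(2 * Real.sqrt 2) * phione y := by funext y; simp [vhd, phione]; ring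
  rw [e]
  refine h.congr_deriv ?_
  unfold dphi1 vh
  have := ch_ne y
  have h2 : Real.sqrt 2 ^ 2 = 2 := by simp
  field_simp
  ring_nf
  rw [h2]
  ring

lemma hd_phitwo (y : ℝ) : HasDerivAt phitwo (dphi2 y) y := by
  have h := ((Real.hasDerivAt_cosh y).sub ((hd_inv y).const_mul 3)).add
    (((hasDerivAt_id y).const_mul 3).mul (hd_phione y))
  have e : phitwo = fun y => Real.cosh y - 3 * (1 / Real.cosh y) + 3 * y * phione y := by
    funext y; simp [phitwo, phione, div_eq_mul_inv]
  rw [e]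
  refine h.congr_deriv ?_
  unfold dphi2 phione dphi1
  simp only [id]
  ring

lemma hd_dphi2 (y : ℝ) : HasDerivAt dphi2 ((1 - 6 / Real.cosh y ^ 2) * phitwo y) y := by
  have h := ((Real.hasDerivAt_sinh y).add ((hd_phione y).const_mul 6)).add
    (((hasDerivAt_id y).const_mul 3).mul (hd_dphi1 y))
  have e : dphi2 = fun y => Real.sinh y + 6 * phione y + 3 * y * dphi1 y := by
    funext y; simp [dphi2, phione, dphi1]
  rw [e]
  refine h.congr_deriv ?_
  unfold phitwo phione dphi1
  have := ch_ne y
  simp only [id]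
  field_simp
  ring

lemma wronsk (y : ℝ) : dphi1 y * phitwo y - phione y * dphi2 y = -2 := by
  unfold phione phitwo dphi1 dphi2
  have := ch_ne y
  have h := sh_sq y
  field_simp
  ring_nf
  rw [h]
  ring

lemma dphi2_zero : dphi2 0 = 0 := by simp [dphi2]
lemma vhd_zero : vhd 0 = 0 := by simp [vhd]

lemma cont_vh : Continuous vh := continuous_iff_continuousAt.2 fun y => (hd_vh y).continuousAt
lemma cont_vhd : Continuous vhd := continuous_iff_continuousAt.2 fun y => (hd_vhd y).continuousAt
lemma cont_phione : Continuous phione := continuous_iff_continuousAt.2 fun y => (hd_phione y).continuousAt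
lemma cont_dphi1 : Continuous dphi1 := continuous_iff_continuousAt.2 fun y => (hd_dphi1 y).continuousAt
lemma cont_phitwo : Continuous phitwo := continuous_iff_continuousAt.2 fun y => (hd_phitwo y).continuousAt
lemma cont_dphi2 : Continuous dphi2 := continuous_iff_continuousAt.2 fun y => (hd_dphi2 y).continuousAt

lemma exp_div_ch (y : ℝ) : Real.exp y * (1 / Real.cosh y) ≤ 2 := by
  rw [mul_one_div, div_le_iff₀ (Real.cosh_pos y), Real.cosh_eq]
  have := Real.exp_pos (-y)
  linarith

lemma abs_sh_le (y : ℝ) : |Real.sinh y| ≤ Real.cosh y :=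
  abs_le_of_sq_le_sq (by rw [sh_sq]; linarith) (Real.cosh_pos y).le

lemma phione_le (y : ℝ) : |phione y| ≤ 1 / Real.cosh y := by
  have h := Real.cosh_pos y
  unfold phione
  rw [abs_div, abs_of_pos (pow_pos h 2), div_le_div_iff₀ (pow_pos h 2) h]
  nlinarith [abs_sh_le y]

lemma dphi1_le (y : ℝ) : |dphi1 y| ≤ 1 / Real.cosh y := by
  have h := Real.cosh_pos y
  have h1 := Real.one_le_cosh y
  unfold dphi1
  rw [abs_div, abs_of_pos h]
  gcongr
  rw [abs_le]
  have h2 : 2 / Real.cosh y ^ 2 ≤ 2 := by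
    rw [div_le_iff₀ (pow_pos h 2)]; nlinarith
  have h3 : 0 ≤ 2 / Real.cosh y ^ 2 := by positivity
  constructor <;> linarith

lemma inv_ch_le (y : ℝ) : 1 / Real.cosh y ≤ 2 * Real.exp (-y) := by
  have h := exp_div_ch y
  have h2 : Real.exp (-y) * (Real.exp y * (1 / Real.cosh y)) = 1 / Real.cosh y := by
    rw [← mul_assoc, ← Real.exp_add]; simp
  have := mul_le_mul_of_nonneg_left h (Real.exp_pos (-y)).le
  linarith

lemma inv_ch_le_one (y : ℝ) : 1 / Real.cosh y ≤ 1 := by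
  rw [div_le_one (Real.cosh_pos y)]; exact Real.one_le_cosh y

lemma y_inv_ch {y : ℝ} (hy : 0 ≤ y) : y * (1 / Real.cosh y) ≤ 2 := by
  have h1 : y ≤ Real.exp y := by have := Real.add_one_le_exp y; linarith
  have h2 : 0 ≤ 1 / Real.cosh y := by have := Real.cosh_pos y; positivity
  exact (mul_le_mul_of_nonneg_right h1 h2).trans (exp_div_ch y)

lemma ch_le_exp {y : ℝ} (hy : 0 ≤ y) : Real.cosh y ≤ Real.exp y := by
  rw [Real.cosh_eq]
  have : Real.exp (-y) ≤ Real.exp y := Real.exp_le_exp.2 (by linarith)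
  linarith

lemma phitwo_le {y : ℝ} (hy : 0 ≤ y) : |phitwo y| ≤ 10 * Real.exp y := by
  have h1 := ch_le_exp hy
  have h2 := inv_ch_le_one y
  have h3 := y_inv_ch hy
  have h4 := phione_le y
  have h5 : (1 : ℝ) ≤ Real.exp y := Real.one_le_exp hy
  have h6 : 0 ≤ 1 / Real.cosh y := by have := Real.cosh_pos y; positivity
  have e : phitwo y = Real.cosh y - 3 * (1 / Real.cosh y) + 3 * (y * phione y) := by
    simp [phitwo, phione, div_eq_mul_inv, mul_assoc]
  have h7 : |y * phione y| ≤ 2 := by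
    rw [abs_mul, abs_of_nonneg hy]
    exact (mul_le_mul_of_nonneg_left h4 hy).trans h3
  rw [abs_le] at h7 ⊢
  have := Real.cosh_pos y
  rw [e]
  constructor <;> linarith

lemma dphi2_le {y : ℝ} (hy : 0 ≤ y) : |dphi2 y| ≤ 13 * Real.exp y := by
  have h1 := ch_le_exp hy
  have h2 := inv_ch_le_one y
  have h3 := y_inv_ch hy
  have h4 := (phione_le y).trans h2
  have h5 : (1 : ℝ) ≤ Real.exp y := Real.one_le_exp hy
  have e : dphi2 y = Real.sinh y + 6 * phione y + 3 * (y * dphi1 y) := by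
    simp [dphi2, phione, dphi1, mul_assoc]
  have h7 : |y * dphi1 y| ≤ 2 := by
    rw [abs_mul, abs_of_nonneg hy]
    exact (mul_le_mul_of_nonneg_left (dphi1_le y) hy).trans h3
  have h8 := (abs_sh_le y).trans h1
  rw [abs_le] at h4 h7 h8 ⊢
  rw [e]
  constructor <;> linarith

lemma sqrt2_le : 2 * Real.sqrt 2 ≤ 3 := by
  have : Real.sqrt 2 ≤ 3 / 2 := by
    rw [Real.sqrt_le_left (by norm_num)]; norm_num
  linarith

lemma vh_pos (y : ℝ) : 0 < vh y := by
  have := Real.cosh_pos y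
  unfold vh; positivity

lemma vh_le (y : ℝ) : vh y ≤ 3 * (1 / Real.cosh y) := by
  have h6 : 0 ≤ 1 / Real.cosh y := by have := Real.cosh_pos y; positivity
  have := mul_le_mul_of_nonneg_right sqrt2_le h6
  unfold vh
  rw [div_eq_mul_one_div]; exact this

lemma vhd_le (y : ℝ) : |vhd y| ≤ 3 * (1 / Real.cosh y) := by
  have e : vhd y = -(2 * Real.sqrt 2) * phione y := by simp [vhd, phione]; ring
  rw [e, abs_mul, abs_neg, abs_of_nonneg (by positivity)]
  exact mul_le_mul sqrt2_le (phione_le y) (abs_nonneg _) (by norm_num)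

lemma exp_le_vh {y : ℝ} (hy : 0 ≤ y) : Real.exp (-y) ≤ vh y := by
  have h := ch_le_exp hy
  have h0 := Real.cosh_pos y
  have h1 : Real.exp (-y) ≤ 1 / Real.cosh y := by
    rw [Real.exp_neg, ← one_div]
    exact one_div_le_one_div_of_le h0 h
  have h2 : (1 : ℝ) ≤ 2 * Real.sqrt 2 := by
    have : (1 : ℝ) ≤ Real.sqrt 2 := by rw [Real.one_le_sqrt]; norm_num
    linarith
  refine h1.trans ?_
  unfold vh
  gcongr

/-- clamp -/
def cl (y : ℝ) : ℝ := max y 0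
def θ (y : ℝ) : ℝ := Real.exp (-(cl y))
lemma cl_nn (y : ℝ) : 0 ≤ cl y := le_max_right _ _
lemma cl_eq {y : ℝ} (hy : 0 ≤ y) : cl y = y := max_eq_left hy
lemma cont_cl : Continuous cl := continuous_id.max continuous_const
lemma cont_θ : Continuous θ := Real.continuous_exp.comp cont_cl.neg
lemma θ_pos (y : ℝ) : 0 < θ y := Real.exp_pos _
lemma θ_le (y : ℝ) : θ y ≤ 1 := by
  unfold θ; rw [Real.exp_le_one_iff]; have := cl_nn y; linarith
lemma θ_exp (y : ℝ) : θ y * Real.exp (cl y) = 1 := by unfold θ; rw [← Real.exp_add]; simp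

def χ (y : ℝ) : ℝ := Real.exp (cl y) * vh (cl y)
def χd (y : ℝ) : ℝ := Real.exp (cl y) * vhd (cl y)
def a1 (y : ℝ) : ℝ := Real.exp (cl y) * dphi1 (cl y)
def b1 (y : ℝ) : ℝ := Real.exp (cl y) * phione (cl y)
def a2 (y : ℝ) : ℝ := θ y * dphi2 (cl y)
def b2 (y : ℝ) : ℝ := θ y * phitwo (cl y)

lemma cont_χ : Continuous χ := (Real.continuous_exp.comp cont_cl).mul (cont_vh.comp cont_cl)
lemma cont_χd : Continuous χd := (Real.continuous_exp.comp cont_cl).mul (cont_vhd.comp cont_cl)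
lemma cont_a1 : Continuous a1 := (Real.continuous_exp.comp cont_cl).mul (cont_dphi1.comp cont_cl)
lemma cont_b1 : Continuous b1 := (Real.continuous_exp.comp cont_cl).mul (cont_phione.comp cont_cl)
lemma cont_a2 : Continuous a2 := cont_θ.mul (cont_dphi2.comp cont_cl)
lemma cont_b2 : Continuous b2 := cont_θ.mul (cont_phitwo.comp cont_cl)

lemma exp_mul_le {f : ℝ → ℝ} {K : ℝ} (hK : 0 ≤ K) (hf : ∀ y, |f y| ≤ K * (1 / Real.cosh y)) (y : ℝ) :
    |Real.exp y * f y| ≤ K * 2 := by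
  rw [abs_mul, abs_of_pos (Real.exp_pos y)]
  calc _ ≤ Real.exp y * (K * (1 / Real.cosh y)) := mul_le_mul_of_nonneg_left (hf y) (Real.exp_pos y).le
    _ = K * (Real.exp y * (1 / Real.cosh y)) := by ring
    _ ≤ _ := mul_le_mul_of_nonneg_left (exp_div_ch y) hK

lemma χ_le (y : ℝ) : |χ y| ≤ 6 := by
  have := exp_mul_le (f := vh) (K := 3) (by norm_num)
    (fun y => by rw [abs_of_pos (vh_pos y)]; exact vh_le y) (cl y)
  exact this.trans (by norm_num)
lemma χd_le (y : ℝ) : |χd y| ≤ 6 := by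
  have := exp_mul_le (f := vhd) (K := 3) (by norm_num) vhd_le (cl y)
  exact this.trans (by norm_num)
lemma a1_le (y : ℝ) : |a1 y| ≤ 2 := by
  have := exp_mul_le (f := dphi1) (K := 1) (by norm_num) (by simpa using dphi1_le) (cl y)
  exact this.trans (by norm_num)
lemma b1_le (y : ℝ) : |b1 y| ≤ 2 := by
  have := exp_mul_le (f := phione) (K := 1) (by norm_num) (by simpa using phione_le) (cl y)
  exact this.trans (by norm_num)
lemma θ_mul_le {f : ℝ → ℝ} {K : ℝ} (hf : ∀ y, 0 ≤ y → |f y| ≤ K * Real.exp y) (y : ℝ) :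
    |θ y * f (cl y)| ≤ K := by
  rw [abs_mul, abs_of_pos (θ_pos y)]
  calc _ ≤ θ y * (K * Real.exp (cl y)) := mul_le_mul_of_nonneg_left (hf _ (cl_nn y)) (θ_pos y).le
    _ = K * (θ y * Real.exp (cl y)) := by ring
    _ = K := by rw [θ_exp, mul_one]
lemma a2_le (y : ℝ) : |a2 y| ≤ 13 := θ_mul_le (fun _ => dphi2_le) y
lemma b2_le (y : ℝ) : |b2 y| ≤ 10 := θ_mul_le (fun _ => phitwo_le) y

end KGP

namespace KGP

def K1 (r : ℝ) : ℝ →L[ℝ] ℝ := Real.exp (-3 * r) • ContinuousLinearMap.id ℝ ℝ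
lemma K1_cont : Continuous K1 := by unfold K1; fun_prop
lemma K1_le (r : ℝ) (hr : 0 < r) : ‖K1 r‖ ≤ 1 := by
  unfold K1
  rw [norm_smul, ContinuousLinearMap.norm_id, mul_one, Real.norm_of_nonneg (Real.exp_pos _).le, Real.exp_le_one_iff]
  linarith

/-- solution operator for the mode `1` (derivative of the Duffing variation of constants) -/
def T1 (h : ℝ → ℝ) (y : ℝ) : ℝ :=
  (1 / 2) * (a1 y * (∫ s in (0 : ℝ)..cl y, b2 s * Real.exp (-2 * s) * h s)
    + a2 y * (θ y ^ 2 * TI K1 (fun s => b1 s * h s) (cl y)))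

lemma b1h_le {h : ℝ → ℝ} {B : ℝ} (hb : ∀ s, |h s| ≤ B) (s : ℝ) : ‖b1 s * h s‖ ≤ 2 * B := by
  rw [Real.norm_eq_abs, abs_mul]
  exact mul_le_mul (b1_le s) (hb s) (abs_nonneg _) (by norm_num)

lemma T1_int_cont {h : ℝ → ℝ} (hh : Continuous h) : Continuous fun s => b2 s * Real.exp (-2 * s) * h s := by
  have := cont_b2
  fun_prop

lemma T1_int_le {h : ℝ → ℝ} {B : ℝ} (hh : Continuous h) (hb : ∀ s, |h s| ≤ B) {y : ℝ} (hy : 0 ≤ y) :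
    |∫ s in (0 : ℝ)..y, b2 s * Real.exp (-2 * s) * h s| ≤ 10 * B := by
  have hB : 0 ≤ B := (abs_nonneg _).trans (hb 0)
  have h1 := intervalIntegral.norm_integral_le_of_norm_le (μ := volume) (a := 0) (b := y) hy
    (f := fun s => b2 s * Real.exp (-2 * s) * h s) (g := fun s => 10 * B * Real.exp (-s))
    (Eventually.of_forall fun s hs => by
      rw [Real.norm_eq_abs, abs_mul, abs_mul, abs_of_pos (Real.exp_pos _)]
      have e1 : Real.exp (-2 * s) ≤ Real.exp (-s) := Real.exp_le_exp.2 (by linarith [hs.1])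
      calc _ ≤ 10 * Real.exp (-s) * B := by
            gcongr
            exacts [b2_le s, hb s]
        _ = _ := by ring)
    (by apply Continuous.intervalIntegrable; fun_prop)
  rw [Real.norm_eq_abs, intervalIntegral.integral_const_mul] at h1
  refine h1.trans ?_
  have h2 : ∫ s in (0 : ℝ)..y, Real.exp (-s) = 1 - Real.exp (-y) := by
    rw [intervalIntegral.integral_comp_neg (fun s => Real.exp s)]
    simp
  rw [h2]
  have := Real.exp_pos (-y)
  nlinarith

lemma T1_norm {h : ℝ → ℝ} {B : ℝ} (hh : Continuous h) (hb : ∀ s, |h s| ≤ B) (y : ℝ) :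
    |T1 h y| ≤ 23 * B := by
  have hB : 0 ≤ B := (abs_nonneg _).trans (hb 0)
  have h1 := T1_int_le hh hb (cl_nn y)
  have h2 := TI_norm (K := K1) K1_le (b1h_le hb) (cl y)
  rw [Real.norm_eq_abs] at h2
  have h3 : θ y ^ 2 ≤ 1 := pow_le_one₀ (θ_pos y).le (θ_le y)
  have h4 : |θ y ^ 2 * TI K1 (fun s => b1 s * h s) (cl y)| ≤ 1 * (1 * (2 * B)) := by
    rw [abs_mul, abs_of_nonneg (by positivity)]
    exact mul_le_mul h3 h2 (abs_nonneg _) (by norm_num)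
  unfold T1
  rw [abs_mul]
  have h5 := mul_le_mul (a1_le y) h1 (abs_nonneg _) (by norm_num)
  have h6 := mul_le_mul (a2_le y) h4 (abs_nonneg _) (by norm_num)
  rw [← abs_mul] at h5 h6
  have := abs_add_le (a1 y * (∫ s in (0 : ℝ)..cl y, b2 s * Real.exp (-2 * s) * h s))
    (a2 y * (θ y ^ 2 * TI K1 (fun s => b1 s * h s) (cl y)))
  rw [abs_of_pos (by norm_num : (0 : ℝ) < 1 / 2)]
  linarith

lemma T1_cont {h : ℝ → ℝ} {B : ℝ} (hh : Continuous h) (hb : ∀ s, |h s| ≤ B) : Continuous (T1 h) := by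
  have h1 : Continuous fun y => ∫ s in (0 : ℝ)..y, b2 s * Real.exp (-2 * s) * h s :=
    intervalIntegral.continuous_primitive (fun a b => (T1_int_cont hh).intervalIntegrable a b) 0
  have h2 := TI_cont (K := K1) K1_cont K1_le (cont_b1.mul hh) (b1h_le hb)
  have h3 := h1.comp cont_cl
  have h4 := h2.comp cont_cl
  have := cont_a1
  have := cont_a2
  have := cont_θ
  unfold T1
  simp only [Function.comp_def] at h3 h4
  fun_prop

lemma T1_sub {h h' : ℝ → ℝ} {B : ℝ} (hh : Continuous h) (hb : ∀ s, |h s| ≤ B)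
    (hh' : Continuous h') (hb' : ∀ s, |h' s| ≤ B) (y : ℝ) :
    T1 h y - T1 h' y = T1 (fun s => h s - h' s) y := by
  have h2 := TI_sub (K := K1) (h := fun s => b1 s * h s) (h' := fun s => b1 s * h' s) K1_cont K1_le
    (cont_b1.mul hh) (b1h_le hb) (cont_b1.mul hh') (b1h_le hb') (cl y)
  have h1 := intervalIntegral.integral_sub ((T1_int_cont hh).intervalIntegrable 0 (cl y) (μ := volume))
    ((T1_int_cont hh').intervalIntegrable 0 (cl y))
  have e1 : (fun s => b2 s * Real.exp (-2 * s) * (h s - h' s))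
    = fun s => b2 s * Real.exp (-2 * s) * h s - b2 s * Real.exp (-2 * s) * h' s := by funext s; ring
  have e2 : (fun s => b1 s * (h s - h' s)) = fun s => b1 s * h s - b1 s * h' s := by funext s; ring
  unfold T1
  rw [e1, e2, ← h2, h1]
  ring

/-- oscillation frequencies -/
def lam (δ : ℝ) (m : ℕ) : ℝ := Real.sqrt ((m : ℝ) ^ 2 - 1 - δ ^ 2) / δ

lemma lam_ge {δ : ℝ} (h0 : 0 < δ) (h1 : δ ≤ 1) {m : ℕ} (hm : 3 ≤ m) : 2 / δ ≤ lam δ m := by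
  unfold lam
  gcongr
  apply Real.le_sqrt_of_sq_le
  have : (3 : ℝ) ≤ m := by exact_mod_cast hm
  nlinarith

lemma lam_sq {δ : ℝ} (h0 : 0 < δ) (h1 : δ ≤ 1) {m : ℕ} (hm : 3 ≤ m) :
    lam δ m ^ 2 = ((m : ℝ) ^ 2 - 1 - δ ^ 2) / δ ^ 2 := by
  unfold lam
  have : (3 : ℝ) ≤ m := by exact_mod_cast hm
  rw [div_pow, Real.sq_sqrt (by nlinarith)]

def Sb (δ r : ℝ) (m : ℕ) : ℝ := if Odd m ∧ 3 ≤ m then Real.sin (lam δ m * r) / lam δ m else 0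

lemma sin_div_lip (l r r' : ℝ) : |Real.sin (l * r) / l - Real.sin (l * r') / l| ≤ |r - r'| := by
  rcases eq_or_ne l 0 with h | h
  · simp [h]
  · rw [← sub_div, abs_div, div_le_iff₀ (abs_pos.2 h)]
    have : |Real.sin (l * r) - Real.sin (l * r')| ≤ |l * r - l * r'| := by
      simpa [Real.dist_eq] using Real.lipschitzWith_sin.dist_le_mul (l * r) (l * r')
    rw [← mul_sub, abs_mul] at this
    linarith

lemma Sb_lip (δ r r' : ℝ) (m : ℕ) : |Sb δ r m - Sb δ r' m| ≤ |r - r'| := by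
  unfold Sb
  split_ifs
  · exact sin_div_lip _ _ _
  · simp

lemma Sb_bd (δ r : ℝ) (m : ℕ) : |Sb δ r m| ≤ |r| := by
  have := Sb_lip δ r 0 m
  simpa [Sb] using this

lemma Sb_bd' {δ : ℝ} (h0 : 0 < δ) (h1 : δ ≤ 1) (r : ℝ) (m : ℕ) : |Sb δ r m| ≤ δ := by
  unfold Sb
  split_ifs with h
  · have h2 := lam_ge h0 h1 h.2
    have h3 : 0 < 2 / δ := by positivity
    have h4 : 0 < lam δ m := h3.trans_le h2
    rw [abs_div, abs_of_pos h4, div_le_iff₀ h4]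
    have h5 : δ * (2 / δ) = 2 := by field_simp
    have := mul_le_mul_of_nonneg_left h2 h0.le
    have := Real.abs_sin_le_one (lam δ m * r)
    linarith
  · simpa using h0.le

def SS (δ r : ℝ) : WA →L[ℝ] WA := diag (Sb δ r) |r| (Sb_bd δ r)

lemma SS_norm {δ : ℝ} (h0 : 0 < δ) (h1 : δ ≤ 1) (r : ℝ) : ‖SS δ r‖ ≤ δ :=
  ContinuousLinearMap.opNorm_le_bound _ h0.le fun x => norm_diag_le (Sb δ r) δ (Sb_bd' h0 h1 r) x

lemma SS_cont (δ : ℝ) : Continuous (SS δ) := by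
  have : LipschitzWith 1 (SS δ) := by
    refine LipschitzWith.of_dist_le_mul fun r r' => ?_
    rw [dist_eq_norm]
    refine ContinuousLinearMap.opNorm_le_bound _ (by positivity) fun x => ?_
    have h := norm_diag_le (fun m => Sb δ r m - Sb δ r' m) |r - r'| (Sb_lip δ r r') x
    have e : (SS δ r - SS δ r') x = diag (fun m => Sb δ r m - Sb δ r' m) |r - r'| (Sb_lip δ r r') x := by
      refine WA_ext fun m => ?_
      rw [_root_.sub_apply, map_sub]
      simp only [SS, raw_diag]
      ring
    rw [e]
    simpa [Real.dist_eq] using h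
  exact this.continuous

def K2 (δ r : ℝ) : WA →L[ℝ] WA := Real.exp (-2 * r) • SS δ r
lemma K2_cont (δ : ℝ) : Continuous (K2 δ) := by
  have := SS_cont δ
  unfold K2; fun_prop
lemma K2_le {δ : ℝ} (h0 : 0 < δ) (h1 : δ ≤ 1) (r : ℝ) (hr : 0 < r) : ‖K2 δ r‖ ≤ δ := by
  unfold K2
  rw [norm_smul, Real.norm_of_nonneg (Real.exp_pos _).le]
  have : Real.exp (-2 * r) ≤ 1 := by rw [Real.exp_le_one_iff]; linarith
  have h := SS_norm h0 h1 r
  have := norm_nonneg (SS δ r)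
  nlinarith

def Db (κ : ℝ) (m : ℕ) : ℝ := if m = 1 then 1 else κ
lemma Db_bd (κ : ℝ) (m : ℕ) : |Db κ m| ≤ 1 + |κ| := by
  unfold Db; split_ifs
  · simp
  · have := abs_nonneg κ; linarith
def DD (κ : ℝ) : WA →L[ℝ] WA := diag (Db κ) (1 + |κ|) (Db_bd κ)
lemma DD_norm {κ : ℝ} (h0 : 0 < κ) (h1 : κ ≤ 1) (x : WA) : ‖DD κ x‖ ≤ ‖x‖ := by
  have := norm_diag_le (Db κ) 1 (fun m => by
    unfold Db; split_ifs
    · simp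
    · rw [abs_of_pos h0]; exact h1) x
  rw [one_mul] at this
  exact this
lemma DD_coef (κ : ℝ) (x : WA) (m : ℕ) : coefL m (DD κ x) = coefL m x * Db κ m := coef_diag _ _ _ _ _

def e1 : WA := cosE 1
lemma norm_e1 : ‖e1‖ = 4 := by unfold e1; rw [norm_cosE]; norm_num [W]

lemma DD_eq (κ : ℝ) (x : WA) : coefL 1 x • e1 - DD κ x = (-κ) • (x - coefL 1 x • e1) := by
  refine coef_ext fun m => ?_
  simp only [map_sub, map_smul, DD_coef, Db, e1, coef_cosE, smul_eq_mul]
  split_ifs with h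
  · subst h; ring
  · ring

def JJ (q : ℝ → WA) (y : ℝ) : WA := TI (fun _ => ContinuousLinearMap.id ℝ WA) q y

lemma idK_le (r : ℝ) (_ : 0 < r) : ‖ContinuousLinearMap.id ℝ WA‖ ≤ 1 := ContinuousLinearMap.norm_id_le

lemma JJ_norm {q : ℝ → WA} {B : ℝ} (hb : ∀ y, ‖q y‖ ≤ B) (y : ℝ) : ‖JJ q y‖ ≤ B := by
  have := TI_norm (K := fun _ => ContinuousLinearMap.id ℝ WA) idK_le hb y
  rw [one_mul] at this
  exact this
lemma JJ_cont {q : ℝ → WA} {B : ℝ} (hq : Continuous q) (hb : ∀ y, ‖q y‖ ≤ B) : Continuous (JJ q) :=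
  TI_cont continuous_const idK_le hq hb
lemma JJ_sub {q q' : ℝ → WA} {B d : ℝ} (hq : Continuous q) (hb : ∀ y, ‖q y‖ ≤ B)
    (hq' : Continuous q') (hb' : ∀ y, ‖q' y‖ ≤ B) (hd : ∀ y, ‖q y - q' y‖ ≤ d) (y : ℝ) :
    ‖JJ q y - JJ q' y‖ ≤ d := by
  unfold JJ
  rw [TI_sub continuous_const idK_le hq hb hq' hb' y]
  exact JJ_norm (q := fun s => q s - q' s) hd y

def V0 (y : ℝ) : WA := χ y • e1
def VV (κ : ℝ) (q : ℝ → WA) (y : ℝ) : WA := V0 y - DD κ (JJ q y)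
def VD (κ : ℝ) (q : ℝ → WA) (y : ℝ) : WA := χd y • e1 + DD κ (q y)
def ee (δ : ℝ) : ℝ := δ / Real.sqrt (1 + δ ^ 2)
def ss (δ y : ℝ) : ℝ := ee δ * θ y
def PP (N : NL) (s : ℝ) (V V' : WA) : WA := V ^ 2 * V' + s ^ 2 • N.P0 s V V'
def h1 (N : NL) (δ κ : ℝ) (q : ℝ → WA) (y : ℝ) : ℝ :=
  coefL 1 ((1 / 3 : ℝ) • VV κ q y ^ 3 + ss δ y ^ 2 • N.Q0 (ss δ y) (VV κ q y) - (1 / 3 : ℝ) • V0 y ^ 3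
    + V0 y ^ 2 * (coefL 1 (JJ q y) • e1))
def PQ (N : NL) (δ κ : ℝ) (q : ℝ → WA) (y : ℝ) : WA := PP N (ss δ y) (VV κ q y) (VD κ q y)
def T2 (δ : ℝ) (h : ℝ → WA) (y : ℝ) : WA := θ y ^ 2 • TI (K2 δ) h (cl y)
/-- the fixed point map -/
def Phi (N : NL) (δ κ : ℝ) (q : ℝ → WA) (y : ℝ) : WA :=
  T1 (h1 N δ κ q) y • e1 - κ⁻¹ • T2 δ (PQ N δ κ q) y

lemma cubic_id (v Z w : WA) : (1 / 3 : ℝ) • (v - Z) ^ 3 - (1 / 3 : ℝ) • v ^ 3 + v ^ 2 * w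
    = v ^ 2 * (w - Z) + v * Z ^ 2 - (1 / 3 : ℝ) • Z ^ 3 := by
  simp only [Algebra.smul_def]
  have h : (3 : WA) * algebraMap ℝ WA (1 / 3) = 1 := by
    rw [show (3 : WA) = algebraMap ℝ WA 3 from (map_ofNat _ 3).symm, ← map_mul]; norm_num
  linear_combination (- v ^ 2 * Z + v * Z ^ 2) * h

end KGP

namespace KGP

structure Adm (N : NL) (δ κ : ℝ) : Prop where
  δ0 : 0 < δ
  δ1 : δ ≤ 1
  δρ : 25 * δ < N.ρ
  κ0 : 0 < κ
  κ1 : κ ≤ 1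

/-- bounded continuous by `r` -/
def BC (r : ℝ) (q : ℝ → WA) : Prop := Continuous q ∧ ∀ y, ‖q y‖ ≤ r

lemma ee_pos {δ : ℝ} (h : 0 < δ) : 0 < ee δ := by unfold ee; positivity
lemma ee_le {δ : ℝ} (h : 0 < δ) : ee δ ≤ δ := by
  unfold ee
  apply div_le_self h.le
  rw [Real.one_le_sqrt]; nlinarith

variable {N : NL} {δ κ r d : ℝ} {q q' : ℝ → WA}

lemma ss_nn (h : Adm N δ κ) (y : ℝ) : 0 ≤ ss δ y := mul_nonneg (ee_pos h.δ0).le (θ_pos y).le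
lemma ss_le (h : Adm N δ κ) (y : ℝ) : ss δ y ≤ δ := by
  have h1 := ee_le h.δ0
  have h2 := ee_pos h.δ0
  have h3 := θ_le y
  have h4 := θ_pos y
  unfold ss
  nlinarith
lemma cont_ss : Continuous (ss δ) := continuous_const.mul cont_θ

lemma V0_norm (y : ℝ) : ‖V0 y‖ ≤ 24 := by
  unfold V0
  rw [norm_smul, norm_e1, Real.norm_eq_abs]
  have := χ_le y
  linarith
lemma V0_cont : Continuous V0 := cont_χ.smul continuous_const

lemma Z_norm (h : Adm N δ κ) (hq : BC r q) (y : ℝ) : ‖DD κ (JJ q y)‖ ≤ r :=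
  (DD_norm h.κ0 h.κ1 _).trans (JJ_norm hq.2 y)

lemma VV_norm (h : Adm N δ κ) (hr : r ≤ 1) (hq : BC r q) (y : ℝ) : ‖VV κ q y‖ ≤ 25 := by
  have h1 := V0_norm y
  have h2 := Z_norm h hq y
  unfold VV
  refine (norm_sub_le _ _).trans ?_
  linarith
lemma VV_cont (hq : BC r q) : Continuous (VV κ q) := by
  have := JJ_cont hq.1 hq.2
  have := V0_cont
  unfold VV
  fun_prop

lemma VD_norm (h : Adm N δ κ) (hr : r ≤ 1) (hq : BC r q) (y : ℝ) : ‖VD κ q y‖ ≤ 25 := by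
  have h1 := χd_le y
  have h2 := (DD_norm h.κ0 h.κ1 (q y)).trans (hq.2 y)
  unfold VD
  refine (norm_add_le _ _).trans ?_
  rw [norm_smul, norm_e1, Real.norm_eq_abs]
  linarith
lemma VD_cont (hq : BC r q) : Continuous (VD κ q) := by
  have := cont_χd
  have := hq.1
  unfold VD
  fun_prop

lemma VV_sub (h : Adm N δ κ) (hq : BC r q) (hq' : BC r q') (hd : ∀ y, ‖q y - q' y‖ ≤ d) (y : ℝ) :
    ‖VV κ q y - VV κ q' y‖ ≤ d := by
  have e : VV κ q y - VV κ q' y = - DD κ (JJ q y - JJ q' y) := by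
    unfold VV; rw [map_sub]; abel
  rw [e, norm_neg]
  exact (DD_norm h.κ0 h.κ1 _).trans (JJ_sub hq.1 hq.2 hq'.1 hq'.2 hd y)

lemma VD_sub (h : Adm N δ κ) (hd : ∀ y, ‖q y - q' y‖ ≤ d) (y : ℝ) :
    ‖VD κ q y - VD κ q' y‖ ≤ d := by
  have e : VD κ q y - VD κ q' y = DD κ (q y - q' y) := by
    unfold VD; rw [map_sub]; abel
  rw [e]
  exact (DD_norm h.κ0 h.κ1 _).trans (hd y)

lemma mem_AR (h : Adm N δ κ) (hr : r ≤ 1) (hq : BC r q) (y : ℝ) : (VV κ q y, VD κ q y) ∈ AR N 25 (ss δ y) := by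
  have h1 := ss_le h y
  have h2 := h.δρ
  have h3 := h.δ1
  exact ⟨ss_nn h y, h1.trans h3, by linarith, VV_norm h hr hq y, VD_norm h hr hq y⟩

lemma sV_lt (h : Adm N δ κ) (hr : r ≤ 1) (hq : BC r q) (y : ℝ) : ‖ss δ y • VV κ q y‖ < N.ρ :=
  UL_ball N 25 (ss δ y) (VV κ q y, VD κ q y) (mem_AR h hr hq y)

lemma Q0_cont (h : Adm N δ κ) (hr : r ≤ 1) (hq : BC r q) : Continuous fun y => N.Q0 (ss δ y) (VV κ q y) := by
  have h1 := N.cont_g (cont_ss.smul (VV_cont (κ := κ) hq)) (sV_lt h hr hq)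
  have h2 := VV_cont (κ := κ) hq
  simp only [Pi.smul_apply'] at h1
  unfold NL.Q0
  fun_prop

lemma P0_cont (h : Adm N δ κ) (hr : r ≤ 1) (hq : BC r q) :
    Continuous fun y => N.P0 (ss δ y) (VV κ q y) (VD κ q y) := by
  have h1 := N.cont_g (cont_ss.smul (VV_cont (κ := κ) hq)) (sV_lt h hr hq)
  have h2 := VV_cont (κ := κ) hq
  have h3 := VD_cont (κ := κ) hq
  have h4 := N.cont_g' (cont_ss.smul (VV_cont (κ := κ) hq)) (sV_lt h hr hq)
  have h5 := cont_ss (δ := δ)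
  simp only [Pi.smul_apply'] at h1 h4
  have h6 := h4.clm_apply h3
  unfold NL.P0
  fun_prop

lemma PQ_cont (h : Adm N δ κ) (hr : r ≤ 1) (hq : BC r q) : Continuous (PQ N δ κ q) := by
  have h1 := P0_cont h hr hq
  have h2 := VV_cont (κ := κ) hq
  have h3 := VD_cont (κ := κ) hq
  have h5 := cont_ss (δ := δ)
  unfold PQ PP
  fun_prop

lemma h1_cont (h : Adm N δ κ) (hr : r ≤ 1) (hq : BC r q) : Continuous (h1 N δ κ q) := by
  have h1 := Q0_cont h hr hq
  have h2 := VV_cont (κ := κ) hq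
  have h3 := V0_cont
  have h5 := cont_ss (δ := δ)
  have h6 := JJ_cont hq.1 hq.2
  unfold KGP.h1
  fun_prop

lemma PQ_est (N : NL) : ∃ C, 0 ≤ C ∧ ∀ δ κ r q, Adm N δ κ → r ≤ 1 → BC r q →
    (∀ y, ‖PQ N δ κ q y‖ ≤ C) ∧ (∀ y, ‖N.P0 (ss δ y) (VV κ q y) (VD κ q y)‖ ≤ C) ∧
    ∀ q' d, BC r q' → (∀ y, ‖q y - q' y‖ ≤ d) → ∀ y, ‖PQ N δ κ q y - PQ N δ κ q' y‖ ≤ C * d := by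
  obtain ⟨C0, hC0, k0⟩ := UL_P0 N 25
  have hU : UL (AR N 25) (fun s p => PP N s p.1 p.2) := by
    refine UL.add (UL_P1 N 25) (UL.smul (c := fun s => s ^ 2) (K := 1) (UL_P0 N 25) ?_)
    intro s hs
    have := UL_s N 25 s hs
    rw [abs_pow]
    exact pow_le_one₀ (abs_nonneg _) this
  obtain ⟨C, hC, k⟩ := hU
  refine ⟨C + C0, by positivity, fun δ κ r q h hr hq => ⟨fun y => ?_, fun y => ?_, fun q' d hq' hd y => ?_⟩⟩
  · have := (k _ _ (mem_AR h hr hq y)).1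
    change ‖PP N (ss δ y) (VV κ q y) (VD κ q y)‖ ≤ _
    linarith
  · have := (k0 _ _ (mem_AR h hr hq y)).1
    linarith
  · have := (k _ _ (mem_AR h hr hq y)).2 _ (mem_AR h hr hq' y)
    have h2 : ‖(VV κ q y, VD κ q y) - (VV κ q' y, VD κ q' y)‖ ≤ d := by
      rw [Prod.mk_sub_mk]
      exact norm_prod_le_iff.2 ⟨VV_sub h hq hq' hd y, VD_sub h hd y⟩
    have hd0 : 0 ≤ d := (norm_nonneg _).trans h2
    refine this.trans ?_
    have := mul_le_mul_of_nonneg_left h2 hC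
    nlinarith

lemma cubic_lip {v Z Z' u u' : WA} {r d κ : ℝ} (hr : r ≤ 1) (hκ : 0 ≤ κ) (hv : ‖v‖ ≤ 24) (hZ : ‖Z‖ ≤ r) (hZ' : ‖Z'‖ ≤ r)
    (hd : ‖Z - Z'‖ ≤ d) (hu : ‖u - u'‖ ≤ 5 * d) :
    ‖(v ^ 2 * ((-κ) • u) + v * Z ^ 2 - (1 / 3 : ℝ) • Z ^ 3) - (v ^ 2 * ((-κ) • u') + v * Z' ^ 2 - (1 / 3 : ℝ) • Z' ^ 3)‖
      ≤ 2880 * (κ + r) * d := by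
  have hr0 : 0 ≤ r := (norm_nonneg _).trans hZ
  have hd0 : 0 ≤ d := (norm_nonneg _).trans hd
  have e : (v ^ 2 * ((-κ) • u) + v * Z ^ 2 - (1 / 3 : ℝ) • Z ^ 3)
      - (v ^ 2 * ((-κ) • u') + v * Z' ^ 2 - (1 / 3 : ℝ) • Z' ^ 3)
      = (-κ) • (v ^ 2 * (u - u')) + v * ((Z + Z') * (Z - Z'))
        + (-(1 / 3) : ℝ) • ((Z ^ 2 + Z * Z' + Z' ^ 2) * (Z - Z')) := by
    simp only [Algebra.smul_def, map_neg]
    ring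
  have n1 : ‖(-κ) • (v ^ 2 * (u - u'))‖ ≤ κ * (24 ^ 2 * (5 * d)) := by
    rw [norm_smul, norm_neg, Real.norm_of_nonneg hκ]
    have a := norm_mul_le (v ^ 2) (u - u')
    have b : ‖v ^ 2‖ ≤ 24 ^ 2 := (norm_pow_le v 2).trans (pow_le_pow_left₀ (norm_nonneg _) hv 2)
    refine mul_le_mul_of_nonneg_left (a.trans ?_) hκ
    exact mul_le_mul b hu (norm_nonneg _) (by norm_num)
  have n2 : ‖v * ((Z + Z') * (Z - Z'))‖ ≤ 24 * ((r + r) * d) := by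
    refine (norm_mul_le _ _).trans (mul_le_mul hv ((norm_mul_le _ _).trans ?_) (norm_nonneg _) (by norm_num))
    exact mul_le_mul ((norm_add_le _ _).trans (add_le_add hZ hZ')) hd (norm_nonneg _) (by linarith)
  have n3 : ‖(-(1 / 3) : ℝ) • ((Z ^ 2 + Z * Z' + Z' ^ 2) * (Z - Z'))‖ ≤ 1 * ((r + r + r) * d) := by
    rw [norm_smul]
    refine mul_le_mul (by norm_num) ((norm_mul_le _ _).trans (mul_le_mul ?_ hd (norm_nonneg _) (by linarith)))
      (norm_nonneg _) (by norm_num)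
    have s1 : ∀ a b : WA, ‖a‖ ≤ r → ‖b‖ ≤ r → ‖a * b‖ ≤ r := fun a b ha hb => by
      have := norm_mul_le a b
      have := mul_le_mul ha hb (norm_nonneg _) hr0
      nlinarith
    refine norm_add₃_le.trans ?_
    rw [pow_two, pow_two]
    have := s1 Z Z hZ hZ
    have := s1 Z Z' hZ hZ'
    have := s1 Z' Z' hZ' hZ'
    linarith
  rw [e]
  refine norm_add₃_le.trans ?_
  have : 0 ≤ r * d := by positivity
  nlinarith

lemma h1_eq (N : NL) (δ κ : ℝ) (q : ℝ → WA) (y : ℝ) : h1 N δ κ q y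
    = coefL 1 ((V0 y ^ 2 * ((-κ) • (JJ q y - coefL 1 (JJ q y) • e1)) + V0 y * (DD κ (JJ q y)) ^ 2
        - (1 / 3 : ℝ) • (DD κ (JJ q y)) ^ 3) + ss δ y ^ 2 • N.Q0 (ss δ y) (VV κ q y)) := by
  have := cubic_id (V0 y) (DD κ (JJ q y)) (coefL 1 (JJ q y) • e1)
  rw [DD_eq] at this
  rw [← this]
  unfold h1 VV
  congr 1
  abel

lemma proj_norm (x : WA) : ‖x - coefL 1 x • e1‖ ≤ 5 * ‖x‖ := by
  have h := abs_coef_le 1 x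
  refine (norm_sub_le _ _).trans ?_
  rw [norm_smul, norm_e1, Real.norm_eq_abs]
  linarith

lemma h1_est (N : NL) : ∃ C, 0 ≤ C ∧ ∀ δ κ r q, Adm N δ κ → r ≤ 1 → BC r q →
    (∀ y, ‖N.Q0 (ss δ y) (VV κ q y)‖ ≤ C) ∧ (∀ y, |h1 N δ κ q y| ≤ C) ∧
    ∀ q' d, BC r q' → (∀ y, ‖q y - q' y‖ ≤ d) → ∀ y, |h1 N δ κ q y - h1 N δ κ q' y| ≤ C * (κ + r + δ) * d := by
  obtain ⟨C, hC, k⟩ := UL_Q0 N 25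
  have lip : ∀ δ κ r q, Adm N δ κ → r ≤ 1 → BC r q → ∀ q' d, BC r q' → (∀ y, ‖q y - q' y‖ ≤ d) →
      ∀ y, |h1 N δ κ q y - h1 N δ κ q' y| ≤ (C + 2880) * (κ + r + δ) * d := by
    intro δ κ r q h hr hq q' d hq' hd y
    rw [h1_eq, h1_eq, ← map_sub]
    refine (abs_coef_le 1 _).trans ?_
    rw [add_sub_add_comm]
    have hZd : ‖DD κ (JJ q y) - DD κ (JJ q' y)‖ ≤ d := by
      rw [← map_sub]
      exact (DD_norm h.κ0 h.κ1 _).trans (JJ_sub hq.1 hq.2 hq'.1 hq'.2 hd y)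
    have hd0 : 0 ≤ d := (norm_nonneg _).trans (hd 0)
    have hu : ‖(JJ q y - coefL 1 (JJ q y) • e1) - (JJ q' y - coefL 1 (JJ q' y) • e1)‖ ≤ 5 * d := by
      have e : (JJ q y - coefL 1 (JJ q y) • e1) - (JJ q' y - coefL 1 (JJ q' y) • e1)
        = (JJ q y - JJ q' y) - coefL 1 (JJ q y - JJ q' y) • e1 := by
        rw [map_sub, sub_smul]; abel
      rw [e]
      have := JJ_sub hq.1 hq.2 hq'.1 hq'.2 hd y
      exact (proj_norm _).trans (by linarith)
    have n1 := cubic_lip hr h.κ0.le (V0_norm y) (Z_norm h hq y) (Z_norm h hq' y) hZd hu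
    have n2 : ‖ss δ y ^ 2 • N.Q0 (ss δ y) (VV κ q y) - ss δ y ^ 2 • N.Q0 (ss δ y) (VV κ q' y)‖ ≤ δ * (C * d) := by
      rw [← smul_sub, norm_smul, Real.norm_of_nonneg (by positivity)]
      have a := (k _ _ (mem_AR h hr hq y)).2 _ (mem_AR h hr hq' y)
      have h2 : ‖(VV κ q y, VD κ q y) - (VV κ q' y, VD κ q' y)‖ ≤ d := by
        rw [Prod.mk_sub_mk]
        exact norm_prod_le_iff.2 ⟨VV_sub h hq hq' hd y, VD_sub h hd y⟩
      have b := a.trans (mul_le_mul_of_nonneg_left h2 hC)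
      have s1 := ss_nn h y
      have s2 := ss_le h y
      have s3 := h.δ1
      refine mul_le_mul ?_ b (norm_nonneg _) h.δ0.le
      nlinarith
    refine (norm_add_le _ _).trans ((add_le_add n1 n2).trans ?_)
    have := h.δ0
    have := h.κ0
    have hr0 : 0 ≤ r := (norm_nonneg _).trans (hq.2 0)
    have p1 : 0 ≤ C * κ * d := by positivity
    have p2 : 0 ≤ C * r * d := by positivity
    have p3 : 0 ≤ δ * d := by positivity
    nlinarith
  have zero : ∀ δ κ, Adm N δ κ → ∀ y, |h1 N δ κ (fun _ => 0) y| ≤ C := by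
    intro δ κ h y
    have hJ : JJ (fun _ => 0) y = 0 := by simp [JJ, TI]
    have h0 : BC 0 (fun _ : ℝ => (0 : WA)) := ⟨continuous_const, by simp⟩
    rw [h1_eq, hJ]
    simp only [map_zero, zero_smul, sub_zero, smul_zero, mul_zero, ne_eq, OfNat.ofNat_ne_zero,
      not_false_eq_true, zero_pow, add_zero, zero_add]
    refine (abs_coef_le 1 _).trans ?_
    rw [norm_smul, Real.norm_of_nonneg (by positivity)]
    have a := (k _ _ (mem_AR h zero_le_one h0 y)).1
    have s1 := ss_nn h y
    have s2 := ss_le h y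
    have s3 := h.δ1
    have : ss δ y ^ 2 ≤ 1 := pow_le_one₀ s1 (s2.trans s3)
    simp only at a
    nlinarith [norm_nonneg (N.Q0 (ss δ y) (VV κ (fun _ => 0) y))]
  refine ⟨C + 3 * (C + 2880), by positivity, fun δ κ r q h hr hq => ⟨fun y => ?_, fun y => ?_, ?_⟩⟩
  · have := (k _ _ (mem_AR h hr hq y)).1
    simp only at this
    linarith
  · have hr0 : 0 ≤ r := (norm_nonneg _).trans (hq.2 0)
    have a := lip δ κ r q h hr hq (fun _ => 0) r ⟨continuous_const, by simpa using hr0⟩ (by simpa using hq.2) y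
    have b := zero δ κ h y
    have c := abs_add_le (h1 N δ κ q y - h1 N δ κ (fun _ => 0) y) (h1 N δ κ (fun _ => 0) y)
    rw [sub_add_cancel] at c
    have := h.δ1
    have := h.κ1
    have := h.κ0
    have := h.δ0
    have : (C + 2880) * (κ + r + δ) * r ≤ (C + 2880) * 3 * 1 := by
      gcongr; linarith
    linarith
  · intro q' d hq' hd y
    refine (lip δ κ r q h hr hq q' d hq' hd y).trans ?_
    have hr0 : 0 ≤ r := (norm_nonneg _).trans (hq.2 0)
    have hd0 : 0 ≤ d := (norm_nonneg _).trans (hd 0)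
    have := h.κ0
    have := h.δ0
    gcongr
    linarith

end KGP

namespace KGP

lemma ibp_osc {l B : ℝ} (hl : 0 < l) {k k' : ℝ → ℝ} (hk : ∀ s, HasDerivAt k (k' s) s) (hc : Continuous k')
    (hb : ∀ s, 0 ≤ s → |k s| ≤ B * Real.exp (-s)) (hb' : ∀ s, 0 ≤ s → |k' s| ≤ B * Real.exp (-s)) {y : ℝ} (hy : 0 ≤ y) :
    |∫ r in Set.Ioi (0 : ℝ), k (y + r) * Real.sin (l * r)| ≤ 2 * B * Real.exp (-y) / l := by
  have hkc : Continuous k := continuous_iff_continuousAt.2 fun s => (hk s).continuousAt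
  have hB : 0 ≤ B := by
    have := (abs_nonneg _).trans (hb 0 le_rfl)
    simpa using this
  have bd : ∀ f : ℝ → ℝ, (∀ s, 0 ≤ s → |f s| ≤ B * Real.exp (-s)) → ∀ g : ℝ → ℝ, (∀ r, |g r| ≤ 1) →
      ∀ r, 0 ≤ r → ‖f (y + r) * g r‖ ≤ (B * Real.exp (-y)) * Real.exp (-r) := by
    intro f hf g hg r hr
    rw [Real.norm_eq_abs, abs_mul]
    have h1 := hf (y + r) (by positivity)
    rw [neg_add, Real.exp_add] at h1
    calc _ ≤ (B * (Real.exp (-y) * Real.exp (-r))) * 1 := mul_le_mul h1 (hg r) (abs_nonneg _) (by positivity)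
      _ = _ := by ring
  have hs : ∀ r, |Real.sin (l * r)| ≤ 1 := fun r => Real.abs_sin_le_one _
  have hcs : ∀ r, |(-Real.cos (l * r))| ≤ 1 := fun r => by rw [abs_neg]; exact Real.abs_cos_le_one _
  have I1 : IntegrableOn (fun r => k (y + r) * Real.sin (l * r)) (Set.Ioi 0) :=
    integrable_of_exp (by fun_prop) (bd k hb _ hs)
  have I2 : IntegrableOn (fun r => k' (y + r) * (-Real.cos (l * r))) (Set.Ioi 0) :=
    integrable_of_exp (by fun_prop) (bd k' hb' _ hcs)
  have key := integral_Ioi_mul_deriv_eq_deriv_mul (a := (0 : ℝ)) (u := fun r => k (y + r))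
    (v := fun r => -Real.cos (l * r) / l)
    (u' := fun r => k' (y + r)) (v' := fun r => Real.sin (l * r)) (a' := - k y / l) (b' := 0)
    (fun r _ => by simpa using (hk (y + r)).comp_const_add y r)
    (fun r _ => by
      have h1 : HasDerivAt (fun r => l * r) l r := by simpa using (hasDerivAt_id r).const_mul l
      have := (h1.cos.neg).div_const l
      refine this.congr_deriv ?_
      field_simp)
    I1
    (by
      have := I2.div_const l
      refine this.congr (Eventually.of_forall fun r => ?_)
      simp only [Pi.mul_apply]; ring)
    (by
      have : Continuous ((fun r => k (y + r)) * fun r => -Real.cos (l * r) / l) := by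
        refine Continuous.mul (by fun_prop) (by fun_prop)
      have h2 := (this.tendsto 0).mono_left (nhdsWithin_le_nhds (s := Set.Ioi 0))
      convert h2 using 2
      simp; ring)
    (by
      have h2 : Tendsto (fun r : ℝ => (B * Real.exp (-y)) / l * Real.exp (-r)) atTop (𝓝 0) := by
        simpa using (Real.tendsto_exp_neg_atTop_nhds_zero).const_mul ((B * Real.exp (-y)) / l)
      refine squeeze_zero_norm' ?_ h2
      filter_upwards [eventually_ge_atTop 0] with r hr
      have h3 := bd k hb _ hcs r hr
      have e : ((fun r => k (y + r)) * fun r => -Real.cos (l * r) / l) r = k (y + r) * (-Real.cos (l * r)) / l := by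
        simp only [Pi.mul_apply]; ring
      rw [e, norm_div, Real.norm_of_nonneg hl.le, div_mul_eq_mul_div]
      gcongr)
  rw [key]
  have h3 : |∫ r in Set.Ioi (0 : ℝ), k' (y + r) * (-Real.cos (l * r) / l)| ≤ B * Real.exp (-y) / l := by
    have e : (fun r => k' (y + r) * (-Real.cos (l * r) / l)) = fun r => (k' (y + r) * (-Real.cos (l * r))) / l := by
      funext r; ring
    rw [e, integral_div, abs_div, abs_of_pos hl]
    gcongr
    have := norm_integral_le_of_norm_le (μ := volume.restrict (Set.Ioi (0 : ℝ)))
      (f := fun r => k' (y + r) * (-Real.cos (l * r)))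
      ((integrableOn_exp_neg_Ioi 0).const_mul (B * Real.exp (-y)))
      (by
        filter_upwards [ae_restrict_mem measurableSet_Ioi] with r hr
        exact bd k' hb' _ hcs r (le_of_lt hr))
    rwa [integral_const_mul, integral_exp_neg_Ioi_zero, mul_one] at this
  have h4 : |-k y / l| ≤ B * Real.exp (-y) / l := by
    rw [abs_div, abs_neg, abs_of_pos hl]
    gcongr
    exact hb y hy
  rw [zero_sub]
  refine (abs_sub _ _).trans ?_
  rw [abs_neg]
  have : 2 * B * Real.exp (-y) / l = B * Real.exp (-y) / l + B * Real.exp (-y) / l := by ring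
  linarith

def k1 (s : ℝ) : ℝ := vh s ^ 2 * vhd s
def k1d (s : ℝ) : ℝ := 2 * vh s * vhd s ^ 2 + vh s ^ 2 * (vh s - vh s ^ 3 / 4)

lemma hd_k1 (s : ℝ) : HasDerivAt k1 (k1d s) s := by
  have := ((hd_vh s).pow 2).mul (hd_vhd s)
  refine this.congr_deriv ?_
  simp only [Pi.pow_apply, k1d]
  push_cast; ring

lemma cont_k1d : Continuous k1d := by
  have := cont_vh
  have := cont_vhd
  unfold k1d; fun_prop

lemma k1_bd (s : ℝ) : |k1 s| ≤ 600 * Real.exp (-s) ∧ |k1d s| ≤ 600 * Real.exp (-s) := by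
  have h1 := vh_le s
  have h2 := vh_pos s
  have h3 := vhd_le s
  have h4 := inv_ch_le s
  have h5 := inv_ch_le_one s
  have h0 : 0 ≤ 1 / Real.cosh s := by have := Real.cosh_pos s; positivity
  set z := 1 / Real.cosh s
  have z3 : z ^ 3 ≤ z := by
    calc z ^ 3 = z * z ^ 2 := by ring
      _ ≤ z * 1 := mul_le_mul_of_nonneg_left (pow_le_one₀ h0 h5) h0
      _ = z := by ring
  have z5 : z ^ 5 ≤ z := by
    calc z ^ 5 = z * z ^ 4 := by ring
      _ ≤ z * 1 := mul_le_mul_of_nonneg_left (pow_le_one₀ h0 h5) h0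
      _ = z := by ring
  constructor
  · unfold k1
    rw [abs_mul, abs_of_nonneg (by positivity)]
    have : vh s ^ 2 * |vhd s| ≤ (3 * z) ^ 2 * (3 * z) := by gcongr
    nlinarith
  · unfold k1d
    refine (abs_add_le _ _).trans ?_
    have a1 : |2 * vh s * vhd s ^ 2| ≤ 2 * (3 * z) * (3 * z) ^ 2 := by
      rw [abs_mul, abs_of_nonneg (by positivity), abs_pow]; gcongr
    have a2 : |vh s ^ 2 * (vh s - vh s ^ 3 / 4)| ≤ (3 * z) ^ 2 * (3 * z + (3 * z) ^ 3 / 4) := by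
      rw [abs_mul, abs_of_nonneg (by positivity)]
      gcongr
      refine (abs_sub _ _).trans ?_
      rw [abs_of_pos h2, abs_of_pos (by positivity)]
      gcongr
    nlinarith

lemma SS_e1cube (δ r : ℝ) : SS δ r (e1 ^ 3) = ((1 / 4) * (Real.sin (lam δ 3 * r) / lam δ 3)) • cosE 3 := by
  unfold e1 SS
  rw [e1_cube, map_add, map_smul, map_smul, diag_cosE, diag_cosE]
  have h1 : Sb δ r 1 = 0 := by unfold Sb; rw [if_neg (by omega)]
  have h3 : Sb δ r 3 = Real.sin (lam δ 3 * r) / lam δ 3 := by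
    unfold Sb; rw [if_pos ⟨by decide, le_rfl⟩]
  rw [h1, h3, zero_smul, smul_zero, zero_add, smul_smul]

lemma exp_χ (y : ℝ) : χ y ^ 2 * χd y = Real.exp (cl y) ^ 3 * k1 (cl y) := by
  unfold χ χd k1; ring

lemma base_bd {δ : ℝ} (h0 : 0 < δ) (h1 : δ ≤ 1) (y : ℝ) :
    ‖T2 δ (fun s => (χ s ^ 2 * χd s) • e1 ^ 3) y‖ ≤ 4800 * δ ^ 2 := by
  set c := cl y with hc
  have hc0 : 0 ≤ c := cl_nn y
  have hl := lam_ge h0 h1 (le_refl 3)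
  have hl0 : 0 < lam δ 3 := (by positivity : 0 < 2 / δ).trans_le hl
  have key := ibp_osc hl0 hd_k1 cont_k1d (fun s _ => (k1_bd s).1) (fun s _ => (k1_bd s).2) hc0
  have e : TI (K2 δ) (fun s => (χ s ^ 2 * χd s) • e1 ^ 3) c
      = (Real.exp c ^ 3 * ((1 / 4) / lam δ 3) * ∫ r in Set.Ioi (0 : ℝ), k1 (c + r) * Real.sin (lam δ 3 * r)) • cosE 3 := by
    unfold TI
    rw [← integral_const_mul, ← integral_smul_const]
    refine setIntegral_congr_fun measurableSet_Ioi fun r hr => ?_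
    have hr0 : 0 ≤ c + r := add_nonneg hc0 (le_of_lt hr)
    simp only [K2, _root_.smul_apply, map_smul, SS_e1cube, smul_smul, exp_χ, cl_eq hr0]
    congr 1
    have : Real.exp (-r) * (Real.exp (-2 * r) * Real.exp (c + r) ^ 3) = Real.exp c ^ 3 := by
      rw [← Real.exp_nat_mul, ← Real.exp_nat_mul, ← Real.exp_add, ← Real.exp_add]
      congr 1; push_cast; ring
    rw [← this]
    ring
  unfold T2
  rw [← hc, e, norm_smul, norm_smul, norm_cosE, Real.norm_eq_abs, Real.norm_eq_abs, abs_mul, abs_mul,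
    abs_of_pos (by positivity : 0 < Real.exp c ^ 3), abs_of_pos (by positivity : 0 < 1 / 4 / lam δ 3),
    abs_of_pos (pow_pos (θ_pos y) 2)]
  have t1 : θ y ^ 2 * Real.exp c ^ 3 * Real.exp (-c) = 1 := by
    have : Real.exp (-c) = θ y := rfl
    rw [this]
    have := θ_exp y
    rw [← hc] at this
    calc _ = (θ y * Real.exp c) ^ 3 := by ring
      _ = 1 := by rw [this]; ring
  have hinv : 1 / lam δ 3 ≤ δ / 2 := by
    rw [div_le_iff₀ hl0]
    have := mul_le_mul_of_nonneg_left hl h0.le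
    have h5 : δ * (2 / δ) = 2 := by field_simp
    linarith
  have hp : 0 < 1 / lam δ 3 := by positivity
  calc θ y ^ 2 * (Real.exp c ^ 3 * (1 / 4 / lam δ 3)
        * |∫ r in Set.Ioi (0 : ℝ), k1 (c + r) * Real.sin (lam δ 3 * r)| * W 3)
      ≤ θ y ^ 2 * (Real.exp c ^ 3 * (1 / 4 / lam δ 3) * (2 * 600 * Real.exp (-c) / lam δ 3) * W 3) := by
        have := W_pos 3
        gcongr
    _ = (θ y ^ 2 * Real.exp c ^ 3 * Real.exp (-c)) * (4800 * (1 / lam δ 3) ^ 2) := by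
        unfold W; push_cast; ring
    _ ≤ 4800 * δ ^ 2 := by
        rw [t1, one_mul]
        have : (1 / lam δ 3) ^ 2 ≤ (δ / 2) ^ 2 := pow_le_pow_left₀ hp.le hinv 2
        nlinarith

lemma T2_cont {δ B : ℝ} (h0 : 0 < δ) (h1 : δ ≤ 1) {h : ℝ → WA} (hh : Continuous h) (hb : ∀ s, ‖h s‖ ≤ B) :
    Continuous (T2 δ h) := by
  have a := (TI_cont (K2_cont δ) (K2_le h0 h1) hh hb).comp cont_cl
  have := cont_θ
  unfold T2
  simp only [Function.comp_def] at a
  fun_prop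

lemma T2_norm {δ B : ℝ} (h0 : 0 < δ) (h1 : δ ≤ 1) {h : ℝ → WA} (hb : ∀ s, ‖h s‖ ≤ B) (y : ℝ) :
    ‖T2 δ h y‖ ≤ δ * B := by
  unfold T2
  rw [norm_smul, Real.norm_of_nonneg (by positivity)]
  have a := TI_norm (K2_le h0 h1) hb (cl y)
  have b : θ y ^ 2 ≤ 1 := pow_le_one₀ (θ_pos y).le (θ_le y)
  nlinarith [norm_nonneg (TI (K2 δ) h (cl y))]

lemma T2_sub {δ B : ℝ} (h0 : 0 < δ) (h1 : δ ≤ 1) {h h' : ℝ → WA} (hh : Continuous h) (hb : ∀ s, ‖h s‖ ≤ B)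
    (hh' : Continuous h') (hb' : ∀ s, ‖h' s‖ ≤ B) (y : ℝ) :
    T2 δ h y - T2 δ h' y = T2 δ (fun s => h s - h' s) y := by
  unfold T2
  rw [← smul_sub, TI_sub (K2_cont δ) (K2_le h0 h1) hh hb hh' hb']

lemma JJ_zero (y : ℝ) : JJ (fun _ => 0) y = 0 := by simp [JJ, TI]
lemma BC_zero {r : ℝ} (hr : 0 ≤ r) : BC r (fun _ : ℝ => (0 : WA)) := ⟨continuous_const, by simpa using hr⟩

lemma Phi_zero (N : NL) : ∃ C, 0 ≤ C ∧ ∀ δ κ, Adm N δ κ → ∀ y, ‖Phi N δ κ (fun _ => 0) y‖ ≤ C * κ⁻¹ * δ ^ 2 := by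
  obtain ⟨C1, hC1, k1⟩ := PQ_est N
  obtain ⟨C2, hC2, k2⟩ := h1_est N
  refine ⟨92 * C2 + (C1 + 4800), by positivity, fun δ κ h y => ?_⟩
  obtain ⟨q1, -, -⟩ := k2 δ κ 1 (fun _ => 0) h le_rfl (BC_zero zero_le_one)
  obtain ⟨p0, p1, -⟩ := k1 δ κ 1 (fun _ => 0) h le_rfl (BC_zero zero_le_one)
  have hs : ∀ y, ss δ y ^ 2 ≤ δ ^ 2 := fun y => pow_le_pow_left₀ (ss_nn h y) (ss_le h y) 2
  have hκ : 1 ≤ κ⁻¹ := (one_le_inv₀ h.κ0).2 h.κ1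
  have b1 : ∀ y, |h1 N δ κ (fun _ => 0) y| ≤ C2 * δ ^ 2 := by
    intro y
    rw [h1_eq, JJ_zero]
    simp only [map_zero, zero_smul, sub_zero, smul_zero, mul_zero, ne_eq, OfNat.ofNat_ne_zero,
      not_false_eq_true, zero_pow, add_zero, zero_add]
    refine (abs_coef_le 1 _).trans ?_
    rw [norm_smul, Real.norm_of_nonneg (by positivity), mul_comm]
    exact mul_le_mul (q1 y) (hs y) (by positivity) hC2
  have b2 := T1_norm (h1_cont h le_rfl (BC_zero zero_le_one)) b1 y
  have hP0c := P0_cont h le_rfl (BC_zero zero_le_one)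
  have hcs := cont_ss (δ := δ)
  have f1 : Continuous fun s => ss δ s ^ 2 • N.P0 (ss δ s) (VV κ (fun _ => 0) s) (VD κ (fun _ => 0) s) := by
    fun_prop
  have f1b : ∀ s, ‖ss δ s ^ 2 • N.P0 (ss δ s) (VV κ (fun _ => 0) s) (VD κ (fun _ => 0) s)‖ ≤ δ ^ 2 * C1 := by
    intro s
    rw [norm_smul, Real.norm_of_nonneg (by positivity)]
    exact mul_le_mul (hs s) (p1 s) (norm_nonneg _) (by positivity)
  have e : (fun s => PQ N δ κ (fun _ => 0) s - (χ s ^ 2 * χd s) • e1 ^ 3)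
      = fun s => ss δ s ^ 2 • N.P0 (ss δ s) (VV κ (fun _ => 0) s) (VD κ (fun _ => 0) s) := by
    funext s
    have e1' : VV κ (fun _ => 0) s = χ s • e1 := by simp [VV, JJ_zero, V0]
    have e2' : VD κ (fun _ => 0) s = χd s • e1 := by simp [VD]
    unfold PQ PP
    rw [e1', e2', smul_pow, smul_mul_smul_comm]
    rw [show e1 ^ 2 * e1 = e1 ^ 3 from (pow_succ _ _).symm]
    abel
  have f2 : Continuous fun s => (χ s ^ 2 * χd s) • e1 ^ 3 := by
    have := cont_χ
    have := cont_χd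
    fun_prop
  have f3 := PQ_cont h le_rfl (BC_zero zero_le_one)
  have f2b : ∀ s, ‖(χ s ^ 2 * χd s) • e1 ^ 3‖ ≤ C1 + δ ^ 2 * C1 := by
    intro s
    have h1 := congrFun e s
    have h2 : (χ s ^ 2 * χd s) • e1 ^ 3 = PQ N δ κ (fun _ => 0) s
      - ss δ s ^ 2 • N.P0 (ss δ s) (VV κ (fun _ => 0) s) (VD κ (fun _ => 0) s) := by
      rw [← h1]; abel
    rw [h2]
    exact (norm_sub_le _ _).trans (add_le_add (p0 s) (f1b s))
  have hsub := T2_sub h.δ0 h.δ1 (B := C1 + δ ^ 2 * C1) f3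
    (fun s => (p0 s).trans (le_add_of_nonneg_right (by positivity))) f2 f2b y
  rw [e] at hsub
  have b3 : ‖T2 δ (PQ N δ κ (fun _ => 0)) y‖ ≤ (C1 + 4800) * δ ^ 2 := by
    rw [sub_eq_iff_eq_add] at hsub
    rw [hsub]
    have a := T2_norm h.δ0 h.δ1 f1b y
    have b := base_bd h.δ0 h.δ1 y
    refine (norm_add_le _ _).trans ((add_le_add a b).trans ?_)
    have := h.δ1
    have : 0 ≤ δ ^ 2 * C1 := by positivity
    nlinarith
  unfold Phi
  refine (norm_sub_le _ _).trans ?_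
  rw [norm_smul, norm_smul, norm_e1, Real.norm_eq_abs, Real.norm_of_nonneg (by positivity)]
  have c1 : κ⁻¹ * ‖T2 δ (PQ N δ κ (fun _ => 0)) y‖ ≤ κ⁻¹ * ((C1 + 4800) * δ ^ 2) :=
    mul_le_mul_of_nonneg_left b3 (by positivity)
  have c2 : 0 ≤ C2 * δ ^ 2 := by positivity
  nlinarith

lemma Phi_cont {N : NL} {δ κ r : ℝ} {q : ℝ → WA} (h : Adm N δ κ) (hr : r ≤ 1) (hq : BC r q) :
    Continuous (Phi N δ κ q) := by
  obtain ⟨C1, hC1, k1⟩ := PQ_est N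
  obtain ⟨C2, hC2, k2⟩ := h1_est N
  have a := T1_cont (h1_cont h hr hq) (k2 δ κ r q h hr hq).2.1
  have b := T2_cont h.δ0 h.δ1 (PQ_cont h hr hq) (k1 δ κ r q h hr hq).1
  unfold Phi
  fun_prop

lemma Phi_lip (N : NL) : ∃ C, 1 ≤ C ∧ ∀ δ κ r q q' d, Adm N δ κ → r ≤ 1 → BC r q → BC r q' →
    (∀ y, ‖q y - q' y‖ ≤ d) → ∀ y, ‖Phi N δ κ q y - Phi N δ κ q' y‖ ≤ C * (κ + r + δ + κ⁻¹ * δ) * d := by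
  obtain ⟨C1, hC1, k1⟩ := PQ_est N
  obtain ⟨C2, hC2, k2⟩ := h1_est N
  refine ⟨92 * C2 + C1 + 1, by linarith, fun δ κ r q q' d h hr hq hq' hd y => ?_⟩
  have hd0 : 0 ≤ d := (norm_nonneg _).trans (hd 0)
  have hr0 : 0 ≤ r := (norm_nonneg _).trans (hq.2 0)
  have hκ := h.κ0
  have hδ := h.δ0
  have e : Phi N δ κ q y - Phi N δ κ q' y
      = (T1 (h1 N δ κ q) y - T1 (h1 N δ κ q') y) • e1 - κ⁻¹ • (T2 δ (PQ N δ κ q) y - T2 δ (PQ N δ κ q') y) := by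
    unfold Phi
    rw [sub_smul, smul_sub]; abel
  have h1c := h1_cont h hr hq
  have h1c' := h1_cont h hr hq'
  have a := T1_sub h1c (k2 δ κ r q h hr hq).2.1 h1c' (k2 δ κ r q' h hr hq').2.1 y
  have a2 := T1_norm (h1c.sub h1c') ((k2 δ κ r q h hr hq).2.2 q' d hq' hd) y
  have b := T2_sub h.δ0 h.δ1 (PQ_cont h hr hq) (k1 δ κ r q h hr hq).1 (PQ_cont h hr hq') (k1 δ κ r q' h hr hq').1 y
  have b2 := T2_norm h.δ0 h.δ1 ((k1 δ κ r q h hr hq).2.2 q' d hq' hd) y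
  rw [e]
  refine (norm_sub_le _ _).trans ?_
  rw [norm_smul, norm_smul, norm_e1, Real.norm_eq_abs, Real.norm_of_nonneg (by positivity), a, b]
  have c1 := mul_le_mul_of_nonneg_left b2 (inv_nonneg.2 hκ.le)
  have a3 : |T1 (fun s => h1 N δ κ q s - h1 N δ κ q' s) y| ≤ 23 * (C2 * (κ + r + δ) * d) := a2
  have p1 : 0 ≤ (C1 + 1) * (κ + r + δ) * d := by positivity
  have p2 : 0 ≤ (92 * C2 + 1) * (κ⁻¹ * δ) * d := by positivity
  nlinarith

lemma lt_half_aux {x r : ℝ} (h : 0 < r) (h2 : x ≤ r / 50) : 25 * x < r := by linarith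

lemma exists_fix (N : NL) : ∃ κ δ₀ C : ℝ, 0 < δ₀ ∧ 0 ≤ C ∧ ∀ δ, 0 < δ → δ ≤ δ₀ → Adm N δ κ ∧
    ∃ q, BC 1 q ∧ (∀ y, Phi N δ κ q y = q y) ∧ ∀ y, ‖q y‖ ≤ C * δ ^ 2 := by
  obtain ⟨C0, hC0, h0⟩ := Phi_zero N
  obtain ⟨A, hA, hl⟩ := Phi_lip N
  have hA0 : 0 < A := by linarith
  set κ := 1 / (8 * A) with hκ
  have hκ0 : 0 < κ := by positivity
  have hκ1 : κ ≤ 1 := by rw [hκ, div_le_one (by positivity)]; linarith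
  have hAκ : A * κ = 1 / 8 := by rw [hκ]; field_simp
  have hρ := N.hρ
  refine ⟨κ, min (min 1 (N.ρ / 50)) (min (κ / (8 * A)) (κ * κ / (2 * (C0 + 1)))), 2 * (C0 * κ⁻¹), by positivity,
    by positivity, fun δ hδ0 hδ => ?_⟩
  have d1 : δ ≤ 1 := hδ.trans ((min_le_left _ _).trans (min_le_left _ _))
  have d2 : δ ≤ N.ρ / 50 := hδ.trans ((min_le_left _ _).trans (min_le_right _ _))
  have d3 : δ ≤ κ / (8 * A) := hδ.trans ((min_le_right _ _).trans (min_le_left _ _))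
  have d4 : δ ≤ κ * κ / (2 * (C0 + 1)) := hδ.trans ((min_le_right _ _).trans (min_le_right _ _))
  have adm : Adm N δ κ := ⟨hδ0, d1, lt_half_aux hρ d2, hκ0, hκ1⟩
  refine ⟨adm, ?_⟩
  have e3 : A * (κ⁻¹ * δ) ≤ 1 / 8 := by
    rw [le_div_iff₀ (by positivity)] at d3
    have : A * (κ⁻¹ * δ) = (δ * (8 * A)) / (8 * κ) := by field_simp
    rw [this, div_le_iff₀ (by positivity)]
    linarith
  have e4 : A * δ ≤ 1 / 8 := by
    have : 1 ≤ κ⁻¹ := (one_le_inv₀ hκ0).2 hκ1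
    have : A * δ ≤ A * (κ⁻¹ * δ) := by
      apply mul_le_mul_of_nonneg_left _ hA0.le
      nlinarith
    linarith
  have e5 : C0 * κ⁻¹ * δ ^ 2 ≤ κ / 2 := by
    rw [le_div_iff₀ (by positivity)] at d4
    have : C0 * κ⁻¹ * δ ^ 2 = (C0 * δ ^ 2) / κ := by field_simp
    rw [this, div_le_iff₀ hκ0]
    have h6 : C0 * δ ^ 2 ≤ (C0 + 1) * δ := by
      have h7 : δ ^ 2 ≤ δ := by nlinarith
      have h8 := mul_le_mul_of_nonneg_left h7 hC0
      linarith
    nlinarith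
  obtain ⟨q, q1, q2, q3, q4⟩ := fixpt (Phi N δ κ) (r := κ) (b := C0 * κ⁻¹ * δ ^ 2) hκ0 (by positivity)
    (fun q hq hb => Phi_cont adm hκ1 ⟨hq, hb⟩)
    (fun q q' hq hb hq' hb' d hd y => by
      refine (hl δ κ κ q q' d adm hκ1 ⟨hq, hb⟩ ⟨hq', hb'⟩ hd y).trans ?_
      have hd0 : 0 ≤ d := (norm_nonneg _).trans (hd 0)
      have : A * (κ + κ + δ + κ⁻¹ * δ) ≤ 1 / 2 := by linarith
      nlinarith)
    (h0 δ κ adm) e5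
  exact ⟨q, ⟨q1, fun y => (q2 y).trans hκ1⟩, q3, fun y => (q4 y).trans (le_of_eq (by ring))⟩

end KGP

namespace KGP

lemma zero_of_deriv {z : ℝ → ℝ} (h : ∀ y, 0 ≤ y → HasDerivAt z 0 y) (ht : Tendsto z atTop (𝓝 0)) {y : ℝ} (hy : 0 ≤ y) :
    z y = 0 := by
  have hc : ∀ b, 0 ≤ b → z b = z 0 := by
    intro b hb
    exact constant_of_has_deriv_right_zero (a := 0) (b := b)
      (fun x hx => (h x hx.1).continuousAt.continuousWithinAt)
      (fun x hx => (h x hx.1).hasDerivWithinAt) b ⟨hb, le_rfl⟩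
  have h2 : Tendsto z atTop (𝓝 (z 0)) :=
    tendsto_const_nhds.congr' (by filter_upwards [eventually_ge_atTop 0] with b hb using (hc b hb).symm)
  rw [hc y hy]
  exact tendsto_nhds_unique h2 ht

lemma osc {lm B : ℝ} (hl : 0 < lm) {fd F G vm : ℝ → ℝ} (hc : Continuous fd)
    (hb : ∀ s, 0 ≤ s → |fd s| ≤ B * Real.exp (-s))
    (hF : ∀ y, 0 ≤ y → HasDerivAt F (fd y) y) (hF0 : Tendsto F atTop (𝓝 0))
    (hv : ∀ y, 0 ≤ y → HasDerivAt vm (G y) y) (hv0 : Tendsto vm atTop (𝓝 0))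
    (hG : ∀ y, 0 ≤ y → G y = ∫ r in Set.Ioi (0 : ℝ), Real.sin (lm * r) / lm * fd (y + r)) {y : ℝ} (hy : 0 ≤ y) :
    HasDerivWithinAt G (F y - lm ^ 2 * vm y) (Set.Ici y) y := by
  set A : ℝ → ℝ := fun y => ∫ s in Set.Ioi y, Real.sin (lm * s) * fd s with hA
  set C : ℝ → ℝ := fun y => ∫ s in Set.Ioi y, Real.cos (lm * s) * fd s with hC
  have bA : ∀ s, 0 ≤ s → ‖Real.sin (lm * s) * fd s‖ ≤ B * Real.exp (-s) := by
    intro s hs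
    rw [norm_mul, Real.norm_eq_abs, Real.norm_eq_abs]
    have h1 := Real.abs_sin_le_one (lm * s)
    have h2 := hb s hs
    nlinarith [abs_nonneg (fd s), abs_nonneg (Real.sin (lm * s))]
  have bC : ∀ s, 0 ≤ s → ‖Real.cos (lm * s) * fd s‖ ≤ B * Real.exp (-s) := by
    intro s hs
    rw [norm_mul, Real.norm_eq_abs, Real.norm_eq_abs]
    have h1 := Real.abs_cos_le_one (lm * s)
    have h2 := hb s hs
    nlinarith [abs_nonneg (fd s), abs_nonneg (Real.cos (lm * s))]
  have cA : Continuous fun s => Real.sin (lm * s) * fd s := by fun_prop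
  have cC : Continuous fun s => Real.cos (lm * s) * fd s := by fun_prop
  have iA := integrable_of_exp cA bA
  have iC := integrable_of_exp cC bC
  have dA := hasDerivAt_Ioi cA iA
  have dC := hasDerivAt_Ioi cC iC
  have tA := tendsto_Ioi bA
  have tC := tendsto_Ioi bC
  have hI : ∀ (f : ℝ → ℝ), Continuous f → IntegrableOn f (Set.Ioi 0) → ∀ y, 0 ≤ y → IntegrableOn f (Set.Ioi y) :=
    fun f _ hf y hy => hf.mono_set (Set.Ioi_subset_Ioi hy)
  have hGA : ∀ y, 0 ≤ y → G y = (Real.cos (lm * y) * A y - Real.sin (lm * y) * C y) / lm := by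
    intro y hy
    rw [hG y hy]
    have e1 : ∀ r, Real.sin (lm * r) / lm * fd (y + r)
        = (fun s => (Real.cos (lm * y) / lm) * (Real.sin (lm * s) * fd s) - (Real.sin (lm * y) / lm) * (Real.cos (lm * s) * fd s)) (y + r) := by
      intro r
      have : lm * r = lm * (y + r) - lm * y := by ring
      simp only
      rw [this, Real.sin_sub]
      ring
    simp_rw [e1]
    rw [shift_Ioi (fun s => (Real.cos (lm * y) / lm) * (Real.sin (lm * s) * fd s) - (Real.sin (lm * y) / lm) * (Real.cos (lm * s) * fd s)) y,
      integral_sub ((hI _ cA iA y hy).const_mul _) ((hI _ cC iC y hy).const_mul _), integral_const_mul, integral_const_mul]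
    simp only [hA, hC]
    ring
  have ds : ∀ y, HasDerivAt (fun y => Real.sin (lm * y)) (Real.cos (lm * y) * lm) y := by
    intro y
    simpa using ((hasDerivAt_id y).const_mul lm).sin
  have dc : ∀ y, HasDerivAt (fun y => Real.cos (lm * y)) (-Real.sin (lm * y) * lm) y := by
    intro y
    simpa using ((hasDerivAt_id y).const_mul lm).cos
  have dG : ∀ y, HasDerivAt (fun y => (Real.cos (lm * y) * A y - Real.sin (lm * y) * C y) / lm)
      (-(Real.sin (lm * y) * A y + Real.cos (lm * y) * C y)) y := by
    intro y
    refine ((((dc y).mul (dA y)).sub ((ds y).mul (dC y))).div_const lm).congr_deriv ?_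
    simp only [hA, hC]
    field_simp
    ring
  have dG2 : ∀ y, HasDerivAt (fun y => -(Real.sin (lm * y) * A y + Real.cos (lm * y) * C y))
      (- lm * (Real.cos (lm * y) * A y - Real.sin (lm * y) * C y) + fd y) y := by
    intro y
    refine ((((ds y).mul (dA y)).add ((dc y).mul (dC y))).neg).congr_deriv ?_
    simp only [hA, hC]
    linear_combination (fd y) * (Real.sin_sq_add_cos_sq (lm * y))
  have key := zero_of_deriv (z := fun y => -(Real.sin (lm * y) * A y + Real.cos (lm * y) * C y) + lm ^ 2 * vm y - F y) (y := y) ?_ ?_ hy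
  · have h1 : F y - lm ^ 2 * vm y = -(Real.sin (lm * y) * A y + Real.cos (lm * y) * C y) := by linarith
    rw [h1]
    exact (dG y).hasDerivWithinAt.congr (fun x hx => hGA x (hy.trans hx)) (hGA y hy)
  · intro y hy
    refine (((dG2 y).add ((hv y hy).const_mul (lm ^ 2))).sub (hF y hy)).congr_deriv ?_
    rw [hGA y hy]
    field_simp
    ring
  · have s1 : Tendsto (fun y => Real.sin (lm * y) * A y) atTop (𝓝 0) := by
      refine squeeze_zero_norm (fun y => ?_) (tA.norm.trans (by simp))
      rw [norm_mul]
      exact mul_le_of_le_one_left (norm_nonneg _) (Real.abs_sin_le_one _)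
    have s2 : Tendsto (fun y => Real.cos (lm * y) * C y) atTop (𝓝 0) := by
      refine squeeze_zero_norm (fun y => ?_) (tC.norm.trans (by simp))
      rw [norm_mul]
      exact mul_le_of_le_one_left (norm_nonneg _) (Real.abs_cos_le_one _)
    simpa using ((s1.add s2).neg.add (hv0.const_mul (lm ^ 2))).sub hF0

/-- variation of constants for the linearised Duffing equation -/
def HH (R : ℝ → ℝ) (y : ℝ) : ℝ := 1 / 2 * (phione y * (∫ s in (0:ℝ)..y, phitwo s * R s) + phitwo y * ∫ s in Set.Ioi y, phione s * R s)
def HHd (R : ℝ → ℝ) (y : ℝ) : ℝ := 1 / 2 * (dphi1 y * (∫ s in (0:ℝ)..y, phitwo s * R s) + dphi2 y * ∫ s in Set.Ioi y, phione s * R s)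

lemma phioneR_bd {R : ℝ → ℝ} {B : ℝ} (hb : ∀ s, 0 ≤ s → |R s| ≤ B * Real.exp (-3 * s)) (s : ℝ) (hs : 0 ≤ s) :
    ‖phione s * R s‖ ≤ 2 * B * Real.exp (-4 * s) := by
  rw [norm_mul, Real.norm_eq_abs, Real.norm_eq_abs]
  have h1 := (phione_le s).trans (inv_ch_le s)
  calc |phione s| * |R s| ≤ (2 * Real.exp (-s)) * (B * Real.exp (-3 * s)) :=
        mul_le_mul h1 (hb s hs) (abs_nonneg _) (by positivity)
    _ = 2 * B * (Real.exp (-s) * Real.exp (-3 * s)) := by ring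
    _ = _ := by rw [← Real.exp_add]; ring_nf

lemma hd_HH {R : ℝ → ℝ} {B : ℝ} (hc : Continuous R) (hb : ∀ s, 0 ≤ s → |R s| ≤ B * Real.exp (-3 * s)) (y : ℝ) :
    HasDerivAt (HH R) (HHd R y) y ∧ HasDerivAt (HHd R) ((1 - 6 / Real.cosh y ^ 2) * HH R y - R y) y := by
  have hB : 0 ≤ B := by have := (abs_nonneg _).trans (hb 0 le_rfl); simpa using this
  have c2 : Continuous fun s => phitwo s * R s := cont_phitwo.mul hc
  have c1 : Continuous fun s => phione s * R s := cont_phione.mul hc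
  have d2 := (c2.integral_hasStrictDerivAt 0 y).hasDerivAt
  have b1 : ∀ s, 0 ≤ s → ‖phione s * R s‖ ≤ 2 * B * Real.exp (-s) := by
    intro s hs
    refine (phioneR_bd hb s hs).trans ?_
    gcongr
    linarith
  have d1 := hasDerivAt_Ioi c1 (integrable_of_exp c1 b1) y
  have w := wronsk y
  constructor
  · refine ((((hd_phione y).mul d2).add ((hd_phitwo y).mul d1)).const_mul (1 / 2 : ℝ)).congr_deriv ?_
    unfold HHd
    ring
  · refine ((((hd_dphi1 y).mul d2).add ((hd_dphi2 y).mul d1)).const_mul (1 / 2 : ℝ)).congr_deriv ?_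
    unfold HH
    linear_combination (1 / 2 * R y) * w

lemma HH_tendsto {R : ℝ → ℝ} {B : ℝ} (hc : Continuous R) (hb : ∀ s, 0 ≤ s → |R s| ≤ B * Real.exp (-3 * s)) :
    Tendsto (HH R) atTop (𝓝 0) := by
  have hB : 0 ≤ B := by have := (abs_nonneg _).trans (hb 0 le_rfl); simpa using this
  have t0 : Tendsto (fun y : ℝ => 40 * B * Real.exp (-y)) atTop (𝓝 0) := by
    simpa using (Real.tendsto_exp_neg_atTop_nhds_zero).const_mul (40 * B)
  refine squeeze_zero_norm' ?_ t0
  filter_upwards [eventually_ge_atTop 0] with y hy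
  have i1 : |∫ s in (0:ℝ)..y, phitwo s * R s| ≤ 10 * B := by
    have h1 : ∀ s ∈ Set.Ioc 0 y, ‖phitwo s * R s‖ ≤ 10 * B * Real.exp (-s) := by
      intro s hs
      rw [norm_mul, Real.norm_eq_abs, Real.norm_eq_abs]
      calc |phitwo s| * |R s| ≤ (10 * Real.exp s) * (B * Real.exp (-3 * s)) :=
            mul_le_mul (phitwo_le hs.1.le) (hb s hs.1.le) (abs_nonneg _) (by positivity)
        _ = 10 * B * (Real.exp s * Real.exp (-3 * s)) := by ring
        _ = 10 * B * Real.exp (-2 * s) := by rw [← Real.exp_add]; ring_nf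
        _ ≤ _ := by gcongr; have := hs.1; linarith
    have h2 := intervalIntegral.norm_integral_le_of_norm_le hy (g := fun s => 10 * B * Real.exp (-s)) (f := fun s => phitwo s * R s)
      (μ := volume) (Eventually.of_forall h1) (Continuous.intervalIntegrable (by fun_prop) _ _)
    have h3 : ∫ s in (0:ℝ)..y, 10 * B * Real.exp (-s) = 10 * B * (1 - Real.exp (-y)) := by
      rw [intervalIntegral.integral_const_mul]
      congr 1
      have := intervalIntegral.integral_eq_sub_of_hasDerivAt (f := fun s => - Real.exp (-s)) (f' := fun s => Real.exp (-s)) (a := 0) (b := y)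
        (fun s _ => by simpa using! ((hasDerivAt_id s).neg.exp).neg) (Continuous.intervalIntegrable (by fun_prop) _ _)
      rw [this]; simp; ring
    rw [h3, Real.norm_eq_abs] at h2
    have := Real.exp_pos (-y)
    nlinarith
  have i2 : |∫ s in Set.Ioi y, phione s * R s| ≤ 2 * B * Real.exp (-2 * y) := by
    have h1 := norm_integral_le_of_norm_le (μ := volume.restrict (Set.Ioi y)) (f := fun s => phione s * R s)
      (g := fun s => 2 * B * Real.exp (-2 * y) * Real.exp (y - s)) ?_ ?_
    · have h3 : ∫ s in Set.Ioi y, 2 * B * Real.exp (-2 * y) * Real.exp (y - s) = 2 * B * Real.exp (-2 * y) := by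
        rw [integral_const_mul, ← shift_Ioi (fun s => Real.exp (y - s)) y]
        have e : ∀ r : ℝ, y - (y + r) = -r := fun r => by ring
        simp_rw [e]
        rw [integral_exp_neg_Ioi_zero, mul_one]
      rw [h3] at h1
      exact h1
    · have : (fun s => 2 * B * Real.exp (-2 * y) * Real.exp (y - s)) = fun s => (2 * B * Real.exp (-2 * y) * Real.exp y) * Real.exp (-s) := by
        funext s; rw [sub_eq_add_neg, Real.exp_add]; ring
      rw [this]
      exact (integrableOn_exp_neg_Ioi y).const_mul _
    · filter_upwards [ae_restrict_mem measurableSet_Ioi] with s hs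
      have hs' : y < s := hs
      refine (phioneR_bd hb s (hy.trans hs'.le)).trans ?_
      rw [mul_assoc (2 * B), ← Real.exp_add]
      gcongr
      linarith
  have e1 := (phione_le y).trans (inv_ch_le y)
  have e2 := phitwo_le hy
  unfold HH
  rw [Real.norm_eq_abs, abs_mul]
  have e3 := abs_add_le (phione y * (∫ s in (0:ℝ)..y, phitwo s * R s)) (phitwo y * ∫ s in Set.Ioi y, phione s * R s)
  rw [abs_mul, abs_mul] at e3
  have e4 := mul_le_mul e1 i1 (abs_nonneg _) (by positivity)
  have e5 := mul_le_mul e2 i2 (abs_nonneg _) (by positivity)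
  have e6 : 10 * Real.exp y * (2 * B * Real.exp (-2 * y)) = 20 * B * Real.exp (-y) := by
    have : Real.exp (-y) = Real.exp y * Real.exp (-2 * y) := by rw [← Real.exp_add]; ring_nf
    rw [this]; ring
  rw [e6] at e5
  rw [abs_of_pos (by norm_num : (0:ℝ) < 1 / 2)]
  have e7 : 0 ≤ B * Real.exp (-y) := by positivity
  linarith

lemma T1_eq {h : ℝ → ℝ} {y : ℝ} (hy : 0 ≤ y) :
    Real.exp (-y) * T1 h y = HHd (fun s => Real.exp (-3 * s) * h s) y := by
  unfold T1 HHd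
  rw [cl_eq hy]
  have hth : θ y = Real.exp (-y) := by unfold θ; rw [cl_eq hy]
  have e1 : ∫ s in (0:ℝ)..y, b2 s * Real.exp (-2 * s) * h s = ∫ s in (0:ℝ)..y, phitwo s * (Real.exp (-3 * s) * h s) := by
    refine intervalIntegral.integral_congr fun s hs => ?_
    rw [Set.uIcc_of_le hy] at hs
    unfold b2 θ
    simp only [cl_eq hs.1]
    have : Real.exp (-3 * s) = Real.exp (-s) * Real.exp (-2 * s) := by rw [← Real.exp_add]; ring_nf
    rw [this]; ring
  have e2 : Real.exp (-4 * y) * TI K1 (fun s => b1 s * h s) y = ∫ s in Set.Ioi y, phione s * (Real.exp (-3 * s) * h s) := by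
    rw [← shift_Ioi (fun s => phione s * (Real.exp (-3 * s) * h s)) y]
    unfold TI
    rw [← integral_const_mul]
    refine setIntegral_congr_fun measurableSet_Ioi fun r hr => ?_
    have hr' : 0 ≤ y + r := add_nonneg hy (le_of_lt hr)
    simp only [K1, b1, cl_eq hr', smul_eq_mul, _root_.smul_apply, ContinuousLinearMap.id_apply]
    have h2 : Real.exp (-3 * (y + r)) = Real.exp (-4 * y) * (Real.exp (-r) * (Real.exp (-3 * r) * Real.exp (y + r))) := by
      simp only [← Real.exp_add]; ring_nf
    rw [h2]; ring
  rw [e1, ← e2]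
  unfold a1 a2
  rw [hth, cl_eq hy]
  have h3 : Real.exp (-4 * y) = Real.exp (-y) ^ 4 := by rw [← Real.exp_nat_mul]; ring_nf
  have h4 : Real.exp (-y) * Real.exp y = 1 := by rw [← Real.exp_add]; simp
  rw [h3]
  linear_combination (1 / 2 * dphi1 y * ∫ s in (0:ℝ)..y, phitwo s * (Real.exp (-3 * s) * h s)) * h4
end KGP

namespace KGP

def vv (κ : ℝ) (q : ℝ → WA) (y : ℝ) : WA := vh y • e1 - DD κ (Real.exp (-y) • JJ q y)
def pp (κ : ℝ) (q : ℝ → WA) (y : ℝ) : WA := vhd y • e1 + DD κ (Real.exp (-y) • q y)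
def NN (N : NL) (e : ℝ) (a : WA) : WA := (1 / 3 : ℝ) • a ^ 3 + e ^ 2 • N.Q0 e a

section
variable {N : NL} {δ κ : ℝ} {q : ℝ → WA}

lemma JJ_exp (q : ℝ → WA) (y : ℝ) : Real.exp (-y) • JJ q y = ∫ s in Set.Ioi y, Real.exp (-s) • q s := by
  rw [← shift_Ioi (fun s => Real.exp (-s) • q s) y]
  unfold JJ TI
  rw [← integral_smul]
  refine integral_congr_ae (Eventually.of_forall fun r => ?_)
  simp only [ContinuousLinearMap.id_apply, smul_smul, ← Real.exp_add]
  ring_nf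

lemma expq_bd (hq : BC 1 q) (s : ℝ) : ‖Real.exp (-s) • q s‖ ≤ 1 * Real.exp (-s) := by
  rw [norm_smul, Real.norm_of_nonneg (Real.exp_pos _).le, mul_comm]
  exact mul_le_mul_of_nonneg_right (hq.2 s) (Real.exp_pos _).le

lemma hd_JJ (hq : BC 1 q) (y : ℝ) : HasDerivAt (fun y => Real.exp (-y) • JJ q y) (-(Real.exp (-y) • q y)) y := by
  have hc : Continuous fun s => Real.exp (-s) • q s := by have := hq.1; fun_prop
  have := hasDerivAt_Ioi hc (integrable_of_exp hc (fun s _ => expq_bd hq s)) y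
  simpa only [JJ_exp] using this

lemma JJ_tendsto (hq : BC 1 q) : Tendsto (fun y => Real.exp (-y) • JJ q y) atTop (𝓝 0) := by
  simp only [JJ_exp]
  exact tendsto_Ioi (fun s _ => expq_bd hq s)

lemma hd_vv (hq : BC 1 q) (y : ℝ) : HasDerivAt (vv κ q) (pp κ q y) y := by
  have h := ((hd_vh y).smul_const e1).sub ((DD κ).hasFDerivAt.comp_hasDerivAt y (hd_JJ hq y))
  refine h.congr_deriv ?_
  unfold pp
  rw [map_neg, sub_neg_eq_add]

lemma pp_cont (hq : BC 1 q) : Continuous (pp κ q) := by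
  have h1 := hq.1
  have h2 := cont_vhd
  unfold pp
  exact (h2.smul continuous_const).add ((DD κ).continuous.comp (by fun_prop))

lemma vv_cont (hq : BC 1 q) : Continuous (vv κ q) :=
  continuous_iff_continuousAt.2 fun y => (hd_vv hq y).continuousAt

lemma vv_eq {y : ℝ} (hy : 0 ≤ y) : vv κ q y = θ y • VV κ q y := by
  unfold vv VV V0 χ θ
  rw [cl_eq hy, map_smul, smul_sub, smul_smul, ← mul_assoc, ← Real.exp_add]
  simp

lemma pp_eq {y : ℝ} (hy : 0 ≤ y) : pp κ q y = θ y • VD κ q y := by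
  unfold pp VD χd θ
  rw [cl_eq hy, map_smul, smul_add, smul_smul, ← mul_assoc, ← Real.exp_add]
  simp

lemma ev_lt (h : Adm N δ κ) (hq : BC 1 q) {y : ℝ} (hy : 0 ≤ y) : ‖ee δ • vv κ q y‖ < N.ρ := by
  rw [vv_eq hy, smul_smul]
  exact sV_lt h le_rfl hq y

lemma NN_cont_at {e : ℝ} {a : WA} (ha : ‖e • a‖ < N.ρ) : ContinuousAt (NN N e) a := by
  unfold NN NL.Q0
  have h1 : ContinuousAt (fun a => N.g (e • a)) a :=
    ContinuousAt.comp (g := N.g) (N.hd _ ha).continuousAt (by fun_prop)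
  have h2 : ContinuousAt (fun a : WA => a ^ 5) a := by fun_prop
  have h3 : ContinuousAt (fun a : WA => (1 / 3 : ℝ) • a ^ 3) a := by fun_prop
  exact h3.add (ContinuousAt.const_smul (g := fun a => a ^ 5 * N.g (e • a)) (h2.mul h1) (e ^ 2))

lemma hd_NNa {e : ℝ} {w : ℝ → WA} {w' : WA} {y : ℝ} (hw : HasDerivAt w w' y) (ha : ‖e • w y‖ < N.ρ) :
    HasDerivAt (fun y => NN N e (w y)) (PP N e (w y) w') y := by
  have h1 : HasDerivAt (fun y => N.g (e • w y)) (N.g' (e • w y) (e • w')) y :=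
    HasFDerivAt.comp_hasDerivAt (l := N.g) y (N.hd _ ha) (hw.const_smul e)
  have h5 := hw.pow 5
  have h3 := hw.pow 3
  refine ((h3.const_smul (1 / 3 : ℝ)).add ((h5.mul h1).const_smul (e ^ 2))).congr_deriv ?_
  unfold PP NL.P0
  rw [map_smul]
  simp only [Nat.cast_ofNat, Nat.add_one_sub_one, Nat.reduceSub]
  have c3 : (3 : WA) = (3 : ℝ) • (1 : WA) := by rw [← Algebra.algebraMap_eq_smul_one]; exact (map_ofNat (algebraMap ℝ WA) _).symm
  have c5 : (5 : WA) = (5 : ℝ) • (1 : WA) := by rw [← Algebra.algebraMap_eq_smul_one]; exact (map_ofNat (algebraMap ℝ WA) _).symm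
  simp only [c3, c5, smul_mul_assoc, mul_smul_comm, one_mul, smul_add, smul_smul]
  norm_num
  ring_nf

lemma PP_scale {e t : ℝ} {V V' : WA} : PP N e (t • V) (t • V') = t ^ 3 • PP N (e * t) V V' := by
  unfold PP NL.P0
  rw [smul_smul e t V, map_smul]
  simp only [smul_pow, smul_mul_assoc, mul_smul_comm, smul_add, smul_smul]
  ring_nf

lemma hd_NN (h : Adm N δ κ) (hq : BC 1 q) {y : ℝ} (hy : 0 ≤ y) :
    HasDerivAt (fun y => NN N (ee δ) (vv κ q y)) (Real.exp (-3 * y) • PQ N δ κ q y) y := by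
  refine (hd_NNa (hd_vv hq y) (ev_lt h hq hy)).congr_deriv ?_
  rw [vv_eq hy, pp_eq hy, PP_scale]
  unfold PQ ss
  congr 1
  unfold θ
  rw [cl_eq hy, ← Real.exp_nat_mul]
  ring_nf

lemma vv_tendsto (h : Adm N δ κ) (hq : BC 1 q) : Tendsto (vv κ q) atTop (𝓝 0) := by
  have t0 : Tendsto (fun y : ℝ => Real.exp (-y) * 25) atTop (𝓝 0) := by
    simpa using (Real.tendsto_exp_neg_atTop_nhds_zero).mul_const 25
  refine squeeze_zero_norm' ?_ t0
  filter_upwards [eventually_ge_atTop 0] with y hy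
  rw [vv_eq hy, norm_smul, Real.norm_of_nonneg (θ_pos y).le]
  have : θ y = Real.exp (-y) := by unfold θ; rw [cl_eq hy]
  rw [this]
  exact mul_le_mul_of_nonneg_left (VV_norm h le_rfl hq y) (Real.exp_pos _).le

lemma NN_tendsto (h : Adm N δ κ) (hq : BC 1 q) : Tendsto (fun y => NN N (ee δ) (vv κ q y)) atTop (𝓝 0) := by
  have h1 : ContinuousAt (NN N (ee δ)) 0 := NN_cont_at (by simpa using N.hρ)
  have h2 : NN N (ee δ) 0 = 0 := by simp [NN, NL.Q0]
  have := h1.tendsto.comp (vv_tendsto h hq)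
  rw [h2] at this
  exact this

lemma coef_e1 (m : ℕ) : coefL m e1 = if m = 1 then 1 else 0 := by
  unfold e1; rw [coef_cosE]
  

/-- coefficients of the fixed point -/
lemma coef_q (hfix : ∀ y, Phi N δ κ q y = q y) (y : ℝ) (m : ℕ) (hm : m ≠ 1) :
    coefL m (q y) = - (κ⁻¹ * coefL m (T2 δ (PQ N δ κ q) y)) := by
  conv_lhs => rw [← hfix y]
  unfold Phi
  rw [map_sub, map_smul, map_smul, coef_e1, if_neg hm]
  simp

lemma coef_SS (δ r : ℝ) (x : WA) (m : ℕ) : coefL m (SS δ r x) = coefL m x * Sb δ r m := coef_diag _ _ _ _ _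

lemma coef_T2 (h : Adm N δ κ) {hh : ℝ → WA} {B : ℝ} (hc : Continuous hh) (hb : ∀ y, ‖hh y‖ ≤ B) (y : ℝ) (m : ℕ) :
    coefL m (T2 δ hh y) = θ y ^ 2 * ∫ r in Set.Ioi (0:ℝ), Real.exp (-3 * r) * (Sb δ r m * coefL m (hh (cl y + r))) := by
  unfold T2
  rw [map_smul, smul_eq_mul]
  congr 1
  unfold TI
  rw [← ContinuousLinearMap.integral_comp_comm _ (TI_int (K2_cont δ) (K2_le h.δ0 h.δ1) hc hb (cl y))]
  refine integral_congr_ae (Eventually.of_forall fun r => ?_)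
  simp only [K2, _root_.smul_apply, map_smul, coef_SS, smul_eq_mul]
  have : Real.exp (-3 * r) = Real.exp (-r) * Real.exp (-2 * r) := by rw [← Real.exp_add]; ring_nf
  rw [this]; ring

lemma coef_T2_zero (h : Adm N δ κ) {hh : ℝ → WA} {B : ℝ} (hc : Continuous hh) (hb : ∀ y, ‖hh y‖ ≤ B) (y : ℝ) (m : ℕ)
    (hm : ¬ (Odd m ∧ 3 ≤ m)) : coefL m (T2 δ hh y) = 0 := by
  rw [coef_T2 h hc hb]
  simp [Sb, hm]

lemma coef_q_zero (h : Adm N δ κ) (hq : BC 1 q) (hfix : ∀ y, Phi N δ κ q y = q y) (y : ℝ) (m : ℕ) (hm : ¬ Odd m) :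
    coefL m (q y) = 0 := by
  obtain ⟨B, _, hB⟩ := PQ_est N
  have hb := (hB δ κ 1 q h le_rfl hq).1
  have h1 : m ≠ 1 := by rintro rfl; exact hm odd_one
  rw [coef_q hfix y m h1, coef_T2_zero h (PQ_cont h le_rfl hq) hb y m (fun h => hm h.1)]
  simp

lemma coef_pp (y : ℝ) (m : ℕ) (hm : m ≠ 1) : coefL m (pp κ q y) = Real.exp (-y) * (κ * coefL m (q y)) := by
  unfold pp
  rw [map_add, map_smul, coef_e1, if_neg hm, DD_coef, map_smul, Db, if_neg hm]
  simp only [smul_eq_mul]; ring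

lemma coef_pp1 (y : ℝ) : coefL 1 (pp κ q y) = vhd y + Real.exp (-y) * coefL 1 (q y) := by
  unfold pp
  rw [map_add, map_smul, coef_e1, DD_coef, map_smul, Db]
  simp

lemma coef_vv1 (y : ℝ) : coefL 1 (vv κ q y) = vh y - coefL 1 (Real.exp (-y) • JJ q y) := by
  unfold vv
  rw [map_sub, map_smul, coef_e1, DD_coef, Db]
  simp

lemma coef_JJ_zero (hq : BC 1 q) (m : ℕ) (hm : ∀ y, coefL m (q y) = 0) (y : ℝ) : coefL m (Real.exp (-y) • JJ q y) = 0 := by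
  have hc : Continuous fun s => Real.exp (-s) • q s := by have := hq.1; fun_prop
  unfold JJ TI
  rw [map_smul, ← ContinuousLinearMap.integral_comp_comm _ (TI_int continuous_const idK_le hq.1 hq.2 y)]
  simp [hm]

lemma hd_coef {w : ℝ → WA} {w' : WA} {y : ℝ} (m : ℕ) (hw : HasDerivAt w w' y) :
    HasDerivAt (fun y => coefL m (w y)) (coefL m w') y :=
  (coefL m).hasFDerivAt.comp_hasDerivAt y hw

lemma td_coef {w : ℝ → WA} (m : ℕ) (hw : Tendsto w atTop (𝓝 0)) :
    Tendsto (fun y => coefL m (w y)) atTop (𝓝 0) := by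
  have := ((coefL m).continuous.tendsto 0).comp hw
  rw [map_zero] at this
  exact this

/-- equation for the oscillating modes -/
lemma mode_osc (h : Adm N δ κ) (hq : BC 1 q) (hfix : ∀ y, Phi N δ κ q y = q y) (m : ℕ) (hm : Odd m) (hm3 : 3 ≤ m)
    {y : ℝ} (hy : 0 ≤ y) : HasDerivWithinAt (fun y => coefL m (pp κ q y))
      ((1 + δ ^ 2 - (m : ℝ) ^ 2) / δ ^ 2 * coefL m (vv κ q y) - coefL m (NN N (ee δ) (vv κ q y))) (Set.Ici y) y := by
  obtain ⟨B, _, hB⟩ := PQ_est N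
  have hb := (hB δ κ 1 q h le_rfl hq).1
  have hPc := PQ_cont h le_rfl hq
  have hl : 0 < lam δ m := lt_of_lt_of_le (by have := h.δ0; positivity) (lam_ge h.δ0 h.δ1 hm3)
  have := osc (lm := lam δ m) (B := B) hl (fd := fun s => -(Real.exp (-3 * s) * coefL m (PQ N δ κ q s)))
    (F := fun y => -coefL m (NN N (ee δ) (vv κ q y)))
    (G := fun y => coefL m (pp κ q y)) (vm := fun y => coefL m (vv κ q y)) ?_ ?_ ?_ ?_ ?_ ?_ ?_ hy
  · refine this.congr_deriv ?_
    rw [lam_sq h.δ0 h.δ1 hm3]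
    ring
  · have := (coefL m).continuous.comp hPc
    exact ((by fun_prop : Continuous fun s : ℝ => Real.exp (-3 * s)).mul this).neg
  · intro s hs
    rw [abs_neg, abs_mul, abs_of_pos (Real.exp_pos _), mul_comm B]
    have h1 := (abs_coef_le m (PQ N δ κ q s)).trans (hb s)
    exact mul_le_mul (Real.exp_le_exp.2 (by linarith)) h1 (abs_nonneg _) (Real.exp_pos _).le
  · intro y hy
    refine (hd_coef m (hd_NN h hq hy)).neg.congr_deriv ?_
    rw [map_smul, smul_eq_mul]
  · simpa using (td_coef m (NN_tendsto h hq)).neg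
  · intro y hy
    exact hd_coef m (hd_vv hq y)
  · exact td_coef m (vv_tendsto h hq)
  · intro y hy
    have h1 : m ≠ 1 := by omega
    rw [coef_pp y m h1, coef_q hfix y m h1, coef_T2 h hPc hb]
    unfold θ
    rw [cl_eq hy]
    have e : ∀ I : ℝ, Real.exp (-y) * (κ * -(κ⁻¹ * (Real.exp (-y) ^ 2 * I))) = (- Real.exp (-3 * y)) * I := by
      intro I
      have : Real.exp (-3 * y) = Real.exp (-y) ^ 3 := by rw [← Real.exp_nat_mul]; ring_nf
      have hk := h.κ0.ne'
      rw [this]; field_simp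
    rw [e, ← integral_const_mul]
    refine integral_congr_ae (Eventually.of_forall fun r => ?_)
    simp only [Sb, hm, hm3, and_self, if_true]
    rw [mul_add, Real.exp_add]
    ring

lemma e1_cube_coef : coefL 1 (e1 ^ 3) = 3 / 4 := by
  unfold e1
  rw [e1_cube, map_add, map_smul, map_smul, coef_cosE, coef_cosE]
  simp

/-- equation for the first mode -/
lemma mode_one (h : Adm N δ κ) (hq : BC 1 q) (hfix : ∀ y, Phi N δ κ q y = q y) :
    (∀ y, 0 ≤ y → HasDerivWithinAt (fun y => coefL 1 (pp κ q y))
      (coefL 1 (vv κ q y) - coefL 1 (NN N (ee δ) (vv κ q y))) (Set.Ici y) y) ∧ coefL 1 (pp κ q 0) = 0 := by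
  obtain ⟨B1, _, hB1⟩ := PQ_est N
  have hb1 := (hB1 δ κ 1 q h le_rfl hq).1
  have hPc := PQ_cont h le_rfl hq
  obtain ⟨B, _, hB⟩ := h1_est N
  have hb := (hB δ κ 1 q h le_rfl hq).2.1
  have hc := h1_cont h le_rfl hq
  set R : ℝ → ℝ := fun s => Real.exp (-3 * s) * h1 N δ κ q s with hR
  have Rc : Continuous R := by rw [hR]; fun_prop
  have Rb : ∀ s, 0 ≤ s → |R s| ≤ B * Real.exp (-3 * s) := by
    intro s _
    rw [hR]; simp only
    rw [abs_mul, abs_of_pos (Real.exp_pos _), mul_comm B]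
    exact mul_le_mul_of_nonneg_left (hb s) (Real.exp_pos _).le
  have q1 : ∀ y, 0 ≤ y → Real.exp (-y) * coefL 1 (q y) = HHd R y := by
    intro y hy
    conv_lhs => rw [← hfix y]
    unfold Phi
    rw [map_sub, map_smul, map_smul, coef_e1, coef_T2_zero h hPc hb1 y 1 (by simp)]
    simp only [if_true, smul_eq_mul, mul_zero, sub_zero, mul_one]
    exact T1_eq hy
  have eta : ∀ y, 0 ≤ y → coefL 1 (Real.exp (-y) • JJ q y) = - HH R y := by
    intro y hy
    have := zero_of_deriv (z := fun y => coefL 1 (Real.exp (-y) • JJ q y) + HH R y) (y := y) ?_ ?_ hy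
    · linarith
    · intro y hy
      refine ((hd_coef 1 (hd_JJ hq y)).add (hd_HH Rc Rb y).1).congr_deriv ?_
      rw [map_neg, map_smul, smul_eq_mul, q1 y hy]; ring
    · simpa using (td_coef 1 (JJ_tendsto hq)).add (HH_tendsto Rc Rb)
  constructor
  · intro y hy
    have hp : HasDerivWithinAt (fun y => coefL 1 (pp κ q y))
        ((vh y - vh y ^ 3 / 4) + ((1 - 6 / Real.cosh y ^ 2) * HH R y - R y)) (Set.Ici y) y := by
      refine ((hd_vhd y).add (hd_HH Rc Rb y).2).hasDerivWithinAt.congr (fun x hx => ?_) ?_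
      · rw [coef_pp1, q1 x (hy.trans hx)]; rfl
      · rw [coef_pp1, q1 y hy]; rfl
    refine hp.congr_deriv ?_
    rw [coef_vv1, eta y hy]
    have hV : vh y = Real.exp (-y) * χ y := by
      unfold χ; rw [cl_eq hy, ← mul_assoc, ← Real.exp_add]; simp
    have hth : θ y = Real.exp (-y) := by unfold θ; rw [cl_eq hy]
    have hJ : Real.exp (-y) * coefL 1 (JJ q y) = - HH R y := by rw [← eta y hy, map_smul, smul_eq_mul]
    have e3 : Real.exp (-3 * y) = Real.exp (-y) ^ 3 := by rw [← Real.exp_nat_mul]; ring_nf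
    have hN : coefL 1 (NN N (ee δ) (vv κ q y)) = Real.exp (-y) ^ 3 * coefL 1 ((1 / 3 : ℝ) • VV κ q y ^ 3 + ss δ y ^ 2 • N.Q0 (ss δ y) (VV κ q y)) := by
      rw [← smul_eq_mul, ← map_smul]
      congr 1
      rw [vv_eq hy]
      unfold NN NL.Q0 ss
      rw [hth, smul_smul]
      simp only [smul_pow, smul_mul_assoc, smul_add, smul_smul]
      ring_nf
    have hRy : R y = Real.exp (-y) ^ 3 * h1 N δ κ q y := by rw [hR]; simp only [e3]
    have h1e : h1 N δ κ q y = coefL 1 ((1 / 3 : ℝ) • VV κ q y ^ 3 + ss δ y ^ 2 • N.Q0 (ss δ y) (VV κ q y))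
        - 1 / 3 * (χ y ^ 3 * (3 / 4)) + χ y ^ 2 * coefL 1 (JJ q y) * (3 / 4) := by
      unfold h1
      rw [map_add, map_sub]
      congr 1
      · congr 1
        unfold V0
        rw [smul_pow, map_smul, map_smul, e1_cube_coef]; rfl
      · unfold V0
        rw [smul_pow, mul_smul_comm, smul_mul_assoc, map_smul, map_smul, ← pow_succ, e1_cube_coef]
        simp only [smul_eq_mul]; ring
    have hv2 : vh y ^ 2 = 8 / Real.cosh y ^ 2 := by
      unfold vh
      rw [div_pow, mul_pow, Real.sq_sqrt (by norm_num)]; norm_num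
    rw [hN, hRy, h1e]
    have h6 : 6 / Real.cosh y ^ 2 = 3 / 4 * vh y ^ 2 := by rw [hv2]; ring
    rw [h6]
    rw [hV]
    linear_combination (-(3/4) * (Real.exp (-y)* χ y)^2) * hJ
  · rw [coef_pp1, q1 0 le_rfl, vhd_zero]
    unfold HHd
    simp [dphi2_zero]

end
end KGP

namespace KGP

lemma ev2_bound (τ : ℝ) (m : ℕ) : |(-(m : ℝ) ^ 2 * Real.cos (m * τ)) / W m| ≤ 1 := by
  rw [abs_div, abs_of_pos (W_pos m), div_le_one (W_pos m), abs_mul, abs_neg, abs_of_nonneg (by positivity)]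
  have h1 := Real.abs_cos_le_one (m * τ)
  have h2 : (m : ℝ) ^ 2 ≤ W m := by unfold W; nlinarith [Nat.cast_nonneg (α := ℝ) m]
  nlinarith [sq_nonneg (m : ℝ), abs_nonneg (Real.cos (m * τ))]

/-- second derivative in `τ` of the evaluation -/
def ev2 (τ : ℝ) : WA →L[ℝ] ℝ := func (fun m => (-(m : ℝ) ^ 2 * Real.cos (m * τ)) / W m) 1 (ev2_bound τ)

lemma ev2_hasSum (τ : ℝ) (x : WA) : HasSum (fun m : ℕ => coefL m x * (-(m : ℝ) ^ 2 * Real.cos (m * τ))) (ev2 τ x) := by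
  have := func_hasSum _ _ (ev2_bound τ) x
  refine this.congr_fun ?_
  intro m
  rw [raw_eq_coef]
  field_simp [(W_pos m).ne']

lemma ev_deriv (x : WA) (τ : ℝ) : HasDerivAt (fun τ => ev τ x) (∑' m : ℕ, coefL m x * (-Real.sin (m * τ) * m)) τ ∧
    HasDerivAt (fun τ => ∑' m : ℕ, coefL m x * (-Real.sin (m * τ) * m)) (ev2 τ x) τ := by
  have hs := summable_raw x
  have ds : ∀ (m : ℕ) y, HasDerivAt (fun y => Real.sin (m * y)) (Real.cos (m * y) * m) y := by
    intro m y
    simpa using ((hasDerivAt_id y).const_mul (m : ℝ)).sin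
  have dc : ∀ (m : ℕ) y, HasDerivAt (fun y => Real.cos (m * y)) (-Real.sin (m * y) * m) y := by
    intro m y
    simpa using ((hasDerivAt_id y).const_mul (m : ℝ)).cos
  have hb : ∀ (m : ℕ) (c : ℝ), |c| ≤ W m → ‖coefL m x * c‖ ≤ |rawL m x| := by
    intro m c hc
    rw [raw_eq_coef, abs_mul, norm_mul, Real.norm_eq_abs, Real.norm_eq_abs, abs_of_pos (W_pos m), mul_comm]
    exact mul_le_mul_of_nonneg_right hc (abs_nonneg _)
  have b1 : ∀ (m : ℕ) y, |-Real.sin (m * y) * m| ≤ W m := by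
    intro m y
    rw [abs_mul, abs_neg, abs_of_nonneg (Nat.cast_nonneg (α := ℝ) m)]
    have h1 := Real.abs_sin_le_one (m * y)
    have h2 : (m : ℝ) ≤ W m := by unfold W; nlinarith [Nat.cast_nonneg (α := ℝ) m]
    nlinarith [Nat.cast_nonneg (α := ℝ) m, abs_nonneg (Real.sin (m * y))]
  have b2 : ∀ (m : ℕ) y, |-(m : ℝ) ^ 2 * Real.cos (m * y)| ≤ W m := by
    intro m y
    have := ev2_bound y m
    rwa [abs_div, abs_of_pos (W_pos m), div_le_one (W_pos m)] at this
  constructor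
  · have h1 := hasDerivAt_tsum hs (fun m y => (dc m y).const_mul (coefL m x)) (fun m y => hb m _ (b1 m y))
      (y₀ := 0) (ev_hasSum 0 x).summable τ
    have e : (fun τ => ev τ x) = fun z => ∑' (n : ℕ), coefL n x * Real.cos (n * z) :=
      funext fun z => (ev_hasSum z x).tsum_eq.symm
    rw [e]; exact h1
  · have dsm : ∀ (m : ℕ) y, HasDerivAt (fun y => coefL m x * (-Real.sin (m * y) * m)) (coefL m x * (-(m : ℝ) ^ 2 * Real.cos (m * y))) y := by
      intro m y
      refine (((ds m y).neg.mul_const (m : ℝ)).const_mul (coefL m x)).congr_deriv ?_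
      ring
    have h1 := hasDerivAt_tsum hs dsm (fun m y => hb m _ (b2 m y))
      (y₀ := 0) (by simp [summable_zero]) τ
    rw [(ev2_hasSum τ x).tsum_eq] at h1
    exact h1

lemma cos_add_pi_mul (m : ℕ) (τ : ℝ) : Real.cos (m * (τ + Real.pi)) = (-1) ^ m * Real.cos (m * τ) := by
  rw [mul_add, Real.cos_add_nat_mul_pi]

lemma ev_shift_odd {x : WA} (h : ∀ m, ¬ Odd m → coefL m x = 0) (τ : ℝ) : ev (τ + Real.pi) x = - ev τ x := by
  refine (ev_hasSum (τ + Real.pi) x).unique ?_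
  refine (ev_hasSum τ x).neg.congr_fun fun m => ?_
  rw [cos_add_pi_mul]
  by_cases hm : Odd m
  · rw [hm.neg_one_pow]; ring
  · rw [h m hm]; ring

lemma sgn_bound (m : ℕ) : |(-1 : ℝ) ^ m| ≤ 1 := by simp [abs_pow]

lemma coef_of_shift {x : WA} (h : ∀ τ, ev (τ + Real.pi) x = - ev τ x) (m : ℕ) (hm : ¬ Odd m) : coefL m x = 0 := by
  have h1 : diag (fun m => (-1 : ℝ) ^ m) 1 sgn_bound x + x = 0 := by
    refine ev_inj fun τ => ?_
    rw [map_add]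
    have h2 : ev τ (diag (fun m => (-1 : ℝ) ^ m) 1 sgn_bound x) = ev (τ + Real.pi) x := by
      refine (ev_hasSum τ _).unique ((ev_hasSum (τ + Real.pi) x).congr_fun fun m => ?_)
      rw [cos_add_pi_mul, coef_diag]; ring
    rw [h2, h τ]; ring
  have h3 := congrArg (coefL m) h1
  rw [map_add, coef_diag, map_zero, (Nat.not_odd_iff_even.1 hm).neg_one_pow] at h3
  linarith

/-- compatibility of the abstract nonlinearity with `f` -/
def Rep (f : ℂ → ℂ) (N : NL) : Prop :=
  (∀ z, f (-z) = - f z) ∧ ∀ a, ‖a‖ < N.ρ → ∀ τ, (f ((ev τ a : ℝ) : ℂ)).re = (ev τ a) ^ 5 * ev τ (N.g a)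

section
variable {N : NL} {δ κ : ℝ} {q : ℝ → WA} {f : ℂ → ℂ}

lemma ev_NN (hf : Rep f N) {e : ℝ} {a : WA} (ha : ‖e • a‖ < N.ρ) (τ : ℝ) :
    e ^ 3 * ev τ (NN N e a) = 1 / 3 * (e * ev τ a) ^ 3 + (f ((e * ev τ a : ℝ) : ℂ)).re := by
  have h := hf.2 _ ha τ
  rw [map_smul, smul_eq_mul] at h
  rw [h]
  unfold NN NL.Q0
  rw [map_add, map_smul, map_smul, ev_mul, ev_pow, ev_pow]
  simp only [smul_eq_mul]
  ring

lemma vv_even (h : Adm N δ κ) (hq : BC 1 q) (hfix : ∀ y, Phi N δ κ q y = q y) (y : ℝ) (m : ℕ) (hm : ¬ Odd m) :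
    coefL m (vv κ q y) = 0 := by
  have h1 : m ≠ 1 := by rintro rfl; exact hm odd_one
  unfold vv
  rw [map_sub, map_smul, coef_e1, if_neg h1, DD_coef, coef_JJ_zero hq m (fun y => coef_q_zero h hq hfix y m hm)]
  simp

lemma pp_even (h : Adm N δ κ) (hq : BC 1 q) (hfix : ∀ y, Phi N δ κ q y = q y) (y : ℝ) (m : ℕ) (hm : ¬ Odd m) :
    coefL m (pp κ q y) = 0 := by
  have h1 : m ≠ 1 := by rintro rfl; exact hm odd_one
  rw [coef_pp y m h1, coef_q_zero h hq hfix y m hm]; simp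

lemma NN_even (hf : Rep f N) (h : Adm N δ κ) (hq : BC 1 q) (hfix : ∀ y, Phi N δ κ q y = q y) {y : ℝ} (hy : 0 ≤ y) (m : ℕ)
    (hm : ¬ Odd m) : coefL m (NN N (ee δ) (vv κ q y)) = 0 := by
  refine coef_of_shift (fun τ => ?_) m hm
  have he := ee_pos h.δ0
  have h1 := ev_NN hf (ev_lt h hq hy) τ
  have h2 := ev_NN hf (ev_lt h hq hy) (τ + Real.pi)
  rw [ev_shift_odd (vv_even h hq hfix y)] at h2
  have h3 : (f ((ee δ * -ev τ (vv κ q y) : ℝ) : ℂ)).re = - (f ((ee δ * ev τ (vv κ q y) : ℝ) : ℂ)).re := by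
    rw [mul_neg, Complex.ofReal_neg, hf.1, Complex.neg_re]
  rw [h3] at h2
  have h4 : ee δ ^ 3 * (ev (τ + Real.pi) (NN N (ee δ) (vv κ q y)) + ev τ (NN N (ee δ) (vv κ q y))) = 0 := by
    rw [mul_add, h1, h2]; ring
  have h5 : ee δ ^ 3 ≠ 0 := by positivity
  have := (mul_eq_zero.1 h4).resolve_left h5
  linarith

lemma mode_all (hf : Rep f N) (h : Adm N δ κ) (hq : BC 1 q) (hfix : ∀ y, Phi N δ κ q y = q y) (m : ℕ) {y : ℝ} (hy : 0 ≤ y) :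
    HasDerivWithinAt (fun y => coefL m (pp κ q y))
      ((1 + δ ^ 2 - (m : ℝ) ^ 2) / δ ^ 2 * coefL m (vv κ q y) - coefL m (NN N (ee δ) (vv κ q y))) (Set.Ici y) y := by
  by_cases hm : Odd m
  · by_cases h3 : 3 ≤ m
    · exact mode_osc h hq hfix m hm h3 hy
    · have : m = 1 := by
        obtain ⟨j, rfl⟩ := hm; omega
      subst this
      refine ((mode_one h hq hfix).1 y hy).congr_deriv ?_
      have := h.δ0.ne'
      field_simp
      push_cast
      ring
  · rw [vv_even h hq hfix y m hm, NN_even hf h hq hfix hy m hm]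
    simp only [pp_even h hq hfix _ m hm]
    simpa using hasDerivWithinAt_const y (Set.Ici y) (0 : ℝ)

def rho (N : NL) (δ κ : ℝ) (q : ℝ → WA) (τ y : ℝ) : ℝ :=
  ((1 + δ ^ 2) * ev τ (vv κ q y) + ev2 τ (vv κ q y)) / δ ^ 2 - ev τ (NN N (ee δ) (vv κ q y))

lemma NNcl_cont (h : Adm N δ κ) (hq : BC 1 q) : Continuous fun y => NN N (ee δ) (vv κ q (cl y)) := by
  refine continuous_iff_continuousAt.2 fun y => ?_
  exact ContinuousAt.comp (f := fun y => vv κ q (cl y)) (NN_cont_at (ev_lt h hq (cl_nn y))) ((vv_cont hq).comp cont_cl).continuousAt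

lemma rho_cont (h : Adm N δ κ) (hq : BC 1 q) (τ : ℝ) : Continuous fun y => rho N δ κ q τ (cl y) := by
  unfold rho
  have h1 := (vv_cont (κ := κ) hq).comp cont_cl
  have h2 := NNcl_cont h hq
  have h3 := (ev τ).continuous.comp h1
  have h4 := (ev2 τ).continuous.comp h1
  have h5 := (ev τ).continuous.comp h2
  exact (((continuous_const.mul h3).add h4).div_const _).sub h5

lemma ev_pp (hf : Rep f N) (h : Adm N δ κ) (hq : BC 1 q) (hfix : ∀ y, Phi N δ κ q y = q y) (τ : ℝ) {y : ℝ} (hy : 0 ≤ y) :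
    ev τ (pp κ q y) = ev τ (pp κ q 0) + ∫ s in (0:ℝ)..y, rho N δ κ q τ (cl s) := by
  have c1 : Continuous fun s => vv κ q (cl s) := (vv_cont (κ := κ) hq).comp cont_cl
  have c2 := NNcl_cont h hq
  set a := ∫ s in (0:ℝ)..y, vv κ q (cl s) with ha
  set b := ∫ s in (0:ℝ)..y, NN N (ee δ) (vv κ q (cl s)) with hb
  have i1 := c1.intervalIntegrable (μ := volume) 0 y
  have i2 := c2.intervalIntegrable (μ := volume) 0 y
  have hT : ∀ (T : WA →L[ℝ] ℝ), T a = ∫ s in (0:ℝ)..y, T (vv κ q (cl s)) := fun T =>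
    (ContinuousLinearMap.intervalIntegral_comp_comm T i1).symm
  have hS : ∀ (T : WA →L[ℝ] ℝ), T b = ∫ s in (0:ℝ)..y, T (NN N (ee δ) (vv κ q (cl s))) := fun T =>
    (ContinuousLinearMap.intervalIntegral_comp_comm T i2).symm
  have j1 : ∀ (T : WA →L[ℝ] ℝ), IntervalIntegrable (fun s => T (vv κ q (cl s))) volume 0 y := fun T =>
    (T.continuous.comp c1).intervalIntegrable _ _
  have j2 : ∀ (T : WA →L[ℝ] ℝ), IntervalIntegrable (fun s => T (NN N (ee δ) (vv κ q (cl s)))) volume 0 y := fun T =>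
    (T.continuous.comp c2).intervalIntegrable _ _
  have hm : ∀ m : ℕ, coefL m (pp κ q y - pp κ q 0) = (1 + δ ^ 2 - (m : ℝ) ^ 2) / δ ^ 2 * coefL m a - coefL m b := by
    intro m
    rw [map_sub, hT, hS, ← intervalIntegral.integral_const_mul, ← intervalIntegral.integral_sub ((j1 _).const_mul _) (j2 _)]
    symm
    refine intervalIntegral.integral_eq_sub_of_hasDeriv_right (f := fun y => coefL m (pp κ q y))
      ((coefL m).continuous.comp (pp_cont hq)).continuousOn (fun x hx => ?_) (((j1 _).const_mul _).sub (j2 _))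
    rw [min_eq_left hy] at hx
    rw [cl_eq hx.1.le]
    exact (mode_all hf h hq hfix m hx.1.le).mono Set.Ioi_subset_Ici_self
  have e1 : ev τ (pp κ q y - pp κ q 0) = ((1 + δ ^ 2) * ev τ a + ev2 τ a) / δ ^ 2 - ev τ b := by
    refine (ev_hasSum τ _).unique ?_
    refine (((((ev_hasSum τ a).mul_left (1 + δ ^ 2)).add (ev2_hasSum τ a)).div_const (δ ^ 2)).sub (ev_hasSum τ b)).congr_fun fun m => ?_
    rw [hm m]; ring
  have e2 : ∫ s in (0:ℝ)..y, rho N δ κ q τ (cl s) = ((1 + δ ^ 2) * ev τ a + ev2 τ a) / δ ^ 2 - ev τ b := by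
    unfold rho
    rw [intervalIntegral.integral_sub ((((j1 _).const_mul _).add (j1 _)).div_const _) (j2 _), intervalIntegral.integral_div,
      intervalIntegral.integral_add ((j1 _).const_mul _) (j1 _), intervalIntegral.integral_const_mul, ← hT, ← hT, ← hS]
  rw [e2, ← e1, map_sub]; ring

/-- profile extended to the whole line as a `C²` function -/
def UU (N : NL) (δ κ : ℝ) (q : ℝ → WA) (τ y : ℝ) : ℝ :=
  ev τ (vv κ q 0) + ∫ s in (0:ℝ)..y, (ev τ (pp κ q 0) + ∫ r in (0:ℝ)..s, rho N δ κ q τ (cl r))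

lemma UU_spec (hf : Rep f N) (h : Adm N δ κ) (hq : BC 1 q) (hfix : ∀ y, Phi N δ κ q y = q y) (τ : ℝ) :
    (∀ y, 0 ≤ y → UU N δ κ q τ y = ev τ (vv κ q y)) ∧
    (∀ y, HasDerivAt (UU N δ κ q τ) (ev τ (pp κ q 0) + ∫ r in (0:ℝ)..y, rho N δ κ q τ (cl r)) y) ∧
    (∀ y, HasDerivAt (fun y => ev τ (pp κ q 0) + ∫ r in (0:ℝ)..y, rho N δ κ q τ (cl r)) (rho N δ κ q τ (cl y)) y) := by
  have d2 : ∀ y, HasDerivAt (fun y => ev τ (pp κ q 0) + ∫ r in (0:ℝ)..y, rho N δ κ q τ (cl r)) (rho N δ κ q τ (cl y)) y :=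
    fun y => ((rho_cont h hq τ).integral_hasStrictDerivAt 0 y).hasDerivAt.const_add _
  have c : Continuous (fun y => ev τ (pp κ q 0) + ∫ r in (0:ℝ)..y, rho N δ κ q τ (cl r)) :=
    continuous_iff_continuousAt.2 fun y => (d2 y).continuousAt
  refine ⟨fun y hy => ?_, fun y => (c.integral_hasStrictDerivAt 0 y).hasDerivAt.const_add _, d2⟩
  unfold UU
  have : ∫ s in (0:ℝ)..y, (ev τ (pp κ q 0) + ∫ r in (0:ℝ)..s, rho N δ κ q τ (cl r)) = ∫ s in (0:ℝ)..y, ev τ (pp κ q s) := by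
    refine intervalIntegral.integral_congr fun s hs => ?_
    rw [Set.uIcc_of_le hy] at hs
    exact (ev_pp hf h hq hfix τ hs.1).symm
  rw [this, intervalIntegral.integral_eq_sub_of_hasDerivAt (f := fun y => ev τ (vv κ q y))
    (fun s _ => (ev τ).hasFDerivAt.comp_hasDerivAt s (hd_vv hq s)) (((ev τ).continuous.comp (pp_cont hq)).intervalIntegrable _ _)]
  ring

end
end KGP

namespace KGP

def dd : ℝ := -(Real.pi / 2)

lemma fC_hasSum {k : ℕ} {ω : ℝ} (hω : 0 < ω) (x : WA) (n : ℤ) :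
    HasSum (fun m : ℕ => (coefL m x : ℂ) * (Complex.I * (Complex.exp (Complex.I * m * dd) * (if (m * k : ℤ) = n then 1 else 0)
        + Complex.exp (-(Complex.I * m * dd)) * (if (m * k : ℤ) = -n then 1 else 0))))
      (fCoeff ω (fun t => ev (k * ω * t + dd) x) n) := by
  have h1 := hasSum_integral_ev x (fun t => k * ω * t + dd) (by fun_prop)
    (fun t => Complex.exp (-(Complex.I * (n : ℂ) * (ω : ℂ) * (t : ℂ)))) (by fun_prop)
    (by
      intro t
      rw [show (-(Complex.I * (n : ℂ) * (ω : ℂ) * (t : ℂ))) = ((-(n * ω * t) : ℝ) : ℂ) * Complex.I by push_cast; ring,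
        Complex.norm_exp_ofReal_mul_I]) (-(Real.pi / ω)) (Real.pi / ω)
  have h2 := h1.mul_left (Complex.I * (ω : ℂ) / (Real.pi : ℂ))
  refine h2.congr_fun fun m => ?_
  rw [integral_cos_exp k ω hω dd m n]
  have hpi : (Real.pi : ℂ) ≠ 0 := by exact_mod_cast Real.pi_ne_zero
  have hw : (ω : ℂ) ≠ 0 := by exact_mod_cast hω.ne'
  field_simp

lemma fC_zero {k : ℕ} {ω : ℝ} (hω : 0 < ω) (x : WA) (n : ℤ)
    (h : ∀ m : ℕ, (m * k : ℤ) = n ∨ (m * k : ℤ) = -n → coefL m x = 0) :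
    fCoeff ω (fun t => ev (k * ω * t + dd) x) n = 0 := by
  refine (fC_hasSum hω x n).unique ?_
  refine hasSum_zero.congr_fun fun m => ?_
  by_cases h1 : (m * k : ℤ) = n
  · simp [h m (Or.inl h1)]
  by_cases h2 : (m * k : ℤ) = -n
  · simp [h m (Or.inr h2)]
  simp [h1, h2]

lemma fC_norm {k : ℕ} {ω : ℝ} (hω : 0 < ω) (x : WA) (n : ℤ) :
    (‖fCoeff ω (fun t => ev (k * ω * t + dd) x) n‖₊ : ℝ≥0∞) ≤ ∑' m : ℕ, ENNReal.ofReal |coefL m x| *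
      ((if (m * k : ℤ) = n then 1 else 0) + (if -(m * k : ℤ) = n then 1 else 0)) := by
  have hs := fC_hasSum (k := k) hω x n
  have hexp : ∀ r : ℝ, ‖Complex.exp (Complex.I * r)‖ = 1 := fun r => by
    rw [mul_comm, Complex.norm_exp_ofReal_mul_I]
  have hb : ∀ m : ℕ, ‖(coefL m x : ℂ) * (Complex.I * (Complex.exp (Complex.I * m * dd) * (if (m * k : ℤ) = n then 1 else 0)
        + Complex.exp (-(Complex.I * m * dd)) * (if (m * k : ℤ) = -n then 1 else 0)))‖ₑ ≤ ENNReal.ofReal |coefL m x| *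
      ((if (m * k : ℤ) = n then 1 else 0) + (if -(m * k : ℤ) = n then 1 else 0)) := by
    intro m
    rw [enorm_mul, enorm_mul]
    have h0 : ‖(coefL m x : ℂ)‖ₑ = ENNReal.ofReal |coefL m x| := by
      rw [← ofReal_norm_eq_enorm, Complex.norm_real, Real.norm_eq_abs]
    have hI : ‖Complex.I‖ₑ = 1 := by rw [← ofReal_norm_eq_enorm]; simp
    rw [h0, hI, one_mul]
    gcongr
    refine (enorm_add_le _ _).trans ?_
    have e1 : ‖Complex.exp (Complex.I * m * dd)‖ₑ = 1 := by
      have := hexp (m * dd)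
      rw [← ofReal_norm_eq_enorm]
      push_cast at this
      rw [← mul_assoc] at this
      rw [this]; simp
    have e2 : ‖Complex.exp (-(Complex.I * m * dd))‖ₑ = 1 := by
      have := hexp (-(m * dd))
      rw [← ofReal_norm_eq_enorm]
      push_cast at this
      rw [mul_neg, ← mul_assoc] at this
      rw [this]; simp
    rw [enorm_mul, enorm_mul, e1, e2, one_mul, one_mul]
    refine add_le_add (le_of_eq ?_) (le_of_eq ?_)
    · split_ifs <;> simp
    · have : ((m * k : ℤ) = -n) ↔ (-(m * k : ℤ) = n) := ⟨fun h => by rw [h]; ring, fun h => by rw [← h]; ring⟩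
      simp only [this]
      split_ifs <;> simp
  refine le_trans ?_ (ENNReal.tsum_le_tsum hb)
  rw [← hs.tsum_eq]
  exact enorm_tsum_le_tsum_enorm

lemma l1_le {k : ℕ} (hk : 1 ≤ k) {ω : ℝ} (hω : 0 < ω) (x : WA) :
    l1op k ω (fun t => ev (k * ω * t + dd) x) ≤ ENNReal.ofReal (2 * ‖x‖) := by
  unfold l1op
  have hk0 : (k : ℝ) ≠ 0 := by positivity
  calc _ ≤ ∑' n : ℤ, ∑' m : ℕ, ENNReal.ofReal (1 + (n : ℝ) ^ 2 / (k : ℝ) ^ 2) * (ENNReal.ofReal |coefL m x| *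
      ((if (m * k : ℤ) = n then 1 else 0) + (if -(m * k : ℤ) = n then 1 else 0))) := by
        refine ENNReal.tsum_le_tsum fun n => ?_
        rw [ENNReal.tsum_mul_left]
        gcongr
        exact fC_norm hω x n
    _ = ∑' m : ℕ, ∑' n : ℤ, ENNReal.ofReal (1 + (n : ℝ) ^ 2 / (k : ℝ) ^ 2) * (ENNReal.ofReal |coefL m x| *
      ((if (m * k : ℤ) = n then 1 else 0) + (if -(m * k : ℤ) = n then 1 else 0))) := ENNReal.tsum_comm
    _ ≤ ∑' m : ℕ, ENNReal.ofReal (2 * |rawL m x|) := by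
        refine ENNReal.tsum_le_tsum fun m => ?_
        have e : ∀ j : ℤ, ((j : ℝ) = m * k ∨ (j : ℝ) = -(m * k)) →
            ∑' n : ℤ, ENNReal.ofReal (1 + (n : ℝ) ^ 2 / (k : ℝ) ^ 2) * (ENNReal.ofReal |coefL m x| * (if j = n then 1 else 0))
              ≤ ENNReal.ofReal |rawL m x| := by
          intro j hj
          rw [tsum_eq_single j (fun n hn => by rw [if_neg (Ne.symm hn)]; simp)]
          rw [if_pos rfl, mul_one, ← ENNReal.ofReal_mul (by positivity)]
          apply ENNReal.ofReal_le_ofReal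
          rw [raw_eq_coef, abs_mul, abs_of_pos (W_pos m)]
          apply mul_le_mul_of_nonneg_right _ (abs_nonneg _)
          have : (j : ℝ) ^ 2 / (k : ℝ) ^ 2 = (m : ℝ) ^ 2 := by
            rcases hj with h | h <;> rw [h] <;> field_simp
          rw [this]
          unfold W
          nlinarith [Nat.cast_nonneg (α := ℝ) m]
        simp_rw [mul_add]
        rw [ENNReal.tsum_add, two_mul, ENNReal.ofReal_add (abs_nonneg _) (abs_nonneg _)]
        refine add_le_add (e (m * k) (Or.inl (by push_cast; ring))) (e (-(m * k)) (Or.inr (by push_cast; ring)))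
    _ = ENNReal.ofReal (2 * ‖x‖) := by
        have h := (hasSum_raw x).mul_left 2
        rw [← h.tsum_eq, ENNReal.ofReal_tsum_of_nonneg (fun m => by positivity) h.summable]

lemma fC_neg (ω : ℝ) (w : ℝ → ℝ) (n : ℤ) : fCoeff ω (fun t => - w t) n = - fCoeff ω w n := by
  unfold fCoeff
  rw [← mul_neg, ← intervalIntegral.integral_neg]
  simp only [Complex.ofReal_neg, neg_mul]

lemma l1_neg (k : ℕ) (ω : ℝ) (w : ℝ → ℝ) : l1op k ω (fun t => - w t) = l1op k ω w := by
  unfold l1op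
  simp only [fC_neg, nnnorm_neg]

lemma KG_neg {f : ℂ → ℂ} {u : ℝ → ℝ → ℝ} (h : IsKGSolutionOn f (Set.Ici 0) u) :
    IsKGSolutionOn f (Set.Iic 0) (fun x t => u (-x) t) := by
  intro x hx t
  have h1 := h (-x) (by simpa using hx) t
  have e : ∀ s, deriv (fun s' => u (-s') t) s = - deriv (fun s' => u s' t) (-s) := fun s =>
    deriv_comp_neg (fun s' => u s' t) s
  have e2 : deriv (fun s => deriv (fun s' => u (-s') t) s) x = deriv (fun s => deriv (fun s' => u s' t) s) (-x) := by
    simp_rw [e]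
    rw [deriv.fun_neg, deriv_comp_neg (fun s => deriv (fun s' => u s' t) s) x, neg_neg]
  simp only [e2]
  exact h1

lemma vh_neg (y : ℝ) : vh (-y) = vh y := by simp [vh]
lemma vhd_neg (y : ℝ) : vhd (-y) = - vhd y := by simp [vhd]; ring
lemma deriv_vh (y : ℝ) : deriv vh y = vhd y := (hd_vh y).deriv

lemma ev_neg (τ : ℝ) (x : WA) : ev (-τ) x = ev τ x := by
  refine (ev_hasSum (-τ) x).unique ((ev_hasSum τ x).congr_fun fun m => ?_)
  rw [mul_neg, Real.cos_neg]

lemma ev_per (τ : ℝ) (k : ℕ) (x : WA) : ev (τ + k * (2 * Real.pi)) x = ev τ x := by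
  refine (ev_hasSum _ x).unique ((ev_hasSum τ x).congr_fun fun m => ?_)
  have : (m : ℝ) * (τ + k * (2 * Real.pi)) = m * τ + ((m * k : ℕ) : ℝ) * (2 * Real.pi) := by push_cast; ring
  rw [this, Real.cos_add_nat_mul_two_pi]

end KGP

namespace KGP

/-- the stable solution -/
def usol (N : NL) (δ κ : ℝ) (q : ℝ → WA) (k : ℕ) (ω : ℝ) (x t : ℝ) : ℝ :=
  ee δ * UU N δ κ q (k * ω * t + dd) (ee δ * x)

section
variable {N : NL} {δ κ : ℝ} {q : ℝ → WA} {f : ℂ → ℂ} {k : ℕ} {ω : ℝ}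

lemma usol_eq (hf : Rep f N) (h : Adm N δ κ) (hq : BC 1 q) (hfix : ∀ y, Phi N δ κ q y = q y) {x : ℝ} (hx : 0 ≤ x) :
    usol N δ κ q k ω x = fun t => ev (k * ω * t + dd) (ee δ • vv κ q (ee δ * x)) := by
  funext t
  unfold usol
  rw [(UU_spec hf h hq hfix _).1 _ (mul_nonneg (ee_pos h.δ0).le hx), map_smul, smul_eq_mul]

lemma usol_d1 (hf : Rep f N) (h : Adm N δ κ) (hq : BC 1 q) (hfix : ∀ y, Phi N δ κ q y = q y) (x t : ℝ) :
    deriv (fun x' => usol N δ κ q k ω x' t) x = ee δ * (ee δ * (ev (k * ω * t + dd) (pp κ q 0) +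
      ∫ r in (0:ℝ)..(ee δ * x), rho N δ κ q (k * ω * t + dd) (cl r))) := by
  have h1 := (UU_spec hf h hq hfix (k * ω * t + dd)).2.1 (ee δ * x)
  have h2 : HasDerivAt (fun x => ee δ * x) (ee δ) x := by simpa using (hasDerivAt_id x).const_mul (ee δ)
  have h3 := (h1.comp x h2).const_mul (ee δ)
  refine (h3.deriv).trans ?_
  ring

lemma usol_d1' (hf : Rep f N) (h : Adm N δ κ) (hq : BC 1 q) (hfix : ∀ y, Phi N δ κ q y = q y) {x : ℝ} (hx : 0 ≤ x) (t : ℝ) :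
    deriv (fun x' => usol N δ κ q k ω x' t) x = ee δ * (ee δ * ev (k * ω * t + dd) (pp κ q (ee δ * x))) := by
  rw [usol_d1 hf h hq hfix, ← ev_pp hf h hq hfix _ (mul_nonneg (ee_pos h.δ0).le hx)]

lemma usol_d2 (hf : Rep f N) (h : Adm N δ κ) (hq : BC 1 q) (hfix : ∀ y, Phi N δ κ q y = q y) {x : ℝ} (hx : 0 ≤ x) (t : ℝ) :
    deriv (fun s => deriv (fun x' => usol N δ κ q k ω x' t) s) x = ee δ ^ 3 * rho N δ κ q (k * ω * t + dd) (ee δ * x) := by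
  simp_rw [usol_d1 hf h hq hfix]
  have h1 := (UU_spec hf h hq hfix (k * ω * t + dd)).2.2 (ee δ * x)
  have h2 : HasDerivAt (fun x => ee δ * x) (ee δ) x := by simpa using (hasDerivAt_id x).const_mul (ee δ)
  have h3 := ((h1.comp x h2).const_mul (ee δ)).const_mul (ee δ)
  refine (h3.deriv).trans ?_
  rw [cl_eq (mul_nonneg (ee_pos h.δ0).le hx)]
  ring

lemma ev_t2 (x : WA) (c t : ℝ) : deriv (fun s => deriv (fun s' => ev (c * s' + dd) x) s) t = c ^ 2 * ev2 (c * t + dd) x := by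
  have hl : ∀ s, HasDerivAt (fun s => c * s + dd) c s := fun s => by
    simpa using ((hasDerivAt_id s).const_mul c).add_const dd
  have h1 : ∀ s, deriv (fun s' => ev (c * s' + dd) x) s = (∑' m : ℕ, coefL m x * (-Real.sin (m * (c * s + dd)) * m)) * c :=
    fun s => (HasDerivAt.comp (h₂ := fun τ => ev τ x) s (ev_deriv x (c * s + dd)).1 (hl s)).deriv
  simp_rw [h1]
  have h2 := (HasDerivAt.comp (h₂ := fun τ => ∑' m : ℕ, coefL m x * (-Real.sin (m * τ) * m)) t (ev_deriv x (c * t + dd)).2 (hl t)).mul_const c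
  refine h2.deriv.trans ?_
  ring

lemma usol_KG (hf : Rep f N) (h : Adm N δ κ) (hq : BC 1 q) (hfix : ∀ y, Phi N δ κ q y = q y)
    (hk : k * ω = 1 / Real.sqrt (1 + δ ^ 2)) : IsKGSolutionOn f (Set.Ici 0) (usol N δ κ q k ω) := by
  intro x hx t
  have hx' : 0 ≤ x := hx
  rw [usol_d2 hf h hq hfix hx', usol_eq hf h hq hfix hx', ev_t2]
  have hy : 0 ≤ ee δ * x := mul_nonneg (ee_pos h.δ0).le hx'
  have h1 := ev_NN hf (ev_lt h hq hy) (k * ω * t + dd)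
  unfold rho
  simp only [map_smul, smul_eq_mul]
  set V := ev (k * ω * t + dd) (vv κ q (ee δ * x))
  set V2 := ev2 (k * ω * t + dd) (vv κ q (ee δ * x))
  set NV := ev (k * ω * t + dd) (NN N (ee δ) (vv κ q (ee δ * x)))
  have hδ := h.δ0.ne'
  have e1 : ee δ ^ 2 = δ ^ 2 * (k * ω) ^ 2 := by unfold ee; rw [hk]; ring
  have e2 : (k * ω) ^ 2 * (1 + δ ^ 2) = 1 := by
    rw [hk, div_pow, Real.sq_sqrt (by positivity)]; field_simp
  have e3 : ee δ ^ 3 * (((1 + δ ^ 2) * V + V2) / δ ^ 2) = ee δ * V + ee δ * (k * ω) ^ 2 * V2 := by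
    have : ee δ ^ 3 = ee δ * (δ ^ 2 * (k * ω) ^ 2) := by rw [← e1]; ring
    rw [this]
    have : ee δ * (δ ^ 2 * (k * ω) ^ 2) * (((1 + δ ^ 2) * V + V2) / δ ^ 2) = ee δ * (((k * ω) ^ 2 * (1 + δ ^ 2)) * V + (k * ω) ^ 2 * V2) := by
      field_simp
    rw [this, e2]; ring
  rw [mul_sub, e3, h1]
  ring

lemma dd_sin (a : ℝ) : Real.sin a = ev (a + dd) e1 := by
  unfold e1 dd
  rw [ev_cosE, ← sub_eq_add_neg, Nat.cast_one, one_mul, Real.cos_sub_pi_div_two]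

lemma err_bound {C : ℝ} (h : Adm N δ κ) (hb : ∀ y, ‖q y‖ ≤ C * δ ^ 2) (hC : 0 ≤ C) {y : ℝ} (hy : 0 ≤ y) {z : WA} (hz : ‖z‖ ≤ C * δ ^ 2) :
    ‖ee δ • DD κ (Real.exp (-y) • z)‖ ≤ C * δ ^ 3 * vh y := by
  have he := ee_pos h.δ0
  rw [norm_smul, Real.norm_of_nonneg he.le]
  have h1 := DD_norm h.κ0 h.κ1 (Real.exp (-y) • z)
  rw [norm_smul, Real.norm_of_nonneg (Real.exp_pos _).le] at h1
  have h2 := exp_le_vh hy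
  have h3 := mul_le_mul h2 hz (norm_nonneg _) (vh_pos y).le
  have h4 := mul_le_mul (ee_le h.δ0) (h1.trans h3) (norm_nonneg _) h.δ0.le
  refine h4.trans (le_of_eq (by ring))

lemma usol_bound {C : ℝ} (hf : Rep f N) (h : Adm N δ κ) (hq : BC 1 q) (hfix : ∀ y, Phi N δ κ q y = q y)
    (hb : ∀ y, ‖q y‖ ≤ C * δ ^ 2) (hC : 0 ≤ C) (hk : 1 ≤ k) (hω : 0 < ω) {x : ℝ} (hx : 0 ≤ x) :
    l1op k ω (fun t => usol N δ κ q k ω x t - ee δ * vh (ee δ * x) * Real.sin (k * ω * t))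
    + l1op k ω (fun t => deriv (fun x' => usol N δ κ q k ω x' t) x / ee δ - ee δ * vhd (ee δ * x) * Real.sin (k * ω * t))
    ≤ ENNReal.ofReal ((4 * C + 1) * δ ^ 3 * vh (ee δ * x)) := by
  have he := ee_pos h.δ0
  have hy : 0 ≤ ee δ * x := mul_nonneg he.le hx
  set y := ee δ * x with hyd
  have f1 : (fun t => usol N δ κ q k ω x t - ee δ * vh y * Real.sin (k * ω * t))
      = fun t => - ev (k * ω * t + dd) (ee δ • DD κ (Real.exp (-y) • JJ q y)) := by
    funext t
    rw [usol_eq hf h hq hfix hx, dd_sin, ← hyd]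
    simp only [vv, smul_sub, map_sub, map_smul, smul_eq_mul]
    ring
  have f2 : (fun t => deriv (fun x' => usol N δ κ q k ω x' t) x / ee δ - ee δ * vhd y * Real.sin (k * ω * t))
      = fun t => ev (k * ω * t + dd) (ee δ • DD κ (Real.exp (-y) • q y)) := by
    funext t
    rw [usol_d1' hf h hq hfix hx, dd_sin, ← hyd]
    simp only [pp, smul_add, map_add, map_smul, smul_eq_mul]
    field_simp
    ring
  rw [f1, f2, l1_neg]
  have b1 := err_bound h hb hC hy (JJ_norm hb y)
  have b2 := err_bound h hb hC hy (hb y)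
  refine (add_le_add (l1_le hk hω _) (l1_le hk hω _)).trans ?_
  rw [← ENNReal.ofReal_add (by positivity) (by positivity)]
  apply ENNReal.ofReal_le_ofReal
  have : 0 ≤ δ ^ 3 * vh y := mul_nonneg (pow_nonneg h.δ0.le 3) (vh_pos y).le
  linarith

end
end KGP


open KGP


/-- existence of the weak stable/unstable solutions `u_wk^s`, `u_wk^u` of (KG),
`2π/ω`-periodic and odd in `t`, supported on the Fourier modes `n ∈ kℤ` with `n/k` odd,
normalized by `Π_k[∂_x u_wk^⋆(0,·)] = 0` and approximated by the rescaled Duffing homoclinic. -/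
theorem statement3 (f : ℂ → ℂ) (hf : AssumptionA f) :
    ∃ ε₀ : ℝ, 0 < ε₀ ∧ ∃ M : ℝ, 0 < M ∧
      ∀ k : ℕ, 1 ≤ k → ∀ ε : ℝ, 0 < ε → ε ≤ ε₀ →
        ∀ ω : ℝ, ω = 1 / Real.sqrt (k * (k + ε ^ 2)) →
          ∃ us uu : ℝ → ℝ → ℝ,
            IsKGSolutionOn f (Set.Ici 0) us ∧ IsKGSolutionOn f (Set.Iic 0) uu ∧
            -- periodicity and oddness in t
            (∀ x ∈ Set.Ici (0:ℝ), ∀ t, us x (t + 2 * Real.pi / ω) = us x t ∧ us x (-t) = - us x t) ∧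
            (∀ x ∈ Set.Iic (0:ℝ), ∀ t, uu x (t + 2 * Real.pi / ω) = uu x t ∧ uu x (-t) = - uu x t) ∧
            -- Fourier support: only modes n ∈ kℤ with n/k odd
            (∀ x ∈ Set.Ici (0:ℝ), ∀ n : ℤ, (¬ ∃ m : ℤ, n = k * m ∧ Odd m) → fCoeff ω (us x) n = 0) ∧
            (∀ x ∈ Set.Iic (0:ℝ), ∀ n : ℤ, (¬ ∃ m : ℤ, n = k * m ∧ Odd m) → fCoeff ω (uu x) n = 0) ∧
            -- normalization Π_k[∂_x u_wk^⋆(0,·)] = 0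
            fCoeff ω (fun t => deriv (fun x' => us x' t) 0) k = 0 ∧
            fCoeff ω (fun t => deriv (fun x' => uu x' t) 0) k = 0 ∧
            -- approximation bound on the corresponding half-lines
            (∀ x ∈ Set.Ici (0:ℝ),
              l1op k ω (fun t =>
                  us x t - Real.sqrt k * ε * ω * vh (ε * Real.sqrt k * ω * x)
                    * Real.sin (k * ω * t))
                + l1op k ω (fun t =>
                    deriv (fun x' => us x' t) x / (Real.sqrt k * ε * ω)
                      - Real.sqrt k * ε * ω * deriv vh (ε * Real.sqrt k * ω * x)
                        * Real.sin (k * ω * t))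
                ≤ ENNReal.ofReal
                    (M * (k : ℝ) ^ (-(3 : ℝ) / 2) * ε ^ 3 * vh (ε * Real.sqrt k * ω * x))) ∧
            (∀ x ∈ Set.Iic (0:ℝ),
              l1op k ω (fun t =>
                  uu x t - Real.sqrt k * ε * ω * vh (ε * Real.sqrt k * ω * x)
                    * Real.sin (k * ω * t))
                + l1op k ω (fun t =>
                    deriv (fun x' => uu x' t) x / (Real.sqrt k * ε * ω)
                      - Real.sqrt k * ε * ω * deriv vh (ε * Real.sqrt k * ω * x)
                        * Real.sin (k * ω * t))
                ≤ ENNReal.ofReal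
                    (M * (k : ℝ) ^ (-(3 : ℝ) / 2) * ε ^ 3 * vh (ε * Real.sqrt k * ω * x))) := by
  obtain ⟨g, g', ρ, hρ, C0, hC0, hr, hd, hl⟩ := nonlin hf
  let N : NL := ⟨g, g', ρ, C0, hρ, hC0, fun a ha => (hd a ha).1, fun a ha => (hd a ha).2.1, fun a ha => (hd a ha).2.2,
    fun a b ha hb => (hl a b ha hb).1, fun a b ha hb => (hl a b ha hb).2⟩
  have hR : Rep f N := ⟨hf.2.1, hr⟩
  obtain ⟨κ, δ₀, C, hδ₀, hC, hmain⟩ := exists_fix N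
  refine ⟨δ₀, hδ₀, 4 * C + 1, by positivity, ?_⟩
  intro k hk ε hε0 hε ω hω
  have hk1 : (1 : ℝ) ≤ k := by exact_mod_cast hk
  have hk0 : (0 : ℝ) < k := by linarith
  have hsk : 0 < Real.sqrt k := Real.sqrt_pos.2 hk0
  have hsq : Real.sqrt k * Real.sqrt k = k := Real.mul_self_sqrt hk0.le
  set δ := ε / Real.sqrt k with hδ
  have hδ0 : 0 < δ := by positivity
  have hδ1 : δ ≤ δ₀ := by
    refine le_trans ?_ hε
    rw [hδ, div_le_iff₀ hsk]
    have : 1 ≤ Real.sqrt k := by rw [Real.one_le_sqrt]; exact hk1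
    nlinarith
  obtain ⟨h, q, hq, hfix, hb⟩ := hmain δ hδ0 hδ1
  have hω0 : 0 < ω := by rw [hω]; positivity
  have hδ2 : 1 + δ ^ 2 = (k + ε ^ 2) / k := by
    rw [hδ, div_pow, Real.sq_sqrt hk0.le]; field_simp
  have hkω : k * ω = 1 / Real.sqrt (1 + δ ^ 2) := by
    have e : (k : ℝ) * (k + ε ^ 2) = (k : ℝ) ^ 2 * (1 + δ ^ 2) := by rw [hδ2]; field_simp
    rw [hω, e, Real.sqrt_mul (by positivity), Real.sqrt_sq hk0.le]
    have : Real.sqrt (1 + δ ^ 2) ≠ 0 := by positivity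
    field_simp
  have hee : Real.sqrt k * ε * ω = ee δ := by
    have h1 : ee δ = δ * (k * ω) := by unfold ee; rw [hkω]; ring
    rw [h1, hδ, div_mul_eq_mul_div, eq_div_iff hsk.ne']
    linear_combination (ε * ω) * hsq
  have hee2 : ε * Real.sqrt k * ω = ee δ := by rw [← hee]; ring
  have hpow : (k : ℝ) ^ (-(3 : ℝ) / 2) * ε ^ 3 = δ ^ 3 := by
    have h3 : (Real.sqrt k) ^ 3 = (k : ℝ) ^ ((3 : ℝ) / 2) := by
      rw [Real.sqrt_eq_rpow, ← Real.rpow_natCast, ← Real.rpow_mul hk0.le]; norm_num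
    rw [hδ, div_pow, h3, neg_div, Real.rpow_neg hk0.le]
    ring
  have hper : ∀ x, 0 ≤ x → ∀ t, usol N δ κ q k ω x (t + 2 * Real.pi / ω) = usol N δ κ q k ω x t ∧
      usol N δ κ q k ω x (-t) = - usol N δ κ q k ω x t := by
    intro x hx t
    rw [usol_eq hR h hq hfix hx]
    constructor
    · simp only
      have : k * ω * (t + 2 * Real.pi / ω) + dd = (k * ω * t + dd) + k * (2 * Real.pi) := by field_simp; ring
      rw [this, ev_per]
    · simp only
      have : k * ω * (-t) + dd = -((k * ω * t + dd) + Real.pi) := by unfold dd; ring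
      rw [this, ev_neg, map_smul, map_smul, ev_shift_odd (vv_even h hq hfix _)]
      simp
  have hsupp : ∀ x, 0 ≤ x → ∀ n : ℤ, (¬ ∃ m : ℤ, n = k * m ∧ Odd m) → fCoeff ω (usol N δ κ q k ω x) n = 0 := by
    intro x hx n hn
    rw [usol_eq hR h hq hfix hx]
    refine fC_zero hω0 _ n fun m hm => ?_
    rw [map_smul, vv_even h hq hfix _ m, smul_zero]
    intro ho
    have ho' : Odd (m : ℤ) := by exact_mod_cast ho
    rcases hm with hm | hm
    · exact hn ⟨m, by rw [← hm]; ring, ho'⟩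
    · exact hn ⟨-m, by linarith, ho'.neg⟩
  have hnorm : fCoeff ω (fun t => deriv (fun x' => usol N δ κ q k ω x' t) 0) k = 0 := by
    have e : (fun t => deriv (fun x' => usol N δ κ q k ω x' t) 0) = fun t => ev (k * ω * t + dd) ((ee δ * ee δ) • pp κ q 0) := by
      funext t
      rw [usol_d1' hR h hq hfix le_rfl, mul_zero, map_smul, smul_eq_mul]
      ring
    rw [e]
    refine fC_zero hω0 _ _ fun m hm => ?_
    have hkz : (1 : ℤ) ≤ k := by exact_mod_cast hk
    have hm1 : m = 1 := by
      rcases hm with hm | hm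
      · have : (m : ℤ) = 1 := by nlinarith
        exact_mod_cast this
      · have : (0 : ℤ) ≤ m := Int.natCast_nonneg m
        nlinarith
    rw [hm1, map_smul, (mode_one h hq hfix).2, smul_zero]
  have hbd := fun x hx => usol_bound (k := k) (ω := ω) (x := x) hR h hq hfix hb hC hk hω0 hx
  refine ⟨usol N δ κ q k ω, fun x t => usol N δ κ q k ω (-x) t, usol_KG hR h hq hfix hkω,
    KG_neg (usol_KG hR h hq hfix hkω), hper, fun x hx => hper (-x) (by simpa using hx), hsupp,
    fun x hx => hsupp (-x) (by simpa using hx), hnorm, ?_, ?_, ?_⟩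
  · have e : ∀ t, deriv (fun x' => usol N δ κ q k ω (-x') t) 0 = - deriv (fun x' => usol N δ κ q k ω x' t) 0 := by
      intro t
      rw [deriv_comp_neg (fun s' => usol N δ κ q k ω s' t) 0, neg_zero]
    simp_rw [e]
    rw [fC_neg, hnorm, neg_zero]
  · intro x hx
    rw [hee, hee2, mul_assoc (4 * C + 1), hpow]
    simp_rw [deriv_vh]
    exact hbd x hx
  · intro x hx
    rw [hee, hee2, mul_assoc (4 * C + 1), hpow]
    have e : ∀ t, deriv (fun x' => usol N δ κ q k ω (-x') t) x = - deriv (fun x' => usol N δ κ q k ω x' t) (-x) := by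
      intro t
      rw [deriv_comp_neg (fun s' => usol N δ κ q k ω s' t) x]
    simp_rw [e, deriv_vh]
    have h1 := hbd (-x) (by simpa using hx)
    rw [mul_neg, vh_neg, vhd_neg] at h1
    have e2 : (fun t => -deriv (fun x' => usol N δ κ q k ω x' t) (-x) / ee δ - ee δ * vhd (ee δ * x) * Real.sin (k * ω * t))
        = fun t => -(deriv (fun x' => usol N δ κ q k ω x' t) (-x) / ee δ - ee δ * -vhd (ee δ * x) * Real.sin (k * ω * t)) := by
      funext t; ring
    rw [e2, l1_neg]
    exact h1
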